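/- Let G be a finite simple graph. The cut polytope Cut(G) is compressed if and only if G has no K₅ minor and every induced cycle in G has length at most 4. (Theorem 3.6 of the paper.) -/

import Mathlib

noncomputable section

/-- The unit hypercube `[0,1]^N ⊆ ℝ^N`. -/
def stdCube (N : ℕ) : Set (Fin N → ℝ) := {x | ∀ i, x i ∈ Set.Icc (0 : ℝ) 1}

/-- The set of `0/1` points `{0,1}^N ⊆ ℝ^N`. -/
def zeroOneSet (N : ℕ) : Set (Fin N → ℝ) := {x | ∀ i, x i = 0 ∨ x i = 1}

/-- A polytope presented as the convex hull of a finite set `A` of integer points in `ℝ^E`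
is compressed (characterization (3) of the paper's Theorem 2.4): there are `N ∈ ℕ` and an
affine map `π : ℝ^E → ℝ^N`, injective on `conv A`, mapping every point of `conv A` lying in
the subgroup of `ℤ^E` generated by `A` into `{0,1}^N`, with
`π(conv A) = [0,1]^N ∩ affineSpan ℝ (π(conv A))`. -/
def IsCompressed {E : Type*} (A : Set (E → ℝ)) : Prop :=
  ∃ (N : ℕ) (π : (E → ℝ) →ᵃ[ℝ] (Fin N → ℝ)),
    Set.InjOn π (convexHull ℝ A) ∧
    (∀ x ∈ convexHull ℝ A ∩ (AddSubgroup.closure A : Set (E → ℝ)), π x ∈ zeroOneSet N) ∧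
    π '' convexHull ℝ A
      = stdCube N ∩ (affineSpan ℝ (π '' convexHull ℝ A) : Set (Fin N → ℝ))

open Classical in
/-- The cut semimetric `δ_G(S) ∈ ℝ^E` of a subset `S` of the vertices of `G`: the coordinate
at an edge is `1` if exactly one of its endpoints lies in `S`, and `0` otherwise. -/
noncomputable def cutVec {V : Type*} (G : SimpleGraph V) (S : Set V) : G.edgeSet → ℝ :=
  fun e =>
    if Sym2.lift ⟨fun u v => ((u ∈ S) ↔ (v ∈ S)), fun _ _ => propext iff_comm⟩ e.1
    then 0 else 1

/-- `G` has a `K₅` minor: five pairwise disjoint nonempty vertex subsets, each inducing a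
connected subgraph, with an edge of `G` between every two of them. -/
def HasK5Minor {V : Type*} (G : SimpleGraph V) : Prop :=
  ∃ B : Fin 5 → Set V,
    (∀ i, (B i).Nonempty) ∧
    (∀ i j, i ≠ j → Disjoint (B i) (B j)) ∧
    (∀ i, (G.induce (B i)).Connected) ∧
    (∀ i j, i ≠ j → ∃ u ∈ B i, ∃ v ∈ B j, G.Adj u v)

/-- Every induced cycle of `G` has length at most `4`: for every `k ≥ 3`, every injective
`v : ℤ/k → V` with `v i ~ v j` exactly when `i − j ≡ ±1 (mod k)` forces `k ≤ 4`. -/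
def InducedCyclesLe4 {V : Type*} (G : SimpleGraph V) : Prop :=
  ∀ k : ℕ, 3 ≤ k → ∀ v : ZMod k → V, Function.Injective v →
    (∀ i j, G.Adj (v i) (v j) ↔ (i - j = 1 ∨ j - i = 1)) → k ≤ 4

section ConnectedSets

variable {V : Type*} {G : SimpleGraph V}

/-- `A` is nonempty and induces a connected subgraph of `G`: it has no proper nonempty part
closed under adjacency. -/
def ConnectedOn (G : SimpleGraph V) (A : Set V) : Prop :=
  A.Nonempty ∧ ∀ X ⊆ A, X.Nonempty → (∀ a ∈ X, ∀ b ∈ A, G.Adj a b → b ∈ X) → A ⊆ X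

/-- Some edge of `G` joins `A` to `B`. -/
def Linked (G : SimpleGraph V) (A B : Set V) : Prop := ∃ a ∈ A, ∃ b ∈ B, G.Adj a b

lemma Linked.symm {A B : Set V} (h : Linked G A B) : Linked G B A := by
  obtain ⟨a, ha, b, hb, hab⟩ := h
  exact ⟨b, hb, a, ha, hab.symm⟩

lemma Linked.mono {A B A' B' : Set V} (h : Linked G A B) (hA : A ⊆ A') (hB : B ⊆ B') :
    Linked G A' B' := by
  obtain ⟨a, ha, b, hb, hab⟩ := h
  exact ⟨a, hA ha, b, hB hb, hab⟩

lemma connectedOn_singleton (v : V) : ConnectedOn G {v} := by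
  refine ⟨⟨v, rfl⟩, fun X hX hne _ => ?_⟩
  obtain ⟨x, hx⟩ := hne
  obtain rfl := hX hx
  simpa using hx

lemma ConnectedOn.exists_crossing {A Y : Set V} (h : ConnectedOn G A) {a b : V} (ha : a ∈ A)
    (haY : a ∈ Y) (hb : b ∈ A) (hbY : b ∉ Y) :
    ∃ c ∈ A, c ∈ Y ∧ ∃ d ∈ A, d ∉ Y ∧ G.Adj c d := by
  by_contra! hcon
  have := h.2 (A ∩ Y) Set.inter_subset_left ⟨a, ha, haY⟩ (fun c hc d hd hcd => by
    by_contra hdY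
    exact hcon c hc.1 hc.2 d hd (fun h' => hdY ⟨hd, h'⟩) hcd)
  exact hbY (this hb).2

lemma connectedOn_of_crossing {A : Set V} {v : V} (hv : v ∈ A)
    (h : ∀ X ⊆ A, v ∈ X → X ≠ A → ∃ c ∈ X, ∃ d ∈ A, d ∉ X ∧ G.Adj c d) :
    ConnectedOn G A := by
  refine ⟨⟨v, hv⟩, fun X hX hne hcl => ?_⟩
  have closed_eq : ∀ Y ⊆ A, v ∈ Y → (∀ a ∈ Y, ∀ b ∈ A, G.Adj a b → b ∈ Y) → Y = A := by
    intro Y hY hvY hYcl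
    by_contra hne
    obtain ⟨c, hc, d, hd, hdY, hcd⟩ := h Y hY hvY hne
    exact hdY (hYcl c hc d hd hcd)
  by_cases hvX : v ∈ X
  · exact (closed_eq X hX hvX hcl).ge
  · have := closed_eq (A \ X) Set.sdiff_subset ⟨hv, hvX⟩
      (fun a ha b hb hab => ⟨hb, fun hbX => ha.2 (hcl b hbX a ha.1 hab.symm)⟩)
    obtain ⟨x, hx⟩ := hne
    exact absurd hx (this.ge (hX hx)).2

lemma ConnectedOn.union_of_mem {A B : Set V} (hA : ConnectedOn G A) (hB : ConnectedOn G B) {v : V}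
    (hvA : v ∈ A) (hvB : v ∈ B) : ConnectedOn G (A ∪ B) := by
  refine connectedOn_of_crossing (Or.inl hvA) fun X hX hvX hne => ?_
  obtain ⟨d, hd, hdX⟩ := Set.exists_of_ssubset (hX.ssubset_of_ne hne)
  rcases hd with hd | hd
  · obtain ⟨c, hc, hcX, e, he, heX, hce⟩ := hA.exists_crossing hvA hvX hd hdX
    exact ⟨c, hcX, e, Or.inl he, heX, hce⟩
  · obtain ⟨c, hc, hcX, e, he, heX, hce⟩ := hB.exists_crossing hvB hvX hd hdX
    exact ⟨c, hcX, e, Or.inr he, heX, hce⟩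

lemma connectedOn_pair {u v : V} (h : G.Adj u v) : ConnectedOn G {u, v} := by
  refine connectedOn_of_crossing (v := u) (by simp) fun X hX huX hne => ?_
  refine ⟨u, huX, v, by simp, fun hvX => hne (hX.antisymm ?_), h⟩
  rintro x (rfl | rfl) <;> assumption

lemma ConnectedOn.union {A B : Set V} (hA : ConnectedOn G A) (hB : ConnectedOn G B)
    (h : Linked G A B) : ConnectedOn G (A ∪ B) := by
  obtain ⟨a, ha, b, hb, hab⟩ := h
  have h1 := hA.union_of_mem (connectedOn_pair hab) ha (by simp)
  have h2 := h1.union_of_mem hB (v := b) (by simp) hb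
  have : A ∪ {a, b} ∪ B = A ∪ B := by
    ext x; simp only [Set.mem_union, Set.mem_insert_iff, Set.mem_singleton_iff]
    constructor
    · rintro ((h | rfl | rfl) | h) <;> tauto
    · tauto
  rwa [this] at h2

lemma ConnectedOn.insert {A : Set V} (hA : ConnectedOn G A) {v a : V} (ha : a ∈ A)
    (h : G.Adj v a) : ConnectedOn G (insert v A) := by
  rw [Set.insert_eq]
  exact (connectedOn_singleton v).union hA ⟨v, rfl, a, ha, h⟩

/-- The component of `v` in the subgraph induced by `X`. -/
lemma exists_component {X : Set V} {v : V} (hv : v ∈ X) :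
    ∃ C ⊆ X, v ∈ C ∧ ConnectedOn G C ∧ ∀ a ∈ C, ∀ b ∈ X, G.Adj a b → b ∈ C := by
  set F : Set (Set V) := {C | C ⊆ X ∧ v ∈ C ∧ ConnectedOn G C}
  have hvF : {v} ∈ F := ⟨by simpa using hv, rfl, connectedOn_singleton v⟩
  refine ⟨⋃₀ F, ?_, ⟨{v}, hvF, rfl⟩, ?_, ?_⟩
  · exact Set.sUnion_subset fun C hC => hC.1
  · refine connectedOn_of_crossing (v := v) ⟨{v}, hvF, rfl⟩ fun Y hY hvY hne => ?_
    obtain ⟨d, ⟨C, hC, hd⟩, hdY⟩ := Set.exists_of_ssubset (hY.ssubset_of_ne hne)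
    obtain ⟨c, hc, hcX, e, he, heX, hce⟩ := hC.2.2.exists_crossing hC.2.1 hvY hd hdY
    exact ⟨c, hcX, e, ⟨C, hC, he⟩, heX, hce⟩
  · rintro a ⟨C, hC, ha⟩ b hb hab
    refine ⟨insert b C, ⟨Set.insert_subset hb hC.1, Or.inr hC.2.1, hC.2.2.insert ha hab.symm⟩,
      Or.inl rfl⟩

lemma ConnectedOn.of_connected_induce {A : Set V} (h : (G.induce A).Connected) :
    ConnectedOn G A := by
  obtain ⟨⟨v, hv⟩⟩ := h.nonempty
  refine connectedOn_of_crossing hv fun X hX hvX hne => ?_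
  obtain ⟨d, hd, hdX⟩ := Set.exists_of_ssubset (hX.ssubset_of_ne hne)
  obtain ⟨p⟩ := h.preconnected ⟨v, hv⟩ ⟨d, hd⟩
  obtain ⟨e, -, he1, he2⟩ := p.exists_boundary_dart {x | x.1 ∈ X} hvX hdX
  exact ⟨_, he1, _, e.snd.2, he2, e.adj⟩

lemma ConnectedOn.connected_induce {A : Set V} (h : ConnectedOn G A) :
    (G.induce A).Connected := by
  obtain ⟨v, hv⟩ := h.1
  have : Nonempty A := ⟨⟨v, hv⟩⟩
  refine SimpleGraph.Connected.mk fun x y => ?_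
  by_contra hxy
  obtain ⟨c, hc, ⟨hcA, hcr⟩, d, hd, hdn, hcd⟩ := h.exists_crossing
    (Y := {z | ∃ hz : z ∈ A, (G.induce A).Reachable x ⟨z, hz⟩}) x.2 ⟨x.2, .refl _⟩ y.2
    (fun ⟨_, h⟩ => hxy h)
  exact hdn ⟨hd, hcr.trans (SimpleGraph.Adj.reachable (by simpa using hcd))⟩

lemma hasK5Minor_of {A B C D E : Set V}
    (hA : ConnectedOn G A) (hB : ConnectedOn G B) (hC : ConnectedOn G C) (hD : ConnectedOn G D)
    (hE : ConnectedOn G E)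
    (dAB : ∀ x ∈ A, x ∉ B) (dAC : ∀ x ∈ A, x ∉ C) (dAD : ∀ x ∈ A, x ∉ D) (dAE : ∀ x ∈ A, x ∉ E)
    (dBC : ∀ x ∈ B, x ∉ C) (dBD : ∀ x ∈ B, x ∉ D) (dBE : ∀ x ∈ B, x ∉ E)
    (dCD : ∀ x ∈ C, x ∉ D) (dCE : ∀ x ∈ C, x ∉ E) (dDE : ∀ x ∈ D, x ∉ E)
    (lAB : Linked G A B) (lAC : Linked G A C) (lAD : Linked G A D) (lAE : Linked G A E)
    (lBC : Linked G B C) (lBD : Linked G B D) (lBE : Linked G B E)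
    (lCD : Linked G C D) (lCE : Linked G C E) (lDE : Linked G D E) : HasK5Minor G := by
  have lt_case : ∀ i j : Fin 5, i < j →
      Disjoint (![A, B, C, D, E] i) (![A, B, C, D, E] j) ∧
        Linked G (![A, B, C, D, E] i) (![A, B, C, D, E] j) := by
    intro i j hij
    fin_cases i <;> fin_cases j <;> first
      | exact absurd hij (by decide)
      | (refine ⟨Set.disjoint_left.2 ?_, ?_⟩ <;> assumption)
  have conn : ∀ i : Fin 5, ConnectedOn G (![A, B, C, D, E] i) := by
    intro i; fin_cases i <;> assumption
  refine ⟨![A, B, C, D, E], fun i => (conn i).1, fun i j hij => ?_,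
    fun i => (conn i).connected_induce, fun i j hij => ?_⟩
  · rcases lt_or_gt_of_ne hij with h | h
    exacts [(lt_case i j h).1, (lt_case j i h).1.symm]
  · rcases lt_or_gt_of_ne hij with h | h
    exacts [(lt_case i j h).2, (lt_case j i h).2.symm]

/-- Two points of a connected set are joined by an induced path inside it. -/
lemma ConnectedOn.exists_induced_path {X : Set V} (hX : ConnectedOn G X) {u v : V} (hu : u ∈ X)
    (hv : v ∈ X) : ∃ (k : ℕ) (f : ℕ → V), f 0 = u ∧ f k = v ∧ (∀ i ≤ k, f i ∈ X) ∧
      (∀ i < k, G.Adj (f i) (f (i + 1))) ∧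
      (∀ i j, i < j → j ≤ k → f i ≠ f j) ∧
      (∀ i j, i + 1 < j → j ≤ k → ¬ G.Adj (f i) (f j)) := by
  classical
  set P : V → ℕ → Prop := fun w k => ∃ f : ℕ → V, f 0 = u ∧ f k = w ∧ (∀ i ≤ k, f i ∈ X) ∧
    (∀ i < k, G.Adj (f i) (f (i + 1))) with hP
  have hex : ∃ k, P v k := by
    by_contra hcon
    obtain ⟨c, hc, ⟨k, f, h0, hk, hfX, hfa⟩, d, hd, hdn, hcd⟩ := hX.exists_crossing
      (Y := {w | ∃ k, P w k}) hu ⟨0, fun _ => u, rfl, rfl, fun _ _ => hu, by simp⟩ hv hcon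
    refine hdn ⟨k + 1, fun i => if i ≤ k then f i else d, by simp [h0], by simp, ?_, ?_⟩
    · intro i _
      dsimp only
      split_ifs with h
      exacts [hfX i h, hd]
    · intro i hi
      dsimp only
      rcases Nat.lt_succ_iff_lt_or_eq.1 hi with h | rfl
      · rw [if_pos h.le, if_pos (by omega)]; exact hfa i h
      · rw [if_pos le_rfl, if_neg (by omega), hk]; exact hcd
  obtain ⟨f, h0, hk, hfX, hfa⟩ := Nat.find_spec hex
  have hmin : ∀ m, m < Nat.find hex → ¬ P v m := fun m hm => Nat.find_min hex hm
  set k := Nat.find hex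
  have hchord : ∀ i j, i + 1 < j → j ≤ k → ¬ G.Adj (f i) (f j) := by
    intro i j hij hj hadj
    refine hmin (k - (j - i - 1)) (by omega)
      ⟨fun m => if m ≤ i then f m else f (m + (j - i - 1)), by simp [h0], ?_, ?_, ?_⟩
    · dsimp only
      rw [if_neg (by omega), Nat.sub_add_cancel (by omega), hk]
    · intro m hm
      dsimp only
      split_ifs with h
      · exact hfX m (by omega)
      · exact hfX _ (by omega)
    · intro m hm
      dsimp only
      rcases lt_trichotomy m i with h | rfl | h
      · rw [if_pos h.le, if_pos (by omega)]; exact hfa m (by omega)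
      · rw [if_pos le_rfl, if_neg (by omega)]
        convert hadj using 2; omega
      · rw [if_neg (by omega), if_neg (by omega)]
        convert hfa (m + (j - i - 1)) (by omega) using 2; omega
  refine ⟨k, f, h0, hk, hfX, hfa, fun i j hij hj heq => ?_, hchord⟩
  rcases Nat.lt_or_ge j k with h | h
  · exact hchord i (j + 1) (by omega) h (heq ▸ hfa j h)
  · obtain rfl : j = k := le_antisymm hj h
    exact hmin i hij ⟨f, h0, heq.trans hk, fun m hm => hfX m (by omega),
      fun m hm => hfa m (by omega)⟩

/-- The image of an interval under a sequence of consecutively adjacent vertices. -/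
lemma connectedOn_image_Icc {f : ℕ → V} {a b : ℕ} (hab : a ≤ b)
    (h : ∀ i, a ≤ i → i < b → G.Adj (f i) (f (i + 1))) : ConnectedOn G (f '' Set.Icc a b) := by
  induction b, hab using Nat.le_induction with
  | base => simpa using connectedOn_singleton (f a)
  | succ b hab ih =>
    have := (ih fun i hi hib => h i hi (by omega)).insert (v := f (b + 1)) (a := f b)
      ⟨b, by simp [hab], rfl⟩ (h b hab (by omega)).symm
    have hI : Set.Icc a (b + 1) = insert (b + 1) (Set.Icc a b) := by
      ext x; simp only [Set.mem_Icc, Set.mem_insert_iff]; omega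
    rwa [hI, Set.image_insert_eq]

end ConnectedSets

section Holes

variable {V : Type*} {G : SimpleGraph V}

lemma ZMod.sub_eq_one_iff_val {n : ℕ} (hn : 1 < n) (i j : ZMod n) :
    i - j = 1 ↔ i.val = j.val + 1 ∨ i.val = 0 ∧ j.val + 1 = n := by
  have : Fact (1 < n) := ⟨hn⟩
  have : NeZero n := ⟨by omega⟩
  rw [sub_eq_iff_eq_add', ← ZMod.val_injective n |>.eq_iff, ZMod.val_add, ZMod.val_one]
  have hi := ZMod.val_lt i
  have hj := ZMod.val_lt j
  rcases Nat.lt_or_ge (j.val + 1) n with h | h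
  · rw [Nat.mod_eq_of_lt h]; omega
  · rw [show j.val + 1 = n by omega, Nat.mod_self]; omega

lemma InducedCyclesLe4.false_of_hole (hG : InducedCyclesLe4 G) {n : ℕ} (hn : 5 ≤ n) (f : ℕ → V)
    (inj : ∀ i j, i < j → j < n → f i ≠ f j) (adj : ∀ i, i + 1 < n → G.Adj (f i) (f (i + 1)))
    (close : G.Adj (f 0) (f (n - 1)))
    (nonadj : ∀ i j, i + 1 < j → j < n → (i = 0 → j ≠ n - 1) → ¬ G.Adj (f i) (f j)) :
    False := by
  have : NeZero n := ⟨by omega⟩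
  have key : ∀ i j, i < j → j < n → (G.Adj (f i) (f j) ↔ j = i + 1 ∨ i = 0 ∧ j + 1 = n) := by
    intro i j hij hj
    constructor
    · intro h
      by_contra hcon
      exact nonadj i j (by omega) hj (by omega) h
    · rintro (rfl | ⟨rfl, h⟩)
      · exact adj i hj
      · obtain rfl : j = n - 1 := by omega
        exact close
  have := hG n (by omega) (fun z => f z.val) ?_ ?_
  · omega
  · intro a b hab
    by_contra hne
    have hne' : a.val ≠ b.val := fun h => hne (ZMod.val_injective n h)
    rcases lt_or_gt_of_ne hne' with h | h
    · exact inj _ _ h (ZMod.val_lt b) hab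
    · exact inj _ _ h (ZMod.val_lt a) hab.symm
  · intro a b
    rw [ZMod.sub_eq_one_iff_val (by omega), ZMod.sub_eq_one_iff_val (by omega)]
    have ha := ZMod.val_lt a
    have hb := ZMod.val_lt b
    rcases lt_trichotomy a.val b.val with h | h | h
    · rw [key _ _ h hb]; omega
    · simp only [h, SimpleGraph.irrefl, false_iff]; omega
    · rw [G.adj_comm, key _ _ h ha]; omega

lemma InducedCyclesLe4.false_of_hole_five (hG : InducedCyclesLe4 G) {a b c d e : V}
    (hab : G.Adj a b) (hbc : G.Adj b c) (hcd : G.Adj c d) (hde : G.Adj d e) (hea : G.Adj e a)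
    (hac : ¬ G.Adj a c) (had : ¬ G.Adj a d) (hbd : ¬ G.Adj b d) (hbe : ¬ G.Adj b e)
    (hce : ¬ G.Adj c e) : False := by
  set f : ℕ → V := fun i => match i with
    | 0 => a | 1 => b | 2 => c | 3 => d | _ => e with hf
  refine hG.false_of_hole le_rfl f ?_ ?_ hea.symm ?_
  · intro i j hij hj h
    have h5 : i < 5 := by omega
    interval_cases i <;> interval_cases j
    all_goals simp only [hf] at h; subst h; simp_all [G.adj_comm]
  · intro i hi
    have h4 : i < 4 := by omega
    interval_cases i <;> assumption
  · intro i j hij hj h0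
    have h5 : i < 5 := by omega
    interval_cases i <;> interval_cases j <;> omega

lemma InducedCyclesLe4.false_of_hole_six (hG : InducedCyclesLe4 G) {a b c d e g : V}
    (hab : G.Adj a b) (hbc : G.Adj b c) (hcd : G.Adj c d) (hde : G.Adj d e) (heg : G.Adj e g)
    (hga : G.Adj g a) (hac : ¬ G.Adj a c) (had : ¬ G.Adj a d) (hae : ¬ G.Adj a e)
    (hbd : ¬ G.Adj b d) (hbe : ¬ G.Adj b e) (hbg : ¬ G.Adj b g) (hce : ¬ G.Adj c e)
    (hcg : ¬ G.Adj c g) (hdg : ¬ G.Adj d g) : False := by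
  set f : ℕ → V := fun i => match i with
    | 0 => a | 1 => b | 2 => c | 3 => d | 4 => e | _ => g with hf
  refine hG.false_of_hole (n := 6) (by omega) f ?_ ?_ hga.symm ?_
  · intro i j hij hj h
    have h5 : i < 6 := by omega
    interval_cases i <;> interval_cases j
    all_goals simp only [hf] at h; subst h; simp_all [G.adj_comm]
  · intro i hi
    have h4 : i < 5 := by omega
    interval_cases i <;> assumption
  · intro i j hij hj h0
    have h5 : i < 6 := by omega
    interval_cases i <;> interval_cases j <;> omega

/-- In a graph without long holes, two nonadjacent vertices attached to two disjoint anticomplete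
connected sets have a common neighbour in each of them. -/
lemma InducedCyclesLe4.exists_common_neighbor (hG : InducedCyclesLe4 G) {A B : Set V} {u v : V}
    (hA : ConnectedOn G A) (hB : ConnectedOn G B) (hAB : ∀ a ∈ A, a ∉ B)
    (hAB' : ∀ a ∈ A, ∀ b ∈ B, ¬ G.Adj a b) (huv : u ≠ v) (huv' : ¬ G.Adj u v)
    (huA : u ∉ A) (hvA : v ∉ A) (huB : u ∉ B) (hvB : v ∉ B)
    (luA : Linked G {u} A) (lvA : Linked G {v} A) (luB : Linked G {u} B)
    (lvB : Linked G {v} B) : ∃ a ∈ A, G.Adj u a ∧ G.Adj v a := by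
  have path : ∀ X : Set V, ConnectedOn G X → u ∉ X → v ∉ X → Linked G {u} X → Linked G {v} X →
      ∃ (k : ℕ) (f : ℕ → V), 2 ≤ k ∧ f 0 = u ∧ f k = v ∧ (∀ i, 0 < i → i < k → f i ∈ X) ∧
      (∀ i < k, G.Adj (f i) (f (i + 1))) ∧
      (∀ i j, i < j → j ≤ k → f i ≠ f j) ∧
      (∀ i j, i + 1 < j → j ≤ k → ¬ G.Adj (f i) (f j)) := by
    rintro X hX huX hvX ⟨_, rfl, a, ha, hua⟩ ⟨_, rfl, b, hb, hvb⟩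
    obtain ⟨k, f, h0, hk, hfX, hfa, hinj, hna⟩ := ((hX.insert ha hua).insert (Or.inr hb)
      hvb).exists_induced_path (Or.inr (Or.inl rfl)) (Or.inl rfl)
    have hk2 : 2 ≤ k := by
      by_contra hlt
      have : k = 0 ∨ k = 1 := by omega
      rcases this with rfl | rfl
      · exact huv (h0.symm.trans hk)
      · exact huv' (by simpa [h0, hk] using hfa 0 (by omega))
    refine ⟨k, f, hk2, h0, hk, fun i hi hik => ?_, hfa, hinj, hna⟩
    rcases hfX i hik.le with h | h | h
    · exact absurd (h.trans hk.symm) (hinj i k hik le_rfl)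
    · exact absurd (h0.trans h.symm) (hinj 0 i hi hik.le)
    · exact h
  obtain ⟨k, f, hk2, h0, hk, hfX, hfa, hinj, hna⟩ := path A hA huA hvA luA lvA
  obtain ⟨l, g, hl2, g0, gl, hgX, hga, ginj, gna⟩ := path B hB huB hvB luB lvB
  rcases Nat.lt_or_ge 2 k with hk3 | hk3
  · exfalso
    refine hG.false_of_hole (n := k + l) (by omega)
      (fun i => if i ≤ k then f i else g (k + l - i)) ?_ ?_ ?_ ?_
    · intro i j hij hj
      rcases Nat.lt_or_ge k j with hj' | hj'
      · rcases Nat.lt_or_ge k i with hi' | hi'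
        · rw [if_neg (by omega), if_neg (by omega)]
          exact (ginj _ _ (by omega) (by omega)).symm
        · rw [if_pos (by omega), if_neg (by omega)]
          rcases Nat.eq_zero_or_pos i with rfl | hi
          · rw [h0, ← g0]; exact ginj _ _ (by omega) (by omega)
          · rcases Nat.eq_or_lt_of_le hi' with rfl | hik
            · rw [hk, ← gl]; exact (ginj _ _ (by omega) (by omega)).symm
            · intro h
              exact hAB _ (hfX i hi hik) (h ▸ hgX _ (by omega) (by omega))
      · rw [if_pos (by omega), if_pos (by omega)]
        exact hinj i j hij hj'
    · intro i hi
      rcases lt_trichotomy i k with h | rfl | h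
      · rw [if_pos (by omega), if_pos (by omega)]; exact hfa i h
      · rw [if_pos (by omega), if_neg (by omega), hk, ← gl]
        convert (hga (l - 1) (by omega)).symm using 2 <;> omega
      · rw [if_neg (by omega), if_neg (by omega)]
        convert (hga (k + l - (i + 1)) (by omega)).symm using 2; omega
    · rw [if_pos (by omega), if_neg (by omega), h0, ← g0]
      convert hga 0 (by omega) using 2; omega
    · intro i j hij hj hcl
      rcases Nat.lt_or_ge k j with hj' | hj'
      · rcases Nat.lt_or_ge k i with hi' | hi'
        · rw [if_neg (by omega), if_neg (by omega), G.adj_comm]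
          exact gna _ _ (by omega) (by omega)
        · rw [if_pos (by omega), if_neg (by omega)]
          rcases Nat.eq_zero_or_pos i with rfl | hi
          · rw [h0, ← g0]; exact gna _ _ (by omega) (by omega)
          · rcases Nat.eq_or_lt_of_le hi' with rfl | hik
            · rw [hk, ← gl, G.adj_comm]; exact gna _ _ (by omega) (by omega)
            · exact hAB' _ (hfX i hi hik) _ (hgX _ (by omega) (by omega))
      · rw [if_pos (by omega), if_pos (by omega)]
        exact hna i j hij hj'
  · obtain rfl : k = 2 := le_antisymm hk3 hk2
    exact ⟨f 1, hfX 1 (by omega) (by omega), h0 ▸ hfa 0 (by omega),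
      hk ▸ (hfa 1 (by omega)).symm⟩

/-- The analogue of `InducedCyclesLe4.exists_common_neighbor` for an independent triple. -/
lemma InducedCyclesLe4.exists_common_neighbor_three (hG : InducedCyclesLe4 G) {D B : Set V}
    {u x w : V} (hD : ConnectedOn G D) (hB : ConnectedOn G B) (hDB : ∀ a ∈ D, a ∉ B)
    (hDB' : ∀ a ∈ D, ∀ b ∈ B, ¬ G.Adj a b) (hux : u ≠ x) (huw : u ≠ w) (hxw : x ≠ w)
    (hux' : ¬ G.Adj u x) (huw' : ¬ G.Adj u w) (hxw' : ¬ G.Adj x w)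
    (hT : ∀ t ∈ ({u, x, w} : Set V), t ∉ D ∧ t ∉ B ∧ Linked G {t} D ∧ Linked G {t} B) :
    ∃ q ∈ D, G.Adj u q ∧ G.Adj x q ∧ G.Adj w q := by
  obtain ⟨uD, uB, luD, luB⟩ := hT u (by simp)
  obtain ⟨xD, xB, lxD, lxB⟩ := hT x (by simp)
  obtain ⟨wD, wB, lwD, lwB⟩ := hT w (by simp)
  have hBD : ∀ b ∈ B, ∀ a ∈ D, ¬ G.Adj b a := fun b hb a ha h => hDB' a ha b hb h.symm
  have hBD' : ∀ b ∈ B, b ∉ D := fun b hb hD => hDB b hD hb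
  obtain ⟨a1, ha1, ua1, xa1⟩ := hG.exists_common_neighbor hD hB hDB hDB' hux hux' uD xD uB xB
    luD lxD luB lxB
  obtain ⟨a2, ha2, ua2, wa2⟩ := hG.exists_common_neighbor hD hB hDB hDB' huw huw' uD wD uB wB
    luD lwD luB lwB
  obtain ⟨a3, ha3, xa3, wa3⟩ := hG.exists_common_neighbor hD hB hDB hDB' hxw hxw' xD wD xB wB
    lxD lwD lxB lwB
  obtain ⟨b1, hb1, ub1, xb1⟩ := hG.exists_common_neighbor hB hD hBD' hBD hux hux' uB xB uD xD
    luB lxB luD lxD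
  obtain ⟨b2, hb2, ub2, wb2⟩ := hG.exists_common_neighbor hB hD hBD' hBD huw huw' uB wB uD wD
    luB lwB luD lwD
  obtain ⟨b3, hb3, xb3, wb3⟩ := hG.exists_common_neighbor hB hD hBD' hBD hxw hxw' xB wB xD wD
    lxB lwB lxD lwD
  by_contra! hcon
  have n1 : ¬ G.Adj w a1 := hcon a1 ha1 ua1 xa1
  have n2 : ¬ G.Adj x a2 := fun h => hcon a2 ha2 ua2 h wa2
  have n3 : ¬ G.Adj u a3 := fun h => hcon a3 ha3 h xa3 wa3
  by_cases h12 : G.Adj a1 a2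
  · exact hG.false_of_hole_five xa1 h12 wa2.symm wb3 xb3.symm n2 hxw' (fun h => n1 h.symm)
      (hDB' _ ha1 _ hb3) (hDB' _ ha2 _ hb3)
  by_cases h13 : G.Adj a1 a3
  · exact hG.false_of_hole_five ua1 h13 wa3.symm wb2 ub2.symm n3 huw' (fun h => n1 h.symm)
      (hDB' _ ha1 _ hb2) (hDB' _ ha3 _ hb2)
  by_cases h23 : G.Adj a2 a3
  · exact hG.false_of_hole_five ua2 h23 xa3.symm xb1 ub1.symm n3 hux' (fun h => n2 h.symm)
      (hDB' _ ha2 _ hb1) (hDB' _ ha3 _ hb1)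
  exact hG.false_of_hole_six ua1 xa1.symm xa3 wa3.symm wa2 ua2.symm hux' n3 huw' h13
    (fun h => n1 h.symm) h12 hxw' n2 (fun h => h23 h.symm)

end Holes

section CutRepresentations

variable {V : Type*}

open Classical in
/-- The cut semimetric of `T` on all pairs of vertices. -/
def cutSep (T : Set V) (u v : V) : ℝ := if (u ∈ T ↔ v ∈ T) then 0 else 1

lemma cutSep_self (T : Set V) (u : V) : cutSep T u u = 0 := by simp [cutSep]

lemma cutSep_comm (T : Set V) (u v : V) : cutSep T u v = cutSep T v u := by
  unfold cutSep; split_ifs <;> tauto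

lemma cutSep_congr {W : Type*} {T : Set V} {T' : Set W} {u v : V} {u' v' : W}
    (h : (u ∈ T ↔ v ∈ T) ↔ (u' ∈ T' ↔ v' ∈ T')) : cutSep T u v = cutSep T' u' v' := by
  unfold cutSep; split_ifs <;> tauto

lemma cutSep_compl (T : Set V) (u v : V) : cutSep Tᶜ u v = cutSep T u v :=
  cutSep_congr (by simp only [Set.mem_compl_iff]; tauto)

/-- A symmetric function vanishing on the diagonal which satisfies all the triangle inequalities
and all the perimeter inequalities: a point of the semimetric polytope. -/
structure Semimetric (x : V → V → ℝ) : Prop where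
  self : ∀ u, x u u = 0
  symm : ∀ u v, x u v = x v u
  tri : ∀ u v w, x u w ≤ x u v + x v w
  perim : ∀ u v w, x u v + x v w + x u w ≤ 2

lemma Semimetric.nonneg {x : V → V → ℝ} (h : Semimetric x) (u v : V) : 0 ≤ x u v := by
  have := h.tri u v u
  rw [h.self, h.symm v u] at this
  linarith

lemma Semimetric.comap {W : Type*} {x : V → V → ℝ} (h : Semimetric x) (f : W → V) :
    Semimetric fun u v => x (f u) (f v) :=
  ⟨fun _ => h.self _, fun _ _ => h.symm _ _, fun _ _ _ => h.tri _ _ _, fun _ _ _ => h.perim _ _ _⟩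

/-- `x` agrees on the pairs in `R` with a convex combination of cut semimetrics. -/
def CutRep (R : V → V → Prop) (x : V → V → ℝ) : Prop :=
  ∃ (ι : Type) (_ : Fintype ι) (w : ι → ℝ) (T : ι → Set V), (∀ i, 0 ≤ w i) ∧ ∑ i, w i = 1 ∧
    ∀ u v, R u v → ∑ i, w i * cutSep (T i) u v = x u v

/-- Every point of the semimetric polytope is a convex combination of cuts on the edges of `H`
inside `X`. -/
def MetricIsCutOn (H : SimpleGraph V) (X : Set V) : Prop :=
  ∀ x : V → V → ℝ, Semimetric x → CutRep (fun u v => H.Adj u v ∧ u ∈ X ∧ v ∈ X) x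

lemma MetricIsCutOn.mono {H H' : SimpleGraph V} {X X' : Set V} (h : MetricIsCutOn H X)
    (hH : H' ≤ H) (hX : X' ⊆ X) : MetricIsCutOn H' X' := by
  intro x hx
  obtain ⟨ι, _, w, T, hw, h1, hT⟩ := h x hx
  exact ⟨ι, _, w, T, hw, h1, fun u v h => hT u v ⟨hH h.1, hX h.2.1, hX h.2.2⟩⟩

lemma MetricIsCutOn.comap {W : Type*} {H : SimpleGraph W} {Y : Set W} (h : MetricIsCutOn H Y)
    {G : SimpleGraph V} {X : Set V} (f : V → W) (g : W → V)
    (hgf : ∀ v ∈ X, g (f v) = v) (hX : ∀ v ∈ X, f v ∈ Y)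
    (hf : ∀ u ∈ X, ∀ v ∈ X, G.Adj u v → H.Adj (f u) (f v)) : MetricIsCutOn G X := by
  intro x hx
  obtain ⟨ι, _, w, T, hw, h1, hT⟩ := h _ (hx.comap g)
  refine ⟨ι, _, w, fun i => f ⁻¹' T i, hw, h1, fun u v ⟨huv, hu, hv⟩ => ?_⟩
  have := hT (f u) (f v) ⟨hf u hu v hv huv, hX u hu, hX v hv⟩
  simp only [hgf u hu, hgf v hv] at this
  rw [← this]
  rfl

lemma MetricIsCutOn.of_induce {H : SimpleGraph V} {X : Set V}
    (h : MetricIsCutOn (H.induce X) Set.univ) : MetricIsCutOn H X := by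
  intro x hx
  obtain ⟨ι, _, w, T, hw, h1, hT⟩ := h _ (hx.comap Subtype.val)
  refine ⟨ι, _, w, fun i => Subtype.val '' T i, hw, h1, fun u v ⟨huv, hu, hv⟩ => ?_⟩
  refine Eq.trans ?_ (hT ⟨u, hu⟩ ⟨v, hv⟩ ⟨by simpa using huv, trivial, trivial⟩)
  refine Finset.sum_congr rfl fun i _ => ?_
  congr 1
  exact cutSep_congr (by simp [hu, hv])

/-- Two finite distributions with the same image under `k₁`, `k₂` have a coupling supported on
the pairs with `k₁ i = k₂ j`. -/
lemma exists_coupling {ι κ K : Type} [Fintype ι] [Fintype κ] [DecidableEq K]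
    {w : ι → ℝ} {w' : κ → ℝ} (hw : ∀ i, 0 ≤ w i) (hw' : ∀ j, 0 ≤ w' j) (k₁ : ι → K) (k₂ : κ → K)
    (hM : ∀ p, ∑ i, w i * (if k₁ i = p then 1 else 0) = ∑ j, w' j * (if k₂ j = p then 1 else 0)) :
    ∃ z : ι → κ → ℝ, (∀ i j, 0 ≤ z i j) ∧ (∀ i j, z i j ≠ 0 → k₁ i = k₂ j) ∧
      (∀ i, ∑ j, z i j = w i) ∧ ∀ j, ∑ i, z i j = w' j := by
  set M : K → ℝ := fun p => ∑ i, w i * (if k₁ i = p then 1 else 0) with hMdef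
  have M0 : ∀ p, 0 ≤ M p := fun p => Finset.sum_nonneg fun i _ => by
    split_ifs <;> simp [hw i]
  have le1 : ∀ i, w i ≤ M (k₁ i) := fun i => by
    have := Finset.single_le_sum (f := fun i' => w i' * (if k₁ i' = k₁ i then (1 : ℝ) else 0))
      (fun i' _ => by split_ifs <;> simp [hw i']) (Finset.mem_univ i)
    simpa [hMdef] using this
  have le2 : ∀ j, w' j ≤ M (k₂ j) := fun j => by
    have := Finset.single_le_sum (f := fun i' => w' i' * (if k₂ i' = k₂ j then (1 : ℝ) else 0))
      (fun i' _ => by split_ifs <;> simp [hw' i']) (Finset.mem_univ j)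
    rw [hMdef]; dsimp only; rw [hM]
    simpa using this
  refine ⟨fun i j => if k₁ i = k₂ j then w i * w' j / M (k₁ i) else 0, ?_, ?_, ?_, ?_⟩
  · intro i j
    dsimp only
    split_ifs
    exacts [div_nonneg (mul_nonneg (hw i) (hw' j)) (M0 _), le_rfl]
  · intro i j h
    by_contra hne
    exact h (if_neg hne)
  · intro i
    have : ∀ j, (if k₁ i = k₂ j then w i * w' j / M (k₁ i) else 0) =
        w i / M (k₁ i) * (w' j * if k₂ j = k₁ i then 1 else 0) := by
      intro j
      by_cases h : k₁ i = k₂ j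
      · simp only [h, if_true]; ring
      · simp [h, Ne.symm h]
    simp only [this]
    rw [← Finset.mul_sum, ← hM]
    rcases (M0 (k₁ i)).eq_or_lt with h | h
    · rw [← h, div_zero, zero_mul]
      linarith [le1 i, hw i]
    · exact div_mul_cancel₀ _ (ne_of_gt h)
  · intro j
    have : ∀ i, (if k₁ i = k₂ j then w i * w' j / M (k₁ i) else 0) =
        w' j / M (k₂ j) * (w i * if k₁ i = k₂ j then 1 else 0) := by
      intro i
      split_ifs with h
      · rw [h]; ring
      · ring
    simp only [this]
    rw [← Finset.mul_sum]
    rcases (M0 (k₂ j)).eq_or_lt with h | h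
    · rw [← h, div_zero, zero_mul]
      linarith [le2 j, hw' j]
    · exact div_mul_cancel₀ _ (ne_of_gt h)

/-- Convex combinations of cuts on two vertex sets can be glued, provided that the types of the
cuts on the intersection, as recorded by `key`, have the same distribution. -/
lemma CutRep.glue {H : SimpleGraph V} {X Y : Set V} {x : V → V → ℝ} {K : Type} [DecidableEq K]
    {ι κ : Type} [Fintype ι] [Fintype κ]
    {w : ι → ℝ} {T : ι → Set V} (hw : ∀ i, 0 ≤ w i) (hw1 : ∑ i, w i = 1)
    (hT : ∀ u v, H.Adj u v ∧ u ∈ X ∧ v ∈ X → ∑ i, w i * cutSep (T i) u v = x u v)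
    {w' : κ → ℝ} {T' : κ → Set V} (hw' : ∀ i, 0 ≤ w' i)
    (hT' : ∀ u v, H.Adj u v ∧ u ∈ Y ∧ v ∈ Y → ∑ i, w' i * cutSep (T' i) u v = x u v)
    (hXY : ∀ u ∈ X, ∀ v ∈ Y, H.Adj u v → u ∈ Y ∨ v ∈ X) (key : Set V → K)
    (hkey : ∀ A B, key A = key B →
      (∀ s ∈ X ∩ Y, s ∈ A ↔ s ∈ B) ∨ (∀ s ∈ X ∩ Y, s ∈ A ↔ s ∉ B))
    (hM : ∀ p, ∑ i, w i * (if key (T i) = p then 1 else 0) =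
      ∑ j, w' j * (if key (T' j) = p then 1 else 0)) :
    CutRep (fun u v => H.Adj u v ∧ u ∈ X ∪ Y ∧ v ∈ X ∪ Y) x := by
  classical
  obtain ⟨z, z0, zk, z1, z2⟩ := exists_coupling hw hw' (fun i => key (T i)) (fun j => key (T' j)) hM
  set F : ι → κ → Set V := fun i j =>
    if ∀ s ∈ X ∩ Y, s ∈ T i ↔ s ∈ T' j then T' j else (T' j)ᶜ with hF
  have F_sep : ∀ i j u v, cutSep (F i j) u v = cutSep (T' j) u v := by
    intro i j u v
    simp only [hF]
    split_ifs
    exacts [rfl, cutSep_compl _ _ _]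
  have F_mem : ∀ i j, key (T i) = key (T' j) → ∀ s ∈ X, s ∈ Y → (s ∈ T i ↔ s ∈ F i j) := by
    intro i j hij s hsX hsY
    simp only [hF]
    split_ifs with h
    · exact h s ⟨hsX, hsY⟩
    · exact ((hkey _ _ hij).resolve_left h) s ⟨hsX, hsY⟩
  set U : ι × κ → Set V := fun p => {v | (v ∈ X ∧ v ∈ T p.1) ∨ (v ∉ X ∧ v ∈ F p.1 p.2)} with hU
  have sumX : ∀ u ∈ X, ∀ v ∈ X, H.Adj u v → ∑ p : ι × κ, z p.1 p.2 * cutSep (U p) u v = x u v := by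
    intro u hu v hv huv
    rw [← hT u v ⟨huv, hu, hv⟩, Fintype.sum_prod_type]
    refine Finset.sum_congr rfl fun i _ => ?_
    rw [← z1 i, Finset.sum_mul]
    refine Finset.sum_congr rfl fun j _ => ?_
    congr 1
    exact cutSep_congr (by simp [hU, hu, hv])
  have sumY : ∀ u ∈ Y, ∀ v ∈ Y, H.Adj u v → ∑ p : ι × κ, z p.1 p.2 * cutSep (U p) u v = x u v := by
    intro u hu v hv huv
    rw [← hT' u v ⟨huv, hu, hv⟩, Fintype.sum_prod_type, Finset.sum_comm]
    refine Finset.sum_congr rfl fun j _ => ?_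
    rw [← z2 j, Finset.sum_mul]
    refine Finset.sum_congr rfl fun i _ => ?_
    by_cases hz : z i j = 0
    · simp [hz]
    congr 1
    rw [← F_sep i j]
    have hm : ∀ s ∈ Y, s ∈ U (i, j) ↔ s ∈ F i j := by
      intro s hs
      by_cases hsX : s ∈ X
      · simp [hU, hsX, F_mem i j (zk i j hz) s hsX hs]
      · simp [hU, hsX]
    exact cutSep_congr (by rw [hm u hu, hm v hv])
  refine ⟨ι × κ, inferInstance, fun p => z p.1 p.2, U, fun p => z0 _ _, ?_, ?_⟩
  · rw [Fintype.sum_prod_type]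
    simp only [z1, hw1]
  · rintro u v ⟨huv, hu | hu, hv | hv⟩
    · exact sumX u hu v hv huv
    · rcases hXY u hu v hv huv with h | h
      exacts [sumY u h v hv huv, sumX u hu v h huv]
    · rcases hXY v hv u hu huv.symm with h | h
      exacts [sumY u hu v h huv, sumX u h v hv huv]
    · exact sumY u hu v hv huv

open Classical in
/-- The unordered partition induced by `T` on the three points `a`, `b`, `c`. -/
def triplePattern (a b c : V) (T : Set V) : Bool × Bool :=
  (decide (a ∈ T ↔ b ∈ T), decide (b ∈ T ↔ c ∈ T))

lemma triplePattern_eq {a b c : V} {A B : Set V}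
    (h : triplePattern a b c A = triplePattern a b c B) :
    (∀ s ∈ ({a, b, c} : Set V), s ∈ A ↔ s ∈ B) ∨ ∀ s ∈ ({a, b, c} : Set V), s ∈ A ↔ s ∉ B := by
  simp only [triplePattern, Prod.mk.injEq, decide_eq_decide] at h
  simp only [Set.mem_insert_iff, Set.mem_singleton_iff, forall_eq_or_imp, forall_eq]
  grind

lemma triplePattern_indicator (a b c : V) (p : Bool × Bool) : ∃ c₀ c₁ c₂ c₃ : ℝ, ∀ T : Set V,
    (if triplePattern a b c T = p then (1 : ℝ) else 0) =
      c₀ + c₁ * cutSep T a b + c₂ * cutSep T b c + c₃ * cutSep T a c := by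
  rcases p with ⟨_ | _, _ | _⟩
  · refine ⟨0, 1 / 2, 1 / 2, -1 / 2, fun T => ?_⟩
    by_cases ha : a ∈ T <;> by_cases hb : b ∈ T <;> by_cases hc : c ∈ T <;>
      simp [triplePattern, cutSep, ha, hb, hc]
    all_goals norm_num
  · refine ⟨0, 1 / 2, -1 / 2, 1 / 2, fun T => ?_⟩
    by_cases ha : a ∈ T <;> by_cases hb : b ∈ T <;> by_cases hc : c ∈ T <;>
      simp [triplePattern, cutSep, ha, hb, hc]
    all_goals norm_num
  · refine ⟨0, -1 / 2, 1 / 2, 1 / 2, fun T => ?_⟩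
    by_cases ha : a ∈ T <;> by_cases hb : b ∈ T <;> by_cases hc : c ∈ T <;>
      simp [triplePattern, cutSep, ha, hb, hc]
    all_goals norm_num
  · refine ⟨1, -1 / 2, -1 / 2, -1 / 2, fun T => ?_⟩
    by_cases ha : a ∈ T <;> by_cases hb : b ∈ T <;> by_cases hc : c ∈ T <;>
      simp [triplePattern, cutSep, ha, hb, hc]
    all_goals norm_num

/-- Gluing along a clique with at most three vertices. -/
lemma MetricIsCutOn.union {H : SimpleGraph V} {X Y : Set V} (hX : MetricIsCutOn H X)
    (hY : MetricIsCutOn H Y) (hXY : ∀ u ∈ X, ∀ v ∈ Y, H.Adj u v → u ∈ Y ∨ v ∈ X)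
    (hclique : ∀ u ∈ X ∩ Y, ∀ v ∈ X ∩ Y, u ≠ v → H.Adj u v)
    (hcard : X ∩ Y = ∅ ∨ ∃ a b c, X ∩ Y = {a, b, c}) : MetricIsCutOn H (X ∪ Y) := by
  intro x hx
  obtain ⟨ι, _, w, T, hw, hw1, hT⟩ := hX x hx
  obtain ⟨κ, _, w', T', hw', hw1', hT'⟩ := hY x hx
  rcases hcard with h | ⟨a, b, c, h⟩
  · exact CutRep.glue (K := Unit) hw hw1 hT hw' hT' hXY (fun _ => ()) (by simp [h])
      (by simp [hw1, hw1'])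
  · have ha : a ∈ X ∩ Y := by simp [h]
    have hb : b ∈ X ∩ Y := by simp [h]
    have hc : c ∈ X ∩ Y := by simp [h]
    have hS : ∀ u ∈ X ∩ Y, ∀ v ∈ X ∩ Y, ∑ i, w i * cutSep (T i) u v = x u v := by
      intro u hu v hv
      by_cases huv : u = v
      · subst huv; simp [cutSep_self, hx.self]
      · exact hT u v ⟨hclique u hu v hv huv, hu.1, hv.1⟩
    have hS' : ∀ u ∈ X ∩ Y, ∀ v ∈ X ∩ Y, ∑ i, w' i * cutSep (T' i) u v = x u v := by
      intro u hu v hv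
      by_cases huv : u = v
      · subst huv; simp [cutSep_self, hx.self]
      · exact hT' u v ⟨hclique u hu v hv huv, hu.2, hv.2⟩
    refine CutRep.glue (K := Bool × Bool) hw hw1 hT hw' hT' hXY (triplePattern a b c) ?_ ?_
    · intro A B hAB
      rw [h]
      exact triplePattern_eq hAB
    · intro p
      obtain ⟨c₀, c₁, c₂, c₃, hp⟩ := triplePattern_indicator a b c p
      have expand : ∀ {α : Type} [Fintype α] (r : α → ℝ) (R : α → Set V),
          ∑ i, r i * (if triplePattern a b c (R i) = p then (1 : ℝ) else 0) =
          c₀ * ∑ i, r i + c₁ * ∑ i, r i * cutSep (R i) a b + c₂ * ∑ i, r i * cutSep (R i) b c +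
            c₃ * ∑ i, r i * cutSep (R i) a c := by
        intro α _ r R
        simp only [hp, Finset.mul_sum, ← Finset.sum_add_distrib]
        exact Finset.sum_congr rfl fun i _ => by ring
      rw [expand, expand, hw1, hw1', hS a ha b hb, hS b hb c hc, hS a ha c hc, hS' a ha b hb,
        hS' b hb c hc, hS' a ha c hc]

end CutRepresentations

section MetricExtension

variable {V : Type*}

/-- The cost of traversing the pair `uv` without (`q = 0`) or with (`q = 1`) a flip. -/
def flipCost (x : V → V → ℝ) (u v : V) (q : ZMod 2) : ℝ := if q = 0 then x u v else 1 - x u v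

/-- `FlipWalk G x n u v p r`: there is a walk in `G` of length `n` from `u` to `v`, some of whose
steps are flipped, with an number of flips of parity `p` and total cost `r`. -/
inductive FlipWalk (G : SimpleGraph V) (x : V → V → ℝ) : ℕ → V → V → ZMod 2 → ℝ → Prop
  | nil (u : V) : FlipWalk G x 0 u u 0 0
  | cons {n : ℕ} {u v w : V} {p : ZMod 2} {r : ℝ} (h : G.Adj u v) (q : ZMod 2)
      (hw : FlipWalk G x n v w p r) : FlipWalk G x (n + 1) u w (q + p) (flipCost x u v q + r)

lemma ZMod.two_cases (q : ZMod 2) : q = 0 ∨ q = 1 := by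
  revert q; decide

namespace FlipWalk

variable {G : SimpleGraph V} {x : V → V → ℝ} {n m : ℕ} {u v w : V} {p q : ZMod 2} {r s : ℝ}

lemma append (h : FlipWalk G x n u v p r) (h' : FlipWalk G x m v w q s) :
    FlipWalk G x (n + m) u w (p + q) (r + s) := by
  induction h with
  | nil u => simpa using h'
  | cons hadj q' hw ih =>
    have := cons hadj q' (ih h')
    rw [add_assoc q', add_assoc (flipCost _ _ _ _), add_right_comm]
    exact this

lemma single (h : G.Adj u v) (q : ZMod 2) : FlipWalk G x 1 u v q (flipCost x u v q) := by
  simpa using cons h q (nil (x := x) v)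

lemma reverse (hx : ∀ u v, x u v = x v u) (h : FlipWalk G x n u v p r) :
    FlipWalk G x n v u p r := by
  induction h with
  | nil u => exact nil u
  | @cons n u v w p r hadj q hw ih =>
    have := ih.append (single (x := x) hadj.symm q)
    rwa [add_comm p, add_comm r, show flipCost x v u q = flipCost x u v q by
      simp only [flipCost, hx v u]] at this

lemma cost_nonneg (hx : ∀ u v, G.Adj u v → 0 ≤ x u v ∧ x u v ≤ 1) (h : FlipWalk G x n u v p r) :
    0 ≤ r := by
  induction h with
  | nil u => exact le_rfl
  | @cons n u v w p r hadj q hw ih =>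
    have := hx u v hadj
    unfold flipCost
    split_ifs <;> linarith

lemma of_fun {f : ℕ → V} {s : ℕ → ZMod 2} {i j : ℕ} (hij : i ≤ j)
    (hadj : ∀ l, i ≤ l → l < j → G.Adj (f l) (f (l + 1))) :
    FlipWalk G x (j - i) (f i) (f j) (∑ l ∈ Finset.Ico i j, s l)
      (∑ l ∈ Finset.Ico i j, flipCost x (f l) (f (l + 1)) (s l)) := by
  induction j, hij using Nat.le_induction with
  | base => simpa using nil (x := x) (f i)
  | succ j hij ih =>
    have := (ih fun l h1 h2 => hadj l h1 (by omega)).append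
      (single (x := x) (hadj j hij (by omega)) (s j))
    rw [Finset.sum_Ico_succ_top hij, Finset.sum_Ico_succ_top hij, Nat.sub_add_comm hij]
    exact this

lemma exists_fun (h : FlipWalk G x n u v p r) : ∃ (f : ℕ → V) (s : ℕ → ZMod 2), f 0 = u ∧
    f n = v ∧ (∀ l < n, G.Adj (f l) (f (l + 1))) ∧ (∑ l ∈ Finset.range n, s l = p) ∧
      ∑ l ∈ Finset.range n, flipCost x (f l) (f (l + 1)) (s l) = r := by
  induction h with
  | nil u => exact ⟨fun _ => u, fun _ => 0, by simp⟩
  | @cons n u v w p r hadj q hw ih =>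
    obtain ⟨f, s, h0, hn, hf, hs, hr⟩ := ih
    refine ⟨fun i => Nat.casesOn i u f, fun i => Nat.casesOn i q s, rfl, hn, ?_, ?_, ?_⟩
    · rintro (_ | l) hl
      · simpa [h0] using hadj
      · exact hf l (by omega)
    · rw [Finset.sum_range_succ', add_comm, ← hs]
      rfl
    · rw [Finset.sum_range_succ', add_comm, ← hr]
      simp [h0]

end FlipWalk

/-- `x` takes values in `[0,1]` on the edges of `G`, and every closed walk with an odd number of
flips costs at least one. -/
structure OddClosed (G : SimpleGraph V) (x : V → V → ℝ) : Prop where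
  symm : ∀ u v, x u v = x v u
  bounds : ∀ u v, G.Adj u v → 0 ≤ x u v ∧ x u v ≤ 1
  one_le : ∀ n u r, FlipWalk G x n u u 1 r → 1 ≤ r

/-- The inequalities on edges, triangles and closed walks of length four. -/
structure ShortCycles (G : SimpleGraph V) (x : V → V → ℝ) : Prop where
  symm : ∀ u v, x u v = x v u
  bounds : ∀ u v, G.Adj u v → 0 ≤ x u v ∧ x u v ≤ 1
  tri : ∀ a b c, G.Adj a b → G.Adj b c → G.Adj c a → x c a ≤ x a b + x b c
  perim : ∀ a b c, G.Adj a b → G.Adj b c → G.Adj c a → x a b + x b c + x c a ≤ 2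
  four : ∀ a b c d, G.Adj a b → G.Adj b c → G.Adj c d → G.Adj d a →
    x d a ≤ x a b + x b c + x c d
  four' : ∀ a b c d, G.Adj a b → G.Adj b c → G.Adj c d → G.Adj d a →
    x a b + x b c + x c d - x d a ≤ 2

lemma sum_range_split {M : Type*} [AddCommMonoid M] (g : ℕ → M) {i j n : ℕ} (hij : i ≤ j)
    (hj : j ≤ n) : ∑ l ∈ Finset.range n, g l =
      ∑ l ∈ Finset.Ico 0 i, g l + ∑ l ∈ Finset.Ico j n, g l + ∑ l ∈ Finset.Ico i j, g l := by
  rw [Finset.range_eq_Ico, ← Finset.sum_Ico_consecutive g (Nat.zero_le i) (hij.trans hj),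
    ← Finset.sum_Ico_consecutive g hij hj, add_assoc, add_comm (∑ l ∈ Finset.Ico i j, g l)]

lemma ShortCycles.oddClosed {G : SimpleGraph V} {x : V → V → ℝ} (hG : InducedCyclesLe4 G)
    (h : ShortCycles G x) : OddClosed G x := by
  refine ⟨h.symm, h.bounds, fun n => ?_⟩
  induction n using Nat.strong_induction_on with
  | _ n ih =>
  intro u r hw
  obtain ⟨f, s, h0, hn, hf, hs, hr⟩ := hw.exists_fun
  have seg : ∀ i j, i ≤ j → j ≤ n → FlipWalk G x (j - i) (f i) (f j) (∑ l ∈ Finset.Ico i j, s l)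
      (∑ l ∈ Finset.Ico i j, flipCost x (f l) (f (l + 1)) (s l)) := fun i j hij hj =>
    FlipWalk.of_fun hij fun l _ hl => hf l (by omega)
  by_cases hrep : ∃ i j, i < j ∧ j ≤ n ∧ j - i < n ∧ f i = f j
  · obtain ⟨i, j, hij, hj, hlt, heq⟩ := hrep
    have w1 := seg i j hij.le hj
    have w2 := (seg 0 i (by omega) (by omega)).append (heq ▸ seg j n hj le_rfl)
    rw [hn, ← h0] at w2
    rw [← heq] at w1
    have c1 := w1.cost_nonneg h.bounds
    have c2 := w2.cost_nonneg h.bounds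
    rw [← hr, sum_range_split _ hij.le hj]
    rw [sum_range_split _ hij.le hj] at hs
    rcases ZMod.two_cases (∑ l ∈ Finset.Ico i j, s l) with hp | hp
    · rw [hp, add_zero] at hs
      rw [hs] at w2
      have := ih _ (by omega) _ _ w2
      linarith
    · rw [hp] at w1
      have := ih _ hlt _ _ w1
      linarith
  by_cases hch : ∃ i j, i + 1 < j ∧ j ≤ n ∧ j - i + 1 < n ∧ G.Adj (f i) (f j)
  · obtain ⟨i, j, hij, hj, hlt, hadj⟩ := hch
    set P := ∑ l ∈ Finset.Ico i j, s l with hP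
    have w1 := (seg i j (by omega) hj).append (FlipWalk.single (x := x) hadj.symm (1 - P))
    have w2 := ((seg 0 i (by omega) (by omega)).append
      (FlipWalk.single (x := x) hadj P)).append (seg j n hj le_rfl)
    rw [hn, ← h0] at w2
    rw [sum_range_split _ (show i ≤ j by omega) hj, ← hP] at hs
    rw [← hP, add_sub_cancel] at w1
    rw [add_right_comm _ P, hs] at w2
    have c1 := ih _ hlt _ _ w1
    have c2 := ih _ (by omega) _ _ w2
    have hc : flipCost x (f j) (f i) (1 - P) + flipCost x (f i) (f j) P = 1 := by
      rcases ZMod.two_cases P with hp | hp <;> simp [hp, flipCost, h.symm (f j)]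
    rw [← hr, sum_range_split _ (show i ≤ j by omega) hj]
    linarith
  push Not at hrep hch
  have hn5 : n < 5 := by
    by_contra hn5
    push Not at hn5
    refine hG.false_of_hole hn5 f (fun i j hij hj => hrep i j hij hj.le (by omega))
      (fun i hi => hf i (by omega)) ?_ (fun i j hij hj hne => hch i j hij hj.le (by omega))
    have := hf (n - 1) (by omega)
    rw [Nat.sub_add_cancel (by omega), hn, ← h0] at this
    exact this.symm
  rw [← hr]
  interval_cases n
  · simp at hs
  · have := hf 0 (by omega)
    rw [hn, ← h0] at this
    exact absurd this (G.irrefl)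
  · have h01 := h.bounds _ _ (hf 0 (by omega))
    have e := h.symm (f 0) (f 1)
    simp only [Finset.sum_range_succ, Finset.sum_range_zero, zero_add] at hs h01 ⊢
    rw [show (1 : ℕ) + 1 = 2 from rfl, hn, ← h0]
    rcases ZMod.two_cases (s 0) with h0 | h0 <;> rcases ZMod.two_cases (s 1) with h1 | h1 <;>
      rw [h0, h1] at hs ⊢ <;> first
      | exact absurd hs (by decide)
      | (simp only [flipCost, if_true, one_ne_zero, if_false]; linarith)
  · have a0 := hf 0 (by omega)
    have a1 := hf 1 (by omega)
    have a2 := hf 2 (by omega)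
    simp only [zero_add, show (1 : ℕ) + 1 = 2 from rfl, show (2 : ℕ) + 1 = 3 from rfl,
      hn.trans h0.symm] at a0 a1 a2
    have t1 := h.tri _ _ _ a0 a1 a2
    have t2 := h.tri _ _ _ a1 a2 a0
    have t3 := h.tri _ _ _ a2 a0 a1
    have t4 := h.perim _ _ _ a0 a1 a2
    simp only [Finset.sum_range_succ, Finset.sum_range_zero, zero_add,
      show (1 : ℕ) + 1 = 2 from rfl, show (2 : ℕ) + 1 = 3 from rfl, hn.trans h0.symm] at hs ⊢
    rcases ZMod.two_cases (s 0) with h0 | h0 <;> rcases ZMod.two_cases (s 1) with h1 | h1 <;>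
      rcases ZMod.two_cases (s 2) with h2 | h2 <;>
      rw [h0, h1, h2] at hs ⊢ <;> first
      | exact absurd hs (by decide)
      | (simp only [flipCost, if_true, one_ne_zero, if_false]; linarith)
  · have a0 := hf 0 (by omega)
    have a1 := hf 1 (by omega)
    have a2 := hf 2 (by omega)
    have a3 := hf 3 (by omega)
    simp only [zero_add, show (1 : ℕ) + 1 = 2 from rfl, show (2 : ℕ) + 1 = 3 from rfl,
      show (3 : ℕ) + 1 = 4 from rfl, hn.trans h0.symm] at a0 a1 a2 a3
    have t1 := h.four _ _ _ _ a0 a1 a2 a3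
    have t2 := h.four _ _ _ _ a1 a2 a3 a0
    have t3 := h.four _ _ _ _ a2 a3 a0 a1
    have t4 := h.four _ _ _ _ a3 a0 a1 a2
    have t5 := h.four' _ _ _ _ a0 a1 a2 a3
    have t6 := h.four' _ _ _ _ a1 a2 a3 a0
    have t7 := h.four' _ _ _ _ a2 a3 a0 a1
    have t8 := h.four' _ _ _ _ a3 a0 a1 a2
    simp only [Finset.sum_range_succ, Finset.sum_range_zero, zero_add,
      show (1 : ℕ) + 1 = 2 from rfl, show (2 : ℕ) + 1 = 3 from rfl, show (3 : ℕ) + 1 = 4 from rfl,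
      hn.trans h0.symm] at hs ⊢
    rcases ZMod.two_cases (s 0) with h0 | h0 <;> rcases ZMod.two_cases (s 1) with h1 | h1 <;>
      rcases ZMod.two_cases (s 2) with h2 | h2 <;> rcases ZMod.two_cases (s 3) with h3 | h3 <;>
      rw [h0, h1, h2, h3] at hs ⊢ <;> first
      | exact absurd hs (by decide)
      | (simp only [flipCost, if_true, one_ne_zero, if_false]; linarith)

/-- One more pair can be added to the domain of `x`. -/
lemma OddClosed.exists_extend_pair {G : SimpleGraph V} {x : V → V → ℝ} (h : OddClosed G x)
    {u v : V} (huv : u ≠ v) (hna : ¬ G.Adj u v) : ∃ x' : V → V → ℝ,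
      OddClosed (G ⊔ SimpleGraph.edge u v) x' ∧ ∀ a b, G.Adj a b → x' a b = x a b := by
  classical
  set R : Set ℝ := {r | r = 1 ∨ ∃ n, FlipWalk G x n u v 0 r} with hR
  have R0 : ∀ r ∈ R, 0 ≤ r := by
    rintro r (rfl | ⟨n, hw⟩)
    exacts [zero_le_one, hw.cost_nonneg h.bounds]
  have Rne : R.Nonempty := ⟨1, Or.inl rfl⟩
  set t := sInf R with ht
  have t0 : 0 ≤ t := le_csInf Rne R0
  have t1 : t ≤ 1 := csInf_le ⟨0, R0⟩ (Or.inl rfl)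
  set c : ZMod 2 → ℝ := fun q => if q = 0 then t else 1 - t with hc
  have c_nonneg : ∀ q, 0 ≤ c q := fun q => by
    simp only [hc]; split_ifs <;> linarith
  have c_le : ∀ n p r, FlipWalk G x n u v p r → c p ≤ r := by
    intro n p r hw
    rcases ZMod.two_cases p with rfl | rfl
    · exact csInf_le ⟨0, R0⟩ (Or.inr ⟨n, hw⟩)
    · simp only [hc, one_ne_zero, if_false]
      have : 1 - r ≤ t := by
        refine le_csInf Rne ?_
        rintro s (rfl | ⟨m, hs⟩)
        · linarith [hw.cost_nonneg h.bounds]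
        · have := h.one_le _ _ _ (hw.append (hs.reverse h.symm))
          linarith
      linarith
  have c_le' : ∀ n p r, FlipWalk G x n v u p r → c p ≤ r := fun n p r hw =>
    c_le n p r (hw.reverse h.symm)
  have c_add : ∀ p q, p + q = 1 → c p + c q = 1 := by
    intro p q hpq
    rcases ZMod.two_cases p with rfl | rfl <;> rcases ZMod.two_cases q with rfl | rfl <;>
      first | exact absurd hpq (by decide) | simp [hc]
  have c_tri : ∀ p q r, c (p + q + r) ≤ c p + c q + c r := by
    intro p q r
    have h0 := c_nonneg 0
    have h1 := c_nonneg 1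
    have e : (1 : ZMod 2) + 1 = 0 := by decide
    rcases ZMod.two_cases p with rfl | rfl <;> rcases ZMod.two_cases q with rfl | rfl <;>
      rcases ZMod.two_cases r with rfl | rfl <;> simp only [e, add_zero, zero_add] <;> linarith
  set B : V → V → V → V → ZMod 2 → ℝ → Prop := fun u v a b p r =>
    ∃ n₁ n₂ p₁ p₂ q r₁ r₂, FlipWalk G x n₁ a u p₁ r₁ ∧ FlipWalk G x n₂ v b p₂ r₂ ∧
      p₁ + q + p₂ = p ∧ r₁ + c q + r₂ ≤ r with hB
  set I : V → V → V → V → ZMod 2 → ℝ → Prop := fun u v a b p r =>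
    (∃ n r', FlipWalk G x n a b p r' ∧ r' ≤ r) ∨ B u v a b p r ∨ B v u a b p r ∨ 1 ≤ r with hI
  have I_swap : ∀ u v a b p r, I u v a b p r → I v u a b p r := by
    exact fun u v a b p r h => h.imp_right or_left_comm.1
  have step : ∀ u v, (∀ n p r, FlipWalk G x n v u p r → c p ≤ r) → ∀ b p r q, I u v v b p r →
      I u v u b (q + p) (c q + r) := by
    rintro u v hcl b p r q (⟨n, r', hw, hr⟩ | ⟨n₁, n₂, p₁, p₂, q', r₁, r₂, w₁, w₂, hp, hr⟩ |
      ⟨n₁, n₂, p₁, p₂, q', r₁, r₂, w₁, w₂, hp, hr⟩ | hr)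
    · exact Or.inr (Or.inl ⟨0, n, 0, p, q, 0, r', .nil u, hw, by ring, by linarith⟩)
    · refine Or.inr (Or.inl ⟨0, n₂, 0, p₂, q + p₁ + q', 0, r₂, .nil u, w₂, by rw [← hp]; ring, ?_⟩)
      have := c_tri q p₁ q'
      have := hcl _ _ _ w₁
      linarith
    · have r1 := w₁.cost_nonneg h.bounds
      have r2 := w₂.cost_nonneg h.bounds
      have q1 := c_nonneg q
      have q2 := c_nonneg q'
      rcases ZMod.two_cases p₁ with rfl | rfl
      · rcases ZMod.two_cases (q + q') with hq | hq
        · refine Or.inl ⟨n₂, r₂, ?_, by linarith⟩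
          rwa [← hp, zero_add, ← add_assoc, hq, zero_add]
        · have := c_add _ _ hq
          exact Or.inr (Or.inr (Or.inr (by linarith)))
      · have := h.one_le _ _ _ w₁
        exact Or.inr (Or.inr (Or.inr (by linarith)))
    · have := c_nonneg q
      exact Or.inr (Or.inr (Or.inr (by linarith)))
  set x' : V → V → ℝ := fun a b => if (a = u ∧ b = v) ∨ (a = v ∧ b = u) then t else x a b with hx'
  have x'_old : ∀ a b, G.Adj a b → x' a b = x a b := by
    intro a b hab
    refine if_neg ?_
    rintro (⟨rfl, rfl⟩ | ⟨rfl, rfl⟩)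
    exacts [hna hab, hna hab.symm]
  have key : ∀ n a b p r, FlipWalk (G ⊔ SimpleGraph.edge u v) x' n a b p r → I u v a b p r := by
    intro n a b p r hw
    induction hw with
    | nil a => exact Or.inl ⟨0, 0, .nil a, le_rfl⟩
    | @cons n a a' b p r hadj q hw ih =>
      rw [SimpleGraph.sup_adj, SimpleGraph.edge_adj] at hadj
      rcases hadj with hadj | ⟨⟨rfl, rfl⟩ | ⟨rfl, rfl⟩, -⟩
      · have hfl : flipCost x' a a' q = flipCost x a a' q := by
          simp only [flipCost, x'_old a a' hadj]
        rw [hfl]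
        have w₀ := FlipWalk.single (x := x) hadj q
        have r0 := w₀.cost_nonneg h.bounds
        rcases ih with ⟨n, r', hw, hr⟩ | ⟨n₁, n₂, p₁, p₂, q', r₁, r₂, w₁, w₂, hp, hr⟩ |
          ⟨n₁, n₂, p₁, p₂, q', r₁, r₂, w₁, w₂, hp, hr⟩ | hr
        · exact Or.inl ⟨_, _, w₀.append hw, by linarith⟩
        · exact Or.inr (Or.inl ⟨_, _, _, _, q', _, _, w₀.append w₁, w₂, by rw [← hp]; ring,
            by linarith⟩)
        · exact Or.inr (Or.inr (Or.inl ⟨_, _, _, _, q', _, _, w₀.append w₁, w₂,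
            by rw [← hp]; ring, by linarith⟩))
        · exact Or.inr (Or.inr (Or.inr (by linarith)))
      · have hfl : flipCost x' a a' q = c q := by simp [flipCost, hx', hc]
        rw [hfl]
        exact step a a' c_le' b p r q ih
      · have hfl : flipCost x' a a' q = c q := by simp [flipCost, hx', hc]
        rw [hfl]
        exact I_swap _ _ _ _ _ _ (step a a' c_le b p r q (I_swap _ _ _ _ _ _ ih))
  refine ⟨x', ⟨fun a b => ?_, fun a b hab => ?_, fun n a r hw => ?_⟩, x'_old⟩
  · simp only [hx', h.symm a b]
    congr 1
    exact propext (by tauto)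
  · rw [SimpleGraph.sup_adj, SimpleGraph.edge_adj] at hab
    rcases hab with hab | ⟨hab, -⟩
    · rw [x'_old a b hab]; exact h.bounds a b hab
    · simp only [hx', if_pos hab]; exact ⟨t0, t1⟩
  · have close : ∀ u v, (∀ n p r, FlipWalk G x n v u p r → c p ≤ r) → B u v a a 1 r → 1 ≤ r := by
      rintro u v hcl ⟨n₁, n₂, p₁, p₂, q, r₁, r₂, w₁, w₂, hp, hr⟩
      have h1 := hcl _ _ _ (w₂.append w₁)
      have h2 := c_add (p₂ + p₁) q (by rw [← hp]; ring)
      linarith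
    rcases key n a a 1 r hw with ⟨n, r', hw, hr⟩ | hb | hb | hr
    · exact (h.one_le _ _ _ hw).trans hr
    · exact close u v c_le' hb
    · exact close v u c_le hb
    · exact hr

lemma OddClosed.exists_semimetric [Finite V] {G : SimpleGraph V} {x : V → V → ℝ}
    (h : OddClosed G x) : ∃ y, Semimetric y ∧ ∀ a b, G.Adj a b → y a b = x a b := by
  classical
  induction G using WellFoundedGT.induction generalizing x with
  | _ G ih =>
  by_cases hG : ∃ u v, u ≠ v ∧ ¬ G.Adj u v
  · obtain ⟨u, v, huv, hna⟩ := hG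
    obtain ⟨x', hx', hold⟩ := h.exists_extend_pair huv hna
    have hlt : G < G ⊔ SimpleGraph.edge u v := by
      refine lt_of_le_of_ne le_sup_left fun heq => hna ?_
      rw [heq, SimpleGraph.sup_adj, SimpleGraph.edge_adj]
      exact Or.inr ⟨Or.inl ⟨rfl, rfl⟩, huv⟩
    obtain ⟨y, hy, hyx⟩ := ih _ hlt hx'
    exact ⟨y, hy, fun a b hab => (hyx a b (Or.inl hab)).trans (hold a b hab)⟩
  · push Not at hG
    have three : ∀ a b c, a ≠ b → b ≠ c → c ≠ a → x a c ≤ x a b + x b c ∧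
        x a b + x b c + x a c ≤ 2 := by
      intro a b c hab hbc hca
      have w := fun q₁ q₂ q₃ : ZMod 2 => ((FlipWalk.single (x := x) (hG a b hab) q₁).append
        (FlipWalk.single (x := x) (hG b c hbc) q₂)).append (FlipWalk.single (x := x) (hG c a hca) q₃)
      have h1 := h.one_le _ _ _ (w 0 0 1)
      have h2 := h.one_le _ _ _ (w 1 1 1)
      simp only [flipCost, if_true, one_ne_zero, if_false] at h1 h2
      rw [h.symm a c]
      constructor <;> linarith
    have b0 : ∀ a b, a ≠ b → 0 ≤ x a b := fun a b hab => (h.bounds a b (hG a b hab)).1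
    have b1 : ∀ a b, a ≠ b → x a b ≤ 1 := fun a b hab => (h.bounds a b (hG a b hab)).2
    refine ⟨fun a b => if a = b then 0 else x a b, ⟨?_, ?_, ?_, ?_⟩, ?_⟩
    · simp
    · intro a b
      simp only [eq_comm, h.symm a b]
    · intro a b c
      have hs := h.symm a b
      have := b0 a b
      have := b0 b c
      have := three a b c
      grind
    · intro a b c
      have hs := h.symm a b
      have := b1 a b
      have := b1 b c
      have := b1 a c
      have := three a b c
      grind
    · intro a b hab
      simp [hab.ne]

/-- In a graph without long holes, the inequalities coming from edges, triangles and squares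
characterize the restrictions of semimetrics. -/
lemma ShortCycles.exists_semimetric [Finite V] {G : SimpleGraph V} {x : V → V → ℝ}
    (hG : InducedCyclesLe4 G) (h : ShortCycles G x) :
    ∃ y, Semimetric y ∧ ∀ a b, G.Adj a b → y a b = x a b :=
  (h.oddClosed hG).exists_semimetric

end MetricExtension

section SmallGraphs

lemma metricIsCutOn_fin_four : MetricIsCutOn (⊤ : SimpleGraph (Fin 4)) Set.univ := by
  intro x hx
  set d0 := x 1 2 + x 1 3 + x 2 3 - x 0 1 - x 0 2 - x 0 3 with hd0
  set d1 := x 0 2 + x 0 3 + x 2 3 - x 0 1 - x 1 2 - x 1 3 with hd1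
  set d2 := x 0 1 + x 0 3 + x 1 3 - x 0 2 - x 1 2 - x 2 3 with hd2
  set d3 := x 0 1 + x 0 2 + x 1 2 - x 0 3 - x 1 3 - x 2 3 with hd3
  set s := max (max d0 d1) (max d2 d3) with hs
  have l0 : d0 ≤ s := (le_max_left _ _).trans (le_max_left _ _)
  have l1 : d1 ≤ s := (le_max_right _ _).trans (le_max_left _ _)
  have l2 : d2 ≤ s := (le_max_left _ _).trans (le_max_right _ _)
  have l3 : d3 ≤ s := (le_max_right _ _).trans (le_max_right _ _)
  have p01 := hx.symm 1 0
  have p02 := hx.symm 2 0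
  have p03 := hx.symm 3 0
  have p12 := hx.symm 2 1
  have p13 := hx.symm 3 1
  have p23 := hx.symm 3 2
  have t : ∀ i j k, x i k ≤ x i j + x j k ∧ x i j + x j k + x i k ≤ 2 := fun i j k =>
    ⟨hx.tri i j k, hx.perim i j k⟩
  have t012 := t 0 1 2
  have t021 := t 0 2 1
  have t102 := t 1 0 2
  have t013 := t 0 1 3
  have t031 := t 0 3 1
  have t103 := t 1 0 3
  have t023 := t 0 2 3
  have t032 := t 0 3 2
  have t203 := t 2 0 3
  have t123 := t 1 2 3
  have t132 := t 1 3 2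
  have t213 := t 2 1 3
  have u1 : s ≤ x 0 2 + x 1 3 + x 0 3 + x 1 2 - x 0 1 - x 2 3 :=
    max_le (max_le (by linarith) (by linarith)) (max_le (by linarith) (by linarith))
  have u2 : s ≤ x 0 1 + x 2 3 + x 0 3 + x 1 2 - x 0 2 - x 1 3 :=
    max_le (max_le (by linarith) (by linarith)) (max_le (by linarith) (by linarith))
  have u3 : s ≤ x 0 1 + x 2 3 + x 0 2 + x 1 3 - x 0 3 - x 1 2 :=
    max_le (max_le (by linarith) (by linarith)) (max_le (by linarith) (by linarith))
  have u4 : s ≤ 4 - (x 0 1 + x 0 2 + x 0 3 + x 1 2 + x 1 3 + x 2 3) :=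
    max_le (max_le (by linarith) (by linarith)) (max_le (by linarith) (by linarith))
  refine ⟨Fin 8, inferInstance,
    ![1 - (x 0 1 + x 0 2 + x 0 3 + x 1 2 + x 1 3 + x 2 3) / 4 - s / 4, (s - d0) / 4, (s - d1) / 4,
      (s - d2) / 4, (s - d3) / 4, (x 0 2 + x 1 3 + x 0 3 + x 1 2 - x 0 1 - x 2 3 - s) / 4,
      (x 0 1 + x 2 3 + x 0 3 + x 1 2 - x 0 2 - x 1 3 - s) / 4,
      (x 0 1 + x 2 3 + x 0 2 + x 1 3 - x 0 3 - x 1 2 - s) / 4],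
    ![∅, {0}, {1}, {2}, {3}, {0, 1}, {0, 2}, {0, 3}], ?_, ?_, ?_⟩
  · intro i
    fin_cases i <;> simp <;> linarith
  · simp [Fin.sum_univ_eight]
    linarith
  · rintro u v ⟨huv, -, -⟩
    have : u ≠ v := huv
    simp only [Fin.sum_univ_eight]
    fin_cases u <;> fin_cases v <;> first | exact absurd rfl this | skip
    all_goals simp [cutSep]
    all_goals linarith

variable {V : Type*}

lemma metricIsCutOn_of_ncard_le_four (G : SimpleGraph V) {X : Set V} (hX : X.Finite)
    (hcard : X.ncard ≤ 4) : MetricIsCutOn G X := by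
  classical
  rcases X.eq_empty_or_nonempty with rfl | ⟨v₀, hv₀⟩
  · exact fun x _ => ⟨Unit, inferInstance, fun _ => 1, fun _ => ∅, by simp, by simp, by simp⟩
  have := hX.fintype
  have hc : Fintype.card X ≤ Fintype.card (Fin 4) := by
    rw [← Nat.card_eq_fintype_card, Nat.card_coe_set_eq]
    simpa using hcard
  obtain ⟨e⟩ := Function.Embedding.nonempty_of_card_le hc
  set f : V → Fin 4 := fun v => if hv : v ∈ X then e ⟨v, hv⟩ else 0 with hf
  have hfX : ∀ v (hv : v ∈ X), f v = e ⟨v, hv⟩ := fun v hv => dif_pos hv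
  have : Nonempty X := ⟨⟨v₀, hv₀⟩⟩
  refine metricIsCutOn_fin_four.comap f (fun i => (Function.invFun e i).1) ?_ ?_ ?_
  · intro v hv
    rw [hfX v hv, Function.leftInverse_invFun e.injective]
  · simp
  · intro u hu v hv huv
    rw [SimpleGraph.top_adj, hfX u hu, hfX v hv]
    intro h
    exact huv.ne (congrArg Subtype.val (e.injective h))

end SmallGraphs

section Octahedron

open Filter Topology

variable {V : Type*}

open Classical in
/-- The switching of `x` at the vertex `p`. -/
def switchAt (p : V) (x : V → V → ℝ) (u v : V) : ℝ :=
  if (u = p ↔ v = p) then x u v else 1 - x u v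

lemma switchAt_switchAt (p : V) (x : V → V → ℝ) : switchAt p (switchAt p x) = x := by
  funext u v
  unfold switchAt
  split_ifs <;> ring

lemma Semimetric.switchAt {x : V → V → ℝ} (h : Semimetric x) (p : V) :
    Semimetric (switchAt p x) := by
  refine ⟨fun u => by simp [_root_.switchAt, h.self], fun u v => ?_, fun u v w => ?_,
    fun u v w => ?_⟩
  · simp only [_root_.switchAt, h.symm v u]
    split_ifs <;> first | rfl | (exfalso; tauto)
  all_goals
    have h0 := h.self p
    have h1 := h.symm u v
    have h2 := h.symm v w
    have h3 := h.symm u w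
    have h4 := h.tri u v w
    have h5 := h.tri v u w
    have h6 := h.tri u w v
    have h7 := h.perim u v w
    have h8 := h.nonneg u v
    have h9 := h.nonneg u w
    have h10 := h.nonneg v w
    by_cases hu : u = p <;> by_cases hv : v = p <;> by_cases hw : w = p <;>
      simp only [_root_.switchAt, hu, hv, hw, iff_self, if_true, if_false, iff_false, false_iff,
        not_true_eq_false] at * <;> linarith

lemma CutRep.switchAt {R : V → V → Prop} {x : V → V → ℝ} (h : CutRep R x) (p : V) :
    CutRep R (switchAt p x) := by
  classical
  obtain ⟨ι, _, w, T, hw, h1, hT⟩ := h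
  refine ⟨ι, _, w, fun i => {u | (u ∈ T i) ↔ u ≠ p}, hw, h1, fun u v huv => ?_⟩
  have key : ∀ i, cutSep {u | (u ∈ T i) ↔ u ≠ p} u v =
      if (u = p ↔ v = p) then cutSep (T i) u v else 1 - cutSep (T i) u v := by
    intro i
    unfold cutSep
    simp only [Set.mem_ofPred_eq]
    split_ifs <;> first | norm_num; done | (exfalso; tauto)
  simp only [key, _root_.switchAt]
  split_ifs
  · exact hT u v huv
  · simp only [mul_sub, mul_one, Finset.sum_sub_distrib, h1, hT u v huv]

/-- The octahedron. -/
def octahedron : SimpleGraph (Fin 3 × Bool) where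
  Adj a b := a.1 ≠ b.1
  symm := ⟨fun _ _ h => h.symm⟩
  loopless := ⟨fun _ h => h rfl⟩

lemma inducedCyclesLe4_octahedron : InducedCyclesLe4 octahedron := by
  intro k hk v hv hadj
  by_contra hlt
  have : NeZero k := ⟨by omega⟩
  have hcast : ∀ m : ℕ, 0 < m → m < k → (m : ZMod k) ≠ 0 := fun m hm hmk h => by
    rw [ZMod.natCast_eq_zero_iff] at h
    exact absurd (Nat.le_of_dvd hm h) (by omega)
  have h1 := hcast 1 (by omega) (by omega)
  have h2 := hcast 2 (by omega) (by omega)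
  have h3 := hcast 3 (by omega) (by omega)
  have h4 := hcast 4 (by omega) (by omega)
  push_cast at h1 h2 h3 h4
  have e1 : (v 0).1 = (v 2).1 := by
    by_contra h
    rcases (hadj 0 2).1 h with h | h
    · exact h3 (by linear_combination -h)
    · exact h1 (by linear_combination h)
  have e2 : (v 0).1 = (v 3).1 := by
    by_contra h
    rcases (hadj 0 3).1 h with h | h
    · exact h4 (by linear_combination -h)
    · exact h2 (by linear_combination h)
  exact (hadj 2 3).2 (Or.inr (by ring)) (e1.symm.trans e2)

lemma cutRep_octahedron_of_eq_zero {x : Fin 3 × Bool → Fin 3 × Bool → ℝ} (hx : Semimetric x)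
    {u v : Fin 3 × Bool} (huv : octahedron.Adj u v) (h0 : x u v = 0) :
    CutRep octahedron.Adj x := by
  have huv' : u.1 ≠ v.1 := huv
  obtain ⟨k, hku, hkv⟩ : ∃ k, k ≠ u.1 ∧ k ≠ v.1 := by
    have : ∀ i j : Fin 3, ∃ k, k ≠ i ∧ k ≠ j := by decide
    exact this _ _
  let H : SimpleGraph (Fin 3 × Bool) :=
    { Adj := fun a b => a ≠ b ∧ ¬ (a.1 = k ∧ b.1 = k)
      symm := ⟨fun a b h => ⟨h.1.symm, fun h' => h.2 h'.symm⟩⟩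
      loopless := ⟨fun a h => h.1 rfl⟩ }
  have hbool : ∀ b : Bool, b = true ∨ b = false := by decide
  have hfin : ∀ j : Fin 3, j = k ∨ j = u.1 ∨ j = v.1 := by
    have : ∀ i j k : Fin 3, i ≠ j → k ≠ i → k ≠ j → ∀ l, l = k ∨ l = i ∨ l = j := by decide
    exact this _ _ _ huv' hku hkv
  have hhalf : ∀ b, MetricIsCutOn H {u, (u.1, !u.2), (v.1, !v.2), (k, b)} := fun b => by
    refine metricIsCutOn_of_ncard_le_four _ (Set.toFinite _) ?_
    have : ({u, (u.1, !u.2), (v.1, !v.2), (k, b)} : Set (Fin 3 × Bool)) =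
        (({u, (u.1, !u.2), (v.1, !v.2), (k, b)} : Finset (Fin 3 × Bool)) :) := by simp
    rw [this, Set.ncard_coe_finset]
    exact Finset.card_le_four
  have hne : ∀ b : Bool, (!b) ≠ b := by decide
  have hinter : ({u, (u.1, !u.2), (v.1, !v.2), (k, true)} : Set (Fin 3 × Bool)) ∩
      {u, (u.1, !u.2), (v.1, !v.2), (k, false)} = {u, (u.1, !u.2), (v.1, !v.2)} := by
    ext w
    simp only [Set.mem_inter_iff, Set.mem_insert_iff, Set.mem_singleton_iff]
    constructor
    · rintro ⟨h | h | h | h, h'⟩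
      · simp [h]
      · simp [h]
      · simp [h]
      · rcases h' with h' | h' | h' | h'
        · simp [h']
        · simp [h']
        · simp [h']
        · rw [h] at h'
          simp at h'
    · rintro (h | h | h) <;> simp [h]
  have hH : MetricIsCutOn H ({u, (u.1, !u.2), (v.1, !v.2), (k, true)} ∪
      {u, (u.1, !u.2), (v.1, !v.2), (k, false)}) := by
    refine (hhalf true).union (hhalf false) ?_ ?_ (Or.inr ⟨_, _, _, hinter⟩)
    · intro a ha b hb hab
      simp only [Set.mem_insert_iff, Set.mem_singleton_iff] at ha hb ⊢
      rcases ha with h | h | h | h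
      · simp [h]
      · simp [h]
      · simp [h]
      · rcases hb with h' | h' | h' | h'
        · simp [h']
        · simp [h']
        · simp [h']
        · exact absurd ⟨by rw [h], by rw [h']⟩ hab.2
    · rw [hinter]
      rintro a ha b - hab
      refine ⟨hab, fun h => ?_⟩
      rcases ha with rfl | rfl | rfl
      exacts [hku h.1.symm, hku h.1.symm, hkv h.1.symm]
  obtain ⟨ι, _, w, T, hw, h1, hT⟩ := hH x hx
  let f : Fin 3 × Bool → Fin 3 × Bool := fun a => if a = v then u else a
  have hxf : ∀ a b, x (f a) (f b) = x a b := by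
    have aux : ∀ b, x u b = x v b := fun b =>
      le_antisymm (by linarith [hx.tri u v b]) (by linarith [hx.tri v u b, hx.symm v u])
    have aux' : ∀ a b, x (f a) b = x a b := fun a b => by
      dsimp only [f]; split_ifs with h
      · rw [h, aux]
      · rfl
    intro a b
    rw [aux', hx.symm, aux', hx.symm]
  have hfmem : ∀ a, f a ∈ ({u, (u.1, !u.2), (v.1, !v.2), (k, true)} ∪
      {u, (u.1, !u.2), (v.1, !v.2), (k, false)} : Set (Fin 3 × Bool)) := by
    intro a
    by_cases hav : a = v
    · simp [f, hav]
    · simp only [f, hav, if_false, Set.mem_union, Set.mem_insert_iff, Set.mem_singleton_iff]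
      have hp : ∀ c : Fin 3 × Bool, a.1 = c.1 → a = c ∨ a = (c.1, !c.2) := fun c hc => by
        rcases Bool.eq_or_eq_not a.2 c.2 with h | h
        · exact Or.inl (Prod.ext hc h)
        · exact Or.inr (Prod.ext hc h)
      rcases hfin a.1 with h | h | h
      · rcases hp (k, true) h with h | h <;> simp [h]
      · rcases hp u h with h | h <;> simp [h]
      · rcases hp v h with h | h
        · exact absurd h hav
        · simp [h]
  have hfk : ∀ a, (f a).1 = k → a.1 = k := by
    intro a h
    dsimp only [f] at h; split_ifs at h
    · exact absurd h.symm hku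
    · exact h
  refine ⟨ι, _, w, fun i => f ⁻¹' T i, hw, h1, fun a b hab => ?_⟩
  change ∑ i, w i * cutSep (T i) (f a) (f b) = _
  rw [← hxf]
  by_cases hfab : f a = f b
  · simp [hfab, cutSep_self, hx.self]
  · exact hT _ _ ⟨⟨hfab, fun h => hab ((hfk a h.1).trans (hfk b h.2).symm)⟩, hfmem a, hfmem b⟩

lemma cutRep_octahedron_of_eq_one {x : Fin 3 × Bool → Fin 3 × Bool → ℝ} (hx : Semimetric x)
    {u v : Fin 3 × Bool} (huv : octahedron.Adj u v) (h1 : x u v = 1) :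
    CutRep octahedron.Adj x := by
  have := (cutRep_octahedron_of_eq_zero (hx.switchAt v) huv (by
    simp [switchAt, h1, huv.ne])).switchAt v
  rwa [switchAt_switchAt] at this

/-- A point at which at most one of finitely many linear inequalities is tight can be moved
along the kernel of a single functional. -/
lemma exists_functional {ι M : Type*} [Finite ι] [AddCommGroup M] [Module ℝ M]
    (L : ι → M →ₗ[ℝ] ℝ) (c : ι → ℝ) (y : M) (hy : ∀ i, L i y ≤ c i)
    (huniq : ∀ i j, L i y = c i → L j y = c j → i = j) :
    ∃ φ : M →ₗ[ℝ] ℝ, ∀ h, φ h = 0 → ∀ᶠ s in 𝓝 (0 : ℝ), ∀ i, L i (y + s • h) ≤ c i := by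
  have hslack : ∀ i h, L i y < c i → ∀ᶠ s in 𝓝 (0 : ℝ), L i (y + s • h) ≤ c i := by
    intro i h hi
    have : Tendsto (fun s : ℝ => L i (y + s • h)) (𝓝 0) (𝓝 (L i y)) := by
      have hc : Continuous fun s : ℝ => L i y + s * L i h := by fun_prop
      have := hc.tendsto 0
      simpa using this
    exact (this.eventually (gt_mem_nhds hi)).mono fun s hs => hs.le
  by_cases htight : ∃ i, L i y = c i
  · obtain ⟨i₀, hi₀⟩ := htight
    refine ⟨L i₀, fun h hh => eventually_all.2 fun i => ?_⟩
    by_cases hi : L i y = c i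
    · rw [huniq i i₀ hi hi₀]
      simp [hh, hi₀]
    · exact hslack i h (lt_of_le_of_ne (hy i) hi)
  · push Not at htight
    exact ⟨0, fun h _ => eventually_all.2 fun i =>
      hslack i h (lt_of_le_of_ne (hy i) (htight i))⟩

/-- The inequalities valid for cuts of a triangle. -/
def TriangleIneqs (p q r : ℝ) : Prop := p ≤ q + r ∧ q ≤ p + r ∧ r ≤ p + q ∧ p + q + r ≤ 2

/-- The inequalities valid for cuts of a four-cycle. -/
def QuadIneqs (p q r t : ℝ) : Prop :=
  (p ≤ q + r + t ∧ q ≤ p + r + t ∧ r ≤ p + q + t ∧ t ≤ p + q + r) ∧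
    q + r + t ≤ p + 2 ∧ p + r + t ≤ q + 2 ∧ p + q + t ≤ r + 2 ∧ p + q + r ≤ t + 2

lemma TriangleIneqs.exists_functional {M : Type*} [AddCommGroup M] [Module ℝ M]
    (p q r : M →ₗ[ℝ] ℝ) (y : M) (hp : 0 < p y ∧ p y < 1) (hq : 0 < q y ∧ q y < 1)
    (hr : 0 < r y ∧ r y < 1) (h : TriangleIneqs (p y) (q y) (r y)) :
    ∃ φ : M →ₗ[ℝ] ℝ, ∀ h, φ h = 0 → ∀ᶠ s in 𝓝 (0 : ℝ),
      TriangleIneqs (p (y + s • h)) (q (y + s • h)) (r (y + s • h)) := by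
  obtain ⟨h1, h2, h3, h4⟩ := h
  obtain ⟨φ, hφ⟩ := _root_.exists_functional
    ![p - q - r, q - p - r, r - p - q, p + q + r] ![0, 0, 0, 2] y
    (by intro i; fin_cases i <;> simp <;> linarith)
    (by
      intro i j
      fin_cases i <;> fin_cases j <;> simp <;> intros <;> linarith)
  refine ⟨φ, fun h hh => (hφ h hh).mono fun s hs => ?_⟩
  have a1 := hs 0
  have a2 := hs 1
  have a3 := hs 2
  have a4 := hs 3
  simp only [Matrix.cons_val, LinearMap.sub_apply, LinearMap.add_apply] at a1 a2 a3 a4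
  exact ⟨by linarith, by linarith, by linarith, by linarith⟩

lemma QuadIneqs.exists_functional {M : Type*} [AddCommGroup M] [Module ℝ M]
    (p q r t : M →ₗ[ℝ] ℝ) (y : M) (hp : 0 < p y ∧ p y < 1) (hq : 0 < q y ∧ q y < 1)
    (hr : 0 < r y ∧ r y < 1) (ht : 0 < t y ∧ t y < 1) (h : QuadIneqs (p y) (q y) (r y) (t y)) :
    ∃ φ : M →ₗ[ℝ] ℝ, ∀ h, φ h = 0 → ∀ᶠ s in 𝓝 (0 : ℝ),
      QuadIneqs (p (y + s • h)) (q (y + s • h)) (r (y + s • h)) (t (y + s • h)) := by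
  obtain ⟨⟨h1, h2, h3, h4⟩, h5, h6, h7, h8⟩ := h
  obtain ⟨φ, hφ⟩ := _root_.exists_functional
    ![p - q - r - t, q - p - r - t, r - p - q - t, t - p - q - r, q + r + t - p, p + r + t - q,
      p + q + t - r, p + q + r - t] ![0, 0, 0, 0, 2, 2, 2, 2] y
    (by intro i; fin_cases i <;> simp <;> linarith)
    (by
      intro i j
      fin_cases i <;> fin_cases j <;> simp <;> intros <;> linarith)
  refine ⟨φ, fun h hh => (hφ h hh).mono fun s hs => ?_⟩
  have a1 := hs 0
  have a2 := hs 1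
  have a3 := hs 2
  have a4 := hs 3
  have a5 := hs 4
  have a6 := hs 5
  have a7 := hs 6
  have a8 := hs 7
  simp only [Matrix.cons_val, LinearMap.sub_apply, LinearMap.add_apply] at a1 a2 a3 a4 a5 a6 a7 a8
  exact ⟨⟨by linarith, by linarith, by linarith, by linarith⟩, by linarith, by linarith,
    by linarith, by linarith⟩

/-- The symmetric function on the pairs of vertices of the octahedron with the given values at the
edges; `(i, a, b)` stands for the edge joining `(i, a)` to `(i + 1, b)`. -/
def octExtend (y : Fin 3 × Bool × Bool → ℝ) (u v : Fin 3 × Bool) : ℝ :=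
  if v.1 = u.1 + 1 then y (u.1, u.2, v.2)
  else if u.1 = v.1 + 1 then y (v.1, v.2, u.2) else 0

/-- The polytope cut out by the bounds, triangle and four-cycle inequalities of the octahedron. -/
def octPolytope : Set (Fin 3 × Bool × Bool → ℝ) :=
  {y | (∀ e, 0 ≤ y e ∧ y e ≤ 1) ∧
    (∀ a b c : Bool, TriangleIneqs (y (0, a, b)) (y (1, b, c)) (y (2, c, a))) ∧
    ∀ i : Fin 3, QuadIneqs (y (i, true, true)) (y (i, false, true)) (y (i, false, false))
      (y (i, true, false))}

lemma shortCycles_octExtend {y : Fin 3 × Bool × Bool → ℝ} (hy : y ∈ octPolytope) :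
    ShortCycles octahedron (octExtend y) := by
  obtain ⟨hb, ht, hq⟩ := hy
  have hfin : ∀ i j : Fin 3, i ≠ j → j = i + 1 ∨ (i = j + 1 ∧ j ≠ i + 1) := by decide
  have hsymm : ∀ u v, octExtend y u v = octExtend y v u := by
    intro u v
    have : ∀ i j : Fin 3, j = i + 1 → i ≠ j + 1 := by decide
    unfold octExtend
    split_ifs with h1 h2
    · exact absurd h2 (this _ _ h1)
    · rfl
    · rfl
    · rfl
  have hbounds : ∀ u v, octahedron.Adj u v → 0 ≤ octExtend y u v ∧ octExtend y u v ≤ 1 := by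
    intro u v huv
    unfold octExtend
    split_ifs
    exacts [hb _, hb _, ⟨le_rfl, zero_le_one⟩]
  have htri : ∀ a b c, octahedron.Adj a b → octahedron.Adj b c → octahedron.Adj c a →
      TriangleIneqs (octExtend y a b) (octExtend y b c) (octExtend y c a) := by
    rintro ⟨i, a⟩ ⟨j, b⟩ ⟨k, c⟩ hij hjk hki
    simp only [octahedron] at hij hjk hki
    have t1 := ht a b c
    have t2 := ht a c b
    have t3 := ht b a c
    have t4 := ht b c a
    have t5 := ht c a b
    have t6 := ht c b a
    simp only [TriangleIneqs] at *
    fin_cases i <;> fin_cases j <;> first | exact absurd rfl hij | skip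
    all_goals fin_cases k <;> first | exact absurd rfl hjk | exact absurd rfl hki | skip
    all_goals
      simp [octExtend]
      refine ⟨?_, ?_, ?_, ?_⟩ <;> linarith
  have hquad : ∀ a b c d, octahedron.Adj a b → octahedron.Adj b c → octahedron.Adj c d →
      octahedron.Adj d a → octExtend y d a ≤ octExtend y a b + octExtend y b c + octExtend y c d ∧
        octExtend y a b + octExtend y b c + octExtend y c d - octExtend y d a ≤ 2 := by
    intro a b c d hab hbc hcd hda
    by_cases hac : a.1 = c.1
    · by_cases hbd : b.1 = d.1
      · obtain ⟨i, a⟩ := a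
        obtain ⟨j, b⟩ := b
        obtain ⟨k, c⟩ := c
        obtain ⟨l, d⟩ := d
        dsimp only at hac hbd
        subst hac hbd
        have b1 := hbounds _ _ hab
        have b2 := hbounds _ _ hbc
        have b3 := hbounds _ _ hcd
        have b4 := hbounds _ _ hda
        have h0 := hq 0
        have h1 := hq 1
        have h2 := hq 2
        simp only [QuadIneqs] at h0 h1 h2
        simp only [octahedron] at hab
        fin_cases i <;> fin_cases j <;> first | exact absurd rfl hab | skip
        all_goals
          simp [octExtend] at b1 b2 b3 b4 ⊢
          cases a <;> cases b <;> cases c <;> cases d <;> constructor <;> linarith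
      · have h1 := htri a b d hab hbd hda
        have h2 := htri b c d hbc hcd (Ne.symm hbd)
        rw [hsymm d b] at h2
        simp only [TriangleIneqs] at h1 h2
        constructor <;> linarith
    · have h1 := htri a b c hab hbc (Ne.symm hac)
      have h2 := htri a c d hac hcd hda
      rw [hsymm c a] at h1
      simp only [TriangleIneqs] at h1 h2
      constructor <;> linarith
  exact ⟨hsymm, hbounds, fun a b c h1 h2 h3 => (htri a b c h1 h2 h3).2.2.1,
    fun a b c h1 h2 h3 => (htri a b c h1 h2 h3).2.2.2,
    fun a b c d h1 h2 h3 h4 => (hquad a b c d h1 h2 h3 h4).1,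
    fun a b c d h1 h2 h3 h4 => (hquad a b c d h1 h2 h3 h4).2⟩

end Octahedron

section OctahedronPolytope

open Filter Topology

lemma Semimetric.triangleIneqs {V : Type*} {x : V → V → ℝ} (h : Semimetric x) (u v w : V) :
    TriangleIneqs (x u v) (x v w) (x w u) := by
  have h1 := h.tri u v w
  have h2 := h.tri v u w
  have h3 := h.tri u w v
  have h4 := h.perim u v w
  have h5 := h.symm u v
  have h6 := h.symm v w
  have h7 := h.symm w u
  exact ⟨by linarith, by linarith, by linarith, by linarith⟩

lemma Semimetric.quadIneqs {V : Type*} {x : V → V → ℝ} (h : Semimetric x) (a b c d : V) :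
    QuadIneqs (x a b) (x b c) (x c d) (x d a) := by
  obtain ⟨h1, h2, h3, h4⟩ := h.triangleIneqs a b c
  obtain ⟨h5, h6, h7, h8⟩ := h.triangleIneqs c d a
  have := h.symm a c
  exact ⟨⟨by linarith, by linarith, by linarith, by linarith⟩, by linarith, by linarith,
    by linarith, by linarith⟩

/-- The edge coordinates of a function on the pairs of vertices of the octahedron. -/
def octRestrict (x : Fin 3 × Bool → Fin 3 × Bool → ℝ) (e : Fin 3 × Bool × Bool) : ℝ :=
  x (e.1, e.2.1) (e.1 + 1, e.2.2)

lemma octahedron_adj_succ (i : Fin 3) (a b : Bool) : octahedron.Adj (i, a) (i + 1, b) := by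
  have : ∀ i : Fin 3, i ≠ i + 1 := by decide
  exact this i

lemma octExtend_octRestrict {x : Fin 3 × Bool → Fin 3 × Bool → ℝ} (hx : ∀ u v, x u v = x v u)
    {u v : Fin 3 × Bool} (h : octahedron.Adj u v) : octExtend (octRestrict x) u v = x u v := by
  obtain ⟨i, a⟩ := u
  obtain ⟨j, b⟩ := v
  have : ∀ i j : Fin 3, i ≠ j → j = i + 1 ∨ i = j + 1 := by decide
  have := this i j h
  simp only [octExtend, octRestrict]
  split_ifs with h1 h2
  · rw [h1]
  · rw [← h2, hx]
  · tauto

lemma convex_octPolytope : Convex ℝ octPolytope := by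
  rintro y ⟨hb, ht, hq⟩ z ⟨hb', ht', hq'⟩ s t hs h0 hst
  simp only [TriangleIneqs, QuadIneqs] at ht hq ht' hq'
  have h2 : s * 2 + t * 2 = 2 := by linarith
  have h1 : s * 1 + t * 1 = 1 := by linarith
  have key : ∀ {p p' : ℝ}, 0 ≤ p → 0 ≤ p' → 0 ≤ s * p + t * p' := fun hp hp' => by positivity
  refine ⟨fun e => ?_, fun a b c => ?_, fun i => ?_⟩
  · simp only [Pi.add_apply, Pi.smul_apply, smul_eq_mul]
    have k1 := key (hb e).1 (hb' e).1
    have k2 := key (sub_nonneg.2 (hb e).2) (sub_nonneg.2 (hb' e).2)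
    constructor <;> linarith
  · obtain ⟨a1, a2, a3, a4⟩ := ht a b c
    obtain ⟨b1, b2, b3, b4⟩ := ht' a b c
    simp only [TriangleIneqs, Pi.add_apply, Pi.smul_apply, smul_eq_mul]
    have k1 := key (sub_nonneg.2 a1) (sub_nonneg.2 b1)
    have k2 := key (sub_nonneg.2 a2) (sub_nonneg.2 b2)
    have k3 := key (sub_nonneg.2 a3) (sub_nonneg.2 b3)
    have k4 := key (sub_nonneg.2 a4) (sub_nonneg.2 b4)
    refine ⟨?_, ?_, ?_, ?_⟩ <;> linarith
  · obtain ⟨⟨a1, a2, a3, a4⟩, a5, a6, a7, a8⟩ := hq i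
    obtain ⟨⟨b1, b2, b3, b4⟩, b5, b6, b7, b8⟩ := hq' i
    simp only [QuadIneqs, Pi.add_apply, Pi.smul_apply, smul_eq_mul]
    have k1 := key (sub_nonneg.2 a1) (sub_nonneg.2 b1)
    have k2 := key (sub_nonneg.2 a2) (sub_nonneg.2 b2)
    have k3 := key (sub_nonneg.2 a3) (sub_nonneg.2 b3)
    have k4 := key (sub_nonneg.2 a4) (sub_nonneg.2 b4)
    have k5 := key (sub_nonneg.2 a5) (sub_nonneg.2 b5)
    have k6 := key (sub_nonneg.2 a6) (sub_nonneg.2 b6)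
    have k7 := key (sub_nonneg.2 a7) (sub_nonneg.2 b7)
    have k8 := key (sub_nonneg.2 a8) (sub_nonneg.2 b8)
    refine ⟨⟨?_, ?_, ?_, ?_⟩, ?_, ?_, ?_, ?_⟩ <;> linarith

lemma isCompact_octPolytope : IsCompact octPolytope := by
  have hclosed : IsClosed octPolytope := by
    simp only [octPolytope, TriangleIneqs, QuadIneqs, Set.ofPred_and, Set.ofPred_forall]
    repeat' first
      | exact isClosed_le (by fun_prop) (by fun_prop)
      | refine IsClosed.inter ?_ ?_
      | refine isClosed_iInter fun _ => ?_
  refine IsCompact.of_isClosed_subset (isCompact_univ_pi fun _ => isCompact_Icc (a := (0 : ℝ))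
    (b := 1)) hclosed fun y hy e _ => hy.1 e

lemma exists_coordinate_of_extreme {y : Fin 3 × Bool × Bool → ℝ}
    (hy : y ∈ octPolytope.extremePoints ℝ) : ∃ e, y e = 0 ∨ y e = 1 := by
  by_contra! hne
  obtain ⟨⟨hb, ht, hq⟩, hext⟩ := mem_extremePoints.1 hy
  have hb' : ∀ e, 0 < y e ∧ y e < 1 := fun e =>
    ⟨lt_of_le_of_ne (hb e).1 (hne e).1.symm, lt_of_le_of_ne (hb e).2 (hne e).2⟩
  let pr : Fin 3 × Bool × Bool → (Fin 3 × Bool × Bool → ℝ) →ₗ[ℝ] ℝ := LinearMap.proj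
  have ht' := fun t : Bool × Bool × Bool => TriangleIneqs.exists_functional (pr (0, t.1, t.2.1))
    (pr (1, t.2.1, t.2.2)) (pr (2, t.2.2, t.1)) y (hb' _) (hb' _) (hb' _) (ht _ _ _)
  have hq' := fun i : Fin 3 => QuadIneqs.exists_functional (pr (i, true, true))
    (pr (i, false, true)) (pr (i, false, false)) (pr (i, true, false)) y (hb' _) (hb' _) (hb' _)
    (hb' _) (hq _)
  choose φ hφ using ht'
  choose ψ hψ using hq'
  let F : (Fin 3 × Bool × Bool → ℝ) →ₗ[ℝ] (Bool × Bool × Bool) ⊕ Fin 3 → ℝ :=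
    LinearMap.pi (Sum.elim φ ψ)
  have hker : F.ker ≠ ⊥ := LinearMap.ker_ne_bot_of_finrank_lt (by simp)
  obtain ⟨h, hF, h0⟩ := Submodule.exists_mem_ne_zero_of_ne_bot hker
  rw [LinearMap.mem_ker] at hF
  have hmem : ∀ᶠ s in 𝓝 (0 : ℝ), y + s • h ∈ octPolytope := by
    have e1 : ∀ᶠ s in 𝓝 (0 : ℝ), ∀ e, 0 < (y + s • h) e ∧ (y + s • h) e < 1 := by
      refine eventually_all.2 fun e => ?_
      have : Tendsto (fun s : ℝ => (y + s • h) e) (𝓝 0) (𝓝 (y e)) := by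
        have hc : Continuous fun s : ℝ => y e + s * h e := by fun_prop
        simpa using hc.tendsto 0
      exact (this.eventually (lt_mem_nhds (hb' e).1)).and (this.eventually (gt_mem_nhds (hb' e).2))
    have e2 := eventually_all.2 fun t => hφ t h (congrFun hF (Sum.inl t))
    have e3 := eventually_all.2 fun i => hψ i h (congrFun hF (Sum.inr i))
    filter_upwards [e1, e2, e3] with s h1 h2 h3
    exact ⟨fun e => ⟨(h1 e).1.le, (h1 e).2.le⟩, fun a b c => h2 (a, b, c), h3⟩
  have hneg : ∀ᶠ s in 𝓝 (0 : ℝ), y + (-s) • h ∈ octPolytope := by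
    have : Tendsto (fun s : ℝ => -s) (𝓝 0) (𝓝 0) := by
      simpa using (continuous_neg (G := ℝ)).tendsto 0
    exact this.eventually hmem
  obtain ⟨s, ⟨hs1, hs2⟩, hs0⟩ :=
    (((hmem.and hneg).filter_mono nhdsWithin_le_nhds).and self_mem_nhdsWithin
      : ∀ᶠ s in 𝓝[>] (0 : ℝ), _).exists
  have := (hext _ hs1 _ hs2 ⟨1 / 2, 1 / 2, by norm_num, by norm_num, by norm_num, by
    module⟩).1
  rw [add_eq_left, smul_eq_zero] at this
  exact this.elim (ne_of_gt hs0) h0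

lemma metricIsCutOn_octahedron : MetricIsCutOn octahedron Set.univ := by
  set Q : Set (Fin 3 × Bool × Bool → ℝ) :=
    convexHull ℝ (Set.range fun T : Set (Fin 3 × Bool) => octRestrict (cutSep T)) with hQ
  have hext : octPolytope.extremePoints ℝ ⊆ Q := by
    intro y hy
    obtain ⟨x, hx, hxy⟩ :=
      (shortCycles_octExtend hy.1).exists_semimetric inducedCyclesLe4_octahedron
    have hxy' : ∀ i a b, x (i, a) (i + 1, b) = y (i, a, b) := fun i a b => by
      rw [hxy _ _ (octahedron_adj_succ i a b)]
      simp [octExtend]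
    obtain ⟨⟨i, a, b⟩, he⟩ := exists_coordinate_of_extreme hy
    have hrep : CutRep octahedron.Adj x := by
      rcases he with he | he
      · exact cutRep_octahedron_of_eq_zero hx (octahedron_adj_succ i a b) ((hxy' i a b).trans he)
      · exact cutRep_octahedron_of_eq_one hx (octahedron_adj_succ i a b) ((hxy' i a b).trans he)
    obtain ⟨ι, _, w, T, hw, h1, hT⟩ := hrep
    refine mem_convexHull_of_exists_fintype w (fun i => octRestrict (cutSep (T i))) hw h1
      (fun i => ⟨T i, rfl⟩) ?_
    funext e
    rw [Finset.sum_apply]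
    exact (hT _ _ (octahedron_adj_succ e.1 e.2.1 e.2.2)).trans (hxy' _ _ _)
  have hsub : octPolytope ⊆ Q := by
    rw [← closure_convexHull_extremePoints isCompact_octPolytope convex_octPolytope]
    exact closure_minimal (convexHull_min hext (convex_convexHull ℝ _))
      ((Set.finite_range _).isClosed_convexHull ℝ)
  intro x hx
  have hmem : octRestrict x ∈ Q := by
    refine hsub ⟨fun e => ⟨hx.nonneg _ _, ?_⟩, fun a b c => ?_, fun i => ?_⟩
    · have := hx.perim (e.1, e.2.1) (e.1 + 1, e.2.2) (e.1, e.2.1)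
      rw [hx.self, hx.symm (e.1 + 1, e.2.2)] at this
      simp only [octRestrict]
      linarith
    · exact hx.triangleIneqs (0, a) (1, b) (2, c)
    · have := hx.quadIneqs (i, true) (i + 1, true) (i, false) (i + 1, false)
      rw [hx.symm (i + 1, true), hx.symm (i + 1, false)] at this
      exact this
  rw [hQ, convexHull_eq] at hmem
  obtain ⟨ι, t, w, z, hw, h1, hz, hc⟩ := hmem
  choose T hT using hz
  classical
  refine ⟨t, inferInstance, fun i => w i, fun i => T i i.2, fun i => hw i i.2, ?_, ?_⟩
  · rw [← h1]
    exact Finset.sum_coe_sort t w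
  · rintro u v ⟨huv, -, -⟩
    rw [← octExtend_octRestrict hx.symm huv, ← hc, Finset.centerMass_eq_of_sum_1 _ _ h1]
    have hz' : ∀ i : t, cutSep (T i i.2) u v = octExtend (z i) u v := fun i => by
      rw [← hT i i.2, octExtend_octRestrict (cutSep_comm _) huv]
    simp only [hz']
    rw [Finset.sum_coe_sort t fun i => w i * octExtend (z i) u v]
    unfold octExtend
    split_ifs <;> simp [Finset.sum_apply]

end OctahedronPolytope

section Reduction

variable {V W : Type*} {G : SimpleGraph V}

/-- Replacing every vertex of a `K₅` model by a connected set yields a `K₅` model. -/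
lemma HasK5Minor.lift {H : SimpleGraph W} (h : HasK5Minor H) (Φ : W → Set V)
    (conn : ∀ w, ConnectedOn G (Φ w)) (disj : ∀ w w', w ≠ w' → ∀ x ∈ Φ w, x ∉ Φ w')
    (adj : ∀ w w', H.Adj w w' → Linked G (Φ w) (Φ w')) : HasK5Minor G := by
  obtain ⟨B, hne, hdisj, hconn, hadj⟩ := h
  refine ⟨fun i => ⋃ w ∈ B i, Φ w, fun i => ?_, fun i j hij => ?_, fun i => ?_, fun i j hij => ?_⟩
  · obtain ⟨w, hw⟩ := hne i
    obtain ⟨x, hx⟩ := (conn w).1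
    exact ⟨x, Set.mem_biUnion hw hx⟩
  · rw [Set.disjoint_left]
    intro x hx hx'
    simp only [Set.mem_iUnion] at hx hx'
    obtain ⟨w, hw, hxw⟩ := hx
    obtain ⟨w', hw', hxw'⟩ := hx'
    refine disj w w' ?_ x hxw hxw'
    rintro rfl
    exact Set.disjoint_left.1 (hdisj i j hij) hw hw'
  · have hB := ConnectedOn.of_connected_induce (hconn i)
    refine ConnectedOn.connected_induce ⟨?_, fun X hX hXne hcl => ?_⟩
    · obtain ⟨w, hw⟩ := hne i
      obtain ⟨x, hx⟩ := (conn w).1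
      exact ⟨x, Set.mem_biUnion hw hx⟩
    · have hfull : ∀ w ∈ B i, (Φ w ∩ X).Nonempty → Φ w ⊆ X := by
        intro w hw hwX
        exact ((conn w).2 (Φ w ∩ X) Set.inter_subset_left hwX fun a ha b hb hab =>
          ⟨hb, hcl a ha.2 b (Set.mem_biUnion hw hb) hab⟩).trans Set.inter_subset_right
      have hsub : B i ⊆ {w ∈ B i | (Φ w ∩ X).Nonempty} := by
        refine hB.2 _ (fun w hw => hw.1) ?_ ?_
        · obtain ⟨x, hx⟩ := hXne
          obtain ⟨w, hw, hxw⟩ := Set.mem_iUnion₂.1 (hX hx)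
          exact ⟨w, hw, x, hxw, hx⟩
        · rintro w ⟨hw, hwX⟩ w' hw' hww'
          obtain ⟨a, ha, b, hb, hab⟩ := adj w w' hww'
          exact ⟨hw', b, hb, hcl a (hfull w hw hwX ha) b (Set.mem_biUnion hw' hb) hab⟩
      exact Set.iUnion₂_subset fun w hw => hfull w hw (hsub hw).2
  · obtain ⟨w, hw, w', hw', hww'⟩ := hadj i j hij
    refine (adj w w' hww').mono ?_ (Set.subset_biUnion_of_mem hw')
    exact Set.subset_biUnion_of_mem hw

/-- The graph obtained from `G` by making `S` a clique. -/
def addClique (G : SimpleGraph V) (S : Set V) : SimpleGraph V where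
  Adj a b := G.Adj a b ∨ a ≠ b ∧ a ∈ S ∧ b ∈ S
  symm := ⟨fun _ _ h => h.imp (fun h => h.symm) fun h => ⟨h.1.symm, h.2.2, h.2.1⟩⟩
  loopless := ⟨fun _ h => h.elim (fun h => h.ne rfl) fun h => h.1 rfl⟩

/-- `C` is the vertex set of a component of `G - S`. -/
structure IsComponent (G : SimpleGraph V) (S C : Set V) : Prop where
  conn : ConnectedOn G C
  disj : ∀ a ∈ C, a ∉ S
  closed : ∀ a ∈ C, ∀ b, b ∉ S → G.Adj a b → b ∈ C

lemma exists_isComponent (G : SimpleGraph V) {S : Set V} {v : V} (hv : v ∉ S) :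
    ∃ C, IsComponent G S C ∧ v ∈ C := by
  obtain ⟨C, hC, hvC, hconn, hcl⟩ := exists_component (G := G) (X := Sᶜ) hv
  exact ⟨C, ⟨hconn, hC, hcl⟩, hvC⟩

lemma IsComponent.subset_of_mem {S C D : Set V} (hC : IsComponent G S C) (hD : IsComponent G S D)
    {v : V} (hvC : v ∈ C) (hvD : v ∈ D) : C ⊆ D := by
  intro x hx
  by_contra hxD
  obtain ⟨c, -, hcD, d, hd, hdD, hcd⟩ := hC.conn.exists_crossing hvC hvD hx hxD
  exact hdD (hD.closed c hcD d (hC.disj d hd) hcd)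

lemma IsComponent.eq_of_mem {S C D : Set V} (hC : IsComponent G S C) (hD : IsComponent G S D)
    {v : V} (hvC : v ∈ C) (hvD : v ∈ D) : C = D :=
  (hC.subset_of_mem hD hvC hvD).antisymm (hD.subset_of_mem hC hvD hvC)

lemma IsComponent.disjoint {S C D : Set V} (hC : IsComponent G S C) (hD : IsComponent G S D)
    (h : C ≠ D) : ∀ x ∈ C, x ∉ D := fun _ hx hx' => h (hC.eq_of_mem hD hx hx')

lemma IsComponent.not_adj {S C D : Set V} (hC : IsComponent G S C) (hD : IsComponent G S D)
    (h : C ≠ D) : ∀ a ∈ C, ∀ b ∈ D, ¬ G.Adj a b := fun a ha b hb hab =>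
  hC.disjoint hD h b (hC.closed a ha b (hD.disj b hb) hab) hb

/-- The vertices outside `A` with a neighbour in `A`. -/
def outerBoundary (G : SimpleGraph V) (A : Set V) : Set V := {s | s ∉ A ∧ Linked G {s} A}

lemma mem_outerBoundary_of_adj {A : Set V} {a s : V} (ha : a ∈ A) (hs : s ∉ A) (h : G.Adj a s) :
    s ∈ outerBoundary G A := ⟨hs, s, rfl, a, ha, h.symm⟩

lemma isComponent_outerBoundary {A : Set V} (hA : ConnectedOn G A) :
    IsComponent G (outerBoundary G A) A :=
  ⟨hA, fun _ ha h => h.1 ha, fun _ ha _ hb hab =>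
    by_contra fun hbA => hb (mem_outerBoundary_of_adj ha hbA hab)⟩

lemma IsComponent.outerBoundary_subset {S C : Set V} (hC : IsComponent G S C) :
    outerBoundary G C ⊆ S := by
  rintro s ⟨hs, t, rfl, a, ha, hta⟩
  by_contra hsS
  exact hs (hC.closed a ha _ hsS hta.symm)

/-- The set `S` can be made a clique by contracting disjoint connected sets avoiding `C`. -/
def RootedOff (G : SimpleGraph V) (S C : Set V) : Prop :=
  ∃ R : V → Set V, (∀ s ∈ S, s ∈ R s ∧ ConnectedOn G (R s) ∧ ∀ x ∈ R s, x ∉ C) ∧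
    ∀ s ∈ S, ∀ t ∈ S, s ≠ t → (∀ x ∈ R s, x ∉ R t) ∧ Linked G (R s) (R t)

lemma not_hasK5Minor_addClique (hK : ¬ HasK5Minor G) {S C : Set V}
    (hR : RootedOff G S C) : ¬ HasK5Minor ((addClique G S).induce (C ∪ S)) := by
  classical
  intro h
  obtain ⟨R, hR1, hR2⟩ := hR
  let Φ : ↥(C ∪ S) → Set V := fun w => if w.1 ∈ S then R w else {w.1}
  have hΦS : ∀ w : ↥(C ∪ S), w.1 ∈ S → Φ w = R w := fun w hw => if_pos hw
  have hΦC : ∀ w : ↥(C ∪ S), w.1 ∉ S → Φ w = {w.1} := fun w hw => if_neg hw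
  have hself : ∀ w, w.1 ∈ Φ w := fun w => by
    by_cases hw : w.1 ∈ S
    · rw [hΦS w hw]; exact (hR1 _ hw).1
    · rw [hΦC w hw]; rfl
  have hC : ∀ w : ↥(C ∪ S), w.1 ∉ S → w.1 ∈ C := fun w hw => w.2.resolve_right hw
  refine hK (h.lift Φ (fun w => ?_) (fun w w' hww' x hx hx' => ?_) (fun w w' hww' => ?_))
  · by_cases hw : w.1 ∈ S
    · rw [hΦS w hw]; exact (hR1 _ hw).2.1
    · rw [hΦC w hw]; exact connectedOn_singleton _
  · have hne : w.1 ≠ w'.1 := fun h => hww' (Subtype.ext h)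
    by_cases hw : w.1 ∈ S <;> by_cases hw' : w'.1 ∈ S
    · rw [hΦS w hw] at hx
      rw [hΦS w' hw'] at hx'
      exact (hR2 _ hw _ hw' hne).1 x hx hx'
    · rw [hΦS w hw] at hx
      rw [hΦC w' hw', Set.mem_singleton_iff] at hx'
      exact (hR1 _ hw).2.2 x hx (hx' ▸ hC w' hw')
    · rw [hΦC w hw, Set.mem_singleton_iff] at hx
      rw [hΦS w' hw'] at hx'
      exact (hR1 _ hw').2.2 x hx' (hx ▸ hC w hw)
    · rw [hΦC w hw, Set.mem_singleton_iff] at hx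
      rw [hΦC w' hw', Set.mem_singleton_iff] at hx'
      exact hne (hx.symm.trans hx')
  · rcases hww' with h' | ⟨hne, hw, hw'⟩
    · exact ⟨w, hself w, w', hself w', h'⟩
    · rw [hΦS w hw, hΦS w' hw']
      exact (hR2 _ hw _ hw' hne).2

lemma inducedCyclesLe4_addClique (hG : InducedCyclesLe4 G) {S C B : Set V}
    (hCS : ∀ a ∈ C, a ∉ S) (hB : ConnectedOn G B) (hBC : ∀ a ∈ C, a ∉ B)
    (hBC' : ∀ a ∈ C, ∀ b ∈ B, ¬ G.Adj a b)
    (hBS : ∀ s ∈ S, s ∉ B ∧ Linked G {s} B) :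
    InducedCyclesLe4 ((addClique G S).induce (C ∪ S)) := by
  intro k hk v hv hadj
  by_contra hlt
  have : NeZero k := ⟨by omega⟩
  have hcast : ∀ m n : ℕ, m < k → n < k → (m : ZMod k) = n → m = n := fun m n hm hn h => by
    rwa [ZMod.natCast_eq_natCast_iff', Nat.mod_eq_of_lt hm, Nat.mod_eq_of_lt hn] at h
  by_cases hall : ∀ i j, (addClique G S).Adj (v i) (v j) → G.Adj (v i) (v j)
  · refine hlt (hG k hk (fun i => (v i).1) (fun i j h => hv (Subtype.ext h)) fun i j => ?_)
    rw [← hadj i j]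
    exact ⟨fun h => Or.inl h, fun h => hall i j h⟩
  have hnew : ∃ i, (v i).1 ∈ S ∧ (v (i + 1)).1 ∈ S ∧ ¬ G.Adj (v (i + 1)) (v i) := by
    push Not at hall
    obtain ⟨i, j, hij, hij'⟩ := hall
    have hS := hij.resolve_left hij'
    rcases (hadj i j).1 hij with h | h
    · exact ⟨j, hS.2.2, by rw [← h, add_sub_cancel]; exact hS.2.1, by
        rw [← h, add_sub_cancel]; exact hij'⟩
    · exact ⟨i, hS.2.1, by rw [← h, add_sub_cancel]; exact hS.2.2, by
        rw [← h, add_sub_cancel]; exact fun h => hij' h.symm⟩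
  obtain ⟨i, hiS, hjS, hnadj⟩ := hnew
  set f : ℕ → V := fun n => (v (i + 1 + n)).1 with hf
  have f0 : f 0 = (v (i + 1)).1 := by simp [hf]
  have flast : f (k - 1) = (v i).1 := by
    have : ((k - 1 : ℕ) : ZMod k) = -1 := by
      rw [Nat.cast_sub (by omega)]; simp
    simp [hf, this]
  have finj : ∀ m n, m < k → n < k → f m = f n → m = n := fun m n hm hn h => by
    have := hv (Subtype.ext h)
    exact hcast m n hm hn (add_left_cancel this)
  have fadj : ∀ m n, m < k → n < k → m < n → ((addClique G S).Adj (f m) (f n) ↔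
      n = m + 1 ∨ (m = 0 ∧ n = k - 1)) := by
    intro m n hm hn hmn
    refine (hadj _ _).trans ?_
    rw [add_sub_add_left_eq_sub, add_sub_add_left_eq_sub, sub_eq_iff_eq_add, sub_eq_iff_eq_add]
    constructor
    · rintro (h | h)
      · right
        rcases Nat.lt_or_ge (n + 1) k with hn' | hn'
        · have := hcast m (n + 1) hm hn' (by push_cast; rw [h]; ring)
          omega
        · have hnk : n + 1 = k := by omega
          have h0 : ((1 + n : ℕ) : ZMod k) = 0 := by
            rw [add_comm, hnk]; simp
          have := hcast m 0 hm (by omega) (by rw [h]; push_cast at h0 ⊢; exact h0)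
          omega
      · left
        rcases Nat.lt_or_ge (m + 1) k with hm' | hm'
        · exact hcast n (m + 1) hn hm' (by push_cast; rw [h]; ring)
        · omega
    · rintro (rfl | ⟨rfl, rfl⟩)
      · right; push_cast; ring
      · left
        rw [Nat.cast_sub (by omega)]; simp
  have fC : ∀ m, 1 ≤ m → m ≤ k - 2 → f m ∈ C ∧ f m ∉ S := by
    intro m hm1 hm2
    have hmS : f m ∉ S := by
      intro hmS
      have a1 := (fadj 0 m (by omega) (by omega) (by omega)).1
        (Or.inr ⟨fun h => by have := finj 0 m (by omega) (by omega) h; omega, f0 ▸ hjS, hmS⟩)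
      have a2 := (fadj m (k - 1) (by omega) (by omega) (by omega)).1
        (Or.inr ⟨fun h => by have := finj m (k - 1) (by omega) (by omega) h; omega, hmS,
          flast ▸ hiS⟩)
      omega
    exact ⟨(v _).2.resolve_right hmS, hmS⟩
  have fG : ∀ m, m + 1 < k → f m ∉ S ∨ f (m + 1) ∉ S → G.Adj (f m) (f (m + 1)) := by
    intro m hm h
    rcases (fadj m (m + 1) (by omega) hm (by omega)).2 (Or.inl rfl) with h' | h'
    · exact h'
    · exact absurd h (by simp [h'.2.1, h'.2.2])
  have hPC : ∀ a ∈ f '' Set.Icc 1 (k - 2), a ∈ C := by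
    rintro _ ⟨m, ⟨h1, h2⟩, rfl⟩
    exact (fC m h1 h2).1
  have hne : (v (i + 1)).1 ≠ (v i).1 := fun h => by
    rw [← f0, ← flast] at h
    have := finj 0 (k - 1) (by omega) (by omega) h
    omega
  obtain ⟨_, ⟨m, ⟨h1, h2⟩, rfl⟩, ha1, ha2⟩ := hG.exists_common_neighbor (A := f '' Set.Icc 1 (k - 2))
    (B := B) (u := (v (i + 1)).1) (v := (v i).1)
    (connectedOn_image_Icc (by omega) fun m h1 h2 =>
      fG m (by omega) (Or.inl (fC m h1 (by omega)).2)) hB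
    (fun a ha => hBC a (hPC a ha)) (fun a ha => hBC' a (hPC a ha)) hne hnadj
    (fun h => hCS _ (hPC _ h) hjS) (fun h => hCS _ (hPC _ h) hiS) (hBS _ hjS).1 (hBS _ hiS).1
    ⟨_, rfl, f 1, ⟨1, ⟨le_rfl, by omega⟩, rfl⟩, by
      rw [← f0]; exact fG 0 (by omega) (Or.inr (fC 1 le_rfl (by omega)).2)⟩
    ⟨_, rfl, f (k - 2), ⟨k - 2, ⟨by omega, le_rfl⟩, rfl⟩, by
      have := fG (k - 2) (by omega) (Or.inl (fC (k - 2) (by omega) le_rfl).2)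
      rw [← flast, show k - 1 = k - 2 + 1 by omega]
      exact this.symm⟩ (hBS _ hjS).2 (hBS _ hiS).2
  rw [← f0] at ha1
  rw [← flast] at ha2
  have b1 := (fadj 0 m (by omega) (by omega) (by omega)).1 (Or.inl ha1)
  have b2 := (fadj m (k - 1) (by omega) (by omega) (by omega)).1 (Or.inl ha2.symm)
  omega

/-- Every smaller graph without `K₅` minors and long holes satisfies the conclusion of the
structural theorem. -/
def SmallerGraphsOk.{u} (n : ℕ) : Prop :=
  ∀ (W : Type u) [Finite W] (H : SimpleGraph W), Nat.card W < n → ¬ HasK5Minor H →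
    InducedCyclesLe4 H → MetricIsCutOn H Set.univ

end Reduction

section ReductionStep

universe u

variable {V : Type u} [Finite V] {G : SimpleGraph V}

lemma metricIsCutOn_of_separator (ih : SmallerGraphsOk.{u} (Nat.card V)) (hK : ¬ HasK5Minor G)
    (hG : InducedCyclesLe4 G) {S : Set V} (hS : S = ∅ ∨ ∃ a b c, S = {a, b, c})
    (hC : ∀ C, IsComponent G S C → RootedOff G S C ∧ ∃ B, IsComponent G S B ∧ B ≠ C ∧
      ∀ s ∈ S, Linked G {s} B) : MetricIsCutOn G Set.univ := by
  have hpiece : ∀ C, IsComponent G S C → MetricIsCutOn (addClique G S) (C ∪ S) := by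
    intro C hCc
    obtain ⟨hR, B, hB, hBC, hBS⟩ := hC C hCc
    refine (ih _ _ ?_ (not_hasK5Minor_addClique hK hR) (inducedCyclesLe4_addClique hG hCc.disj
      hB.conn (hCc.disjoint hB hBC.symm) (hCc.not_adj hB hBC.symm)
      fun s hs => ⟨fun h => hB.disj s h hs, hBS s hs⟩)).of_induce
    rw [Nat.card_coe_set_eq]
    obtain ⟨b, hb⟩ := hB.conn.1
    refine Set.ncard_lt_card fun h => ?_
    rcases h ▸ Set.mem_univ b with h' | h'
    · exact hB.disjoint hCc hBC b hb h'
    · exact hB.disj b hb h'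
  set F : Set (Set V) := {X | S ⊆ X ∧ MetricIsCutOn (addClique G S) X ∧
    ∀ a ∈ X, a ∉ S → ∀ b, b ∉ S → G.Adj a b → b ∈ X}
  have hSF : S ∈ F := by
    refine ⟨subset_rfl, metricIsCutOn_of_ncard_le_four _ S.toFinite ?_,
      fun a ha ha' => absurd ha ha'⟩
    rcases hS with rfl | ⟨a, b, c, rfl⟩
    · simp
    · exact (Set.ncard_insert_le _ _).trans (Nat.succ_le_succ ((Set.ncard_insert_le _ _).trans
        (by simp)))
  obtain ⟨X, ⟨hSX, hX, hXcl⟩, hmax⟩ := F.toFinite.exists_maximal ⟨S, hSF⟩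
  suffices X = Set.univ from (this ▸ hX).mono (fun a b h => Or.inl h) subset_rfl
  by_contra hne
  obtain ⟨v, hv⟩ := (Set.ne_univ_iff_exists_notMem X).1 hne
  obtain ⟨C, hCc, hvC⟩ := exists_isComponent G (S := S) (v := v) fun h => hv (hSX h)
  have hCX : ∀ a ∈ C, a ∉ X := by
    intro a ha haX
    obtain ⟨c, hc, hcX, d, hd, hdX, hcd⟩ := hCc.conn.exists_crossing ha haX hvC hv
    exact hdX (hXcl c hcX (hCc.disj c hc) d (hCc.disj d hd) hcd)
  have hinter : X ∩ (C ∪ S) = S := by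
    ext a
    constructor
    · rintro ⟨haX, ha | ha⟩
      exacts [absurd haX (hCX a ha), ha]
    · exact fun ha => ⟨hSX ha, Or.inr ha⟩
  have hU : X ∪ (C ∪ S) ∈ F := by
    refine ⟨fun a ha => Or.inl (hSX ha), hX.union (hpiece C hCc) ?_ ?_ ?_, ?_⟩
    · rintro a ha b (hb | hb) hab
      · by_cases haS : a ∈ S
        · exact Or.inl (Or.inr haS)
        · rcases hab with hab | hab
          · exact absurd (hXcl a ha haS b (hCc.disj b hb) hab) (hCX b hb)
          · exact absurd hab.2.1 haS
      · exact Or.inr (hSX hb)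
    · rw [hinter]
      exact fun a ha b hb hab => Or.inr ⟨hab, ha, hb⟩
    · rwa [hinter]
    · rintro a (ha | ha | ha) haS b hb hab
      · exact Or.inl (hXcl a ha haS b hb hab)
      · exact Or.inr (Or.inl (hCc.closed a ha b hb hab))
      · exact absurd ha haS
  exact hv (hmax hU Set.subset_union_left (Or.inr (Or.inl hvC)))

end ReductionStep

section SmallSeparators

universe u

variable {V : Type u} {G : SimpleGraph V}

lemma ConnectedOn.insert_of_linked {B : Set V} (hB : ConnectedOn G B) {s : V}
    (h : Linked G {s} B) : ConnectedOn G (Insert.insert s B) := by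
  obtain ⟨t, rfl, b, hb, hsb⟩ := h
  exact hB.insert hb hsb

lemma rootedOff_of_clique {S C B : Set V} {s₀ : V} (hC : IsComponent G S C)
    (hB : IsComponent G S B) (hBC : B ≠ C) (hBS : ∀ s ∈ S, Linked G {s} B)
    (hcl : ∀ s ∈ S, ∀ t ∈ S, s ≠ t → s ≠ s₀ → t ≠ s₀ → G.Adj s t) : RootedOff G S C := by
  classical
  have hR : ∀ s, s ≠ s₀ → (if s = s₀ then insert s B else {s}) = {s} := fun s hs => if_neg hs
  refine ⟨fun s => if s = s₀ then insert s B else {s}, fun s hs => ?_, fun s hs t ht hst => ?_⟩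
  · dsimp only
    split_ifs with h
    · refine ⟨by simp, hB.conn.insert_of_linked (hBS s hs), ?_⟩
      rintro x (rfl | hx)
      exacts [fun h => hC.disj x h hs, hB.disjoint hC hBC x hx]
    · refine ⟨rfl, connectedOn_singleton s, ?_⟩
      rintro x rfl
      exact fun h => hC.disj x h hs
  · dsimp only
    by_cases h : s = s₀
    · rw [if_pos h, if_neg fun h' => hst (h.trans h'.symm)]
      constructor
      · rintro x (rfl | hx) hx'
        · exact hst hx'
        · rw [Set.mem_singleton_iff.1 hx'] at hx
          exact hB.disj t hx ht
      · exact ((hBS t ht).symm.mono (Set.subset_insert _ _) subset_rfl)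
    · rw [if_neg h]
      by_cases h' : t = s₀
      · rw [if_pos h']
        refine ⟨?_, (hBS s hs).mono subset_rfl (Set.subset_insert _ _)⟩
        rintro x rfl (hx | hx)
        exacts [hst hx, hB.disj x hx hs]
      · rw [if_neg h']
        exact ⟨by rintro x rfl hx; exact hst hx, s, rfl, t, rfl, hcl s hs t ht hst h h'⟩

lemma rootedOff_of_two {C B₁ B₂ : Set V} {u x w : V} (hux : u ≠ x) (huw : u ≠ w) (hxw : x ≠ w)
    (hC : ∀ s ∈ ({u, x, w} : Set V), s ∉ C ∧ s ∉ B₁ ∧ s ∉ B₂)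
    (h1 : ConnectedOn G B₁) (h2 : ConnectedOn G B₂) (h12 : ∀ b ∈ B₁, b ∉ B₂)
    (h1C : ∀ b ∈ B₁, b ∉ C) (h2C : ∀ b ∈ B₂, b ∉ C) (u1 : Linked G {u} B₁)
    (x1 : Linked G {x} B₁) (u2 : Linked G {u} B₂) (x2 : Linked G {x} B₂) (w2 : Linked G {w} B₂) :
    RootedOff G {u, x, w} C := by
  classical
  obtain ⟨uC, uB1, uB2⟩ := hC u (by simp)
  obtain ⟨xC, xB1, xB2⟩ := hC x (by simp)
  obtain ⟨wC, wB1, wB2⟩ := hC w (by simp)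
  let R : V → Set V := fun s => if s = u then insert u B₁ else if s = w then insert w B₂ else {s}
  have Ru : R u = insert u B₁ := if_pos rfl
  have Rw : R w = insert w B₂ := by simp [R, huw.symm]
  have Rx : R x = {x} := by simp [R, hux.symm, hxw]
  have cu := h1.insert_of_linked u1
  have cw := h2.insert_of_linked w2
  have lux : Linked G (insert u B₁) {x} := x1.symm.mono (Set.subset_insert _ _) subset_rfl
  have lxw : Linked G {x} (insert w B₂) := x2.mono subset_rfl (Set.subset_insert _ _)
  have luw : Linked G (insert u B₁) (insert w B₂) :=
    u2.mono (by simp) (Set.subset_insert _ _)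
  refine ⟨R, ?_, ?_⟩
  · rintro s (rfl | rfl | rfl)
    · rw [Ru]; exact ⟨by simp, cu, by rintro y (rfl | hy); exacts [uC, h1C y hy]⟩
    · rw [Rx]; exact ⟨rfl, connectedOn_singleton _, by rintro y rfl; exact xC⟩
    · rw [Rw]; exact ⟨by simp, cw, by rintro y (rfl | hy); exacts [wC, h2C y hy]⟩
  · have dux : ∀ y ∈ insert u B₁, y ∉ ({x} : Set V) := by
      rintro y (rfl | hy) rfl
      exacts [hux rfl, xB1 hy]
    have dxw : ∀ y ∈ ({x} : Set V), y ∉ insert w B₂ := by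
      rintro y rfl (rfl | hy)
      exacts [hxw rfl, xB2 hy]
    have duw : ∀ y ∈ insert u B₁, y ∉ insert w B₂ := by
      rintro y (rfl | hy) (rfl | hy')
      exacts [huw rfl, uB2 hy', wB1 hy, h12 y hy hy']
    rintro s (rfl | rfl | rfl) t (rfl | rfl | rfl) hst
    · exact absurd rfl hst
    · rw [Ru, Rx]; exact ⟨dux, lux⟩
    · rw [Ru, Rw]; exact ⟨duw, luw⟩
    · rw [Ru, Rx]; exact ⟨fun y hy hy' => dux y hy' hy, lux.symm⟩
    · exact absurd rfl hst
    · rw [Rx, Rw]; exact ⟨dxw, lxw⟩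
    · rw [Ru, Rw]; exact ⟨fun y hy hy' => duw y hy' hy, luw.symm⟩
    · rw [Rx, Rw]; exact ⟨fun y hy hy' => dxw y hy' hy, lxw.symm⟩
    · exact absurd rfl hst

/-- `G - S` is disconnected, and every vertex of `S` has a neighbour in each of its components. -/
structure FullSeparator (G : SimpleGraph V) (S : Set V) : Prop where
  linked : ∀ C, IsComponent G S C → ∀ s ∈ S, Linked G {s} C
  ne : ∃ C D, IsComponent G S C ∧ IsComponent G S D ∧ C ≠ D

lemma FullSeparator.exists_ne {S : Set V} (h : FullSeparator G S) (C : Set V) :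
    ∃ D, IsComponent G S D ∧ D ≠ C := by
  obtain ⟨D, E, hD, hE, hDE⟩ := h.ne
  by_cases hDC : D = C
  · exact ⟨E, hE, fun h => hDE (hDC.trans h.symm)⟩
  · exact ⟨D, hD, hDC⟩

/-- Every connected set which does not dominate the graph has at least `k` outer neighbours. -/
def BoundaryAtLeast (G : SimpleGraph V) (k : ℕ) : Prop :=
  ∀ A, ConnectedOn G A → (∃ v, v ∉ A ∧ v ∉ outerBoundary G A) → k ≤ (outerBoundary G A).ncard

lemma BoundaryAtLeast.fullSeparator [Finite V] {S : Set V} (h : BoundaryAtLeast G S.ncard)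
    {C D : Set V} (hC : IsComponent G S C) (hD : IsComponent G S D) (hCD : C ≠ D) :
    FullSeparator G S := by
  refine ⟨fun E hE s hs => ?_, C, D, hC, hD, hCD⟩
  obtain ⟨F, hF, hFE⟩ : ∃ F, IsComponent G S F ∧ F ≠ E := by
    by_cases hCE : C = E
    · exact ⟨D, hD, fun h => hCD (hCE.trans h.symm)⟩
    · exact ⟨C, hC, hCE⟩
  obtain ⟨f, hf⟩ := hF.conn.1
  have hle := h E hE.conn ⟨f, hF.disjoint hE hFE f hf,
    fun h => hF.disj f hf (hE.outerBoundary_subset h)⟩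
  rw [← Set.eq_of_subset_of_ncard_le hE.outerBoundary_subset hle] at hs
  exact hs.2

variable [Finite V]

lemma FullSeparator.metricIsCutOn_of_clique (ih : SmallerGraphsOk.{u} (Nat.card V))
    (hK : ¬ HasK5Minor G) (hG : InducedCyclesLe4 G) {S : Set V} (hS : FullSeparator G S)
    (hcard : S = ∅ ∨ ∃ a b c, S = {a, b, c}) (s₀ : V)
    (hcl : ∀ s ∈ S, ∀ t ∈ S, s ≠ t → s ≠ s₀ → t ≠ s₀ → G.Adj s t) :
    MetricIsCutOn G Set.univ := by
  refine metricIsCutOn_of_separator ih hK hG hcard fun C hC => ?_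
  obtain ⟨B, hB, hBC⟩ := hS.exists_ne C
  exact ⟨rootedOff_of_clique hC hB hBC (hS.linked B hB) hcl, B, hB, hBC, hS.linked B hB⟩

lemma FullSeparator.metricIsCutOn_of_three (ih : SmallerGraphsOk.{u} (Nat.card V))
    (hK : ¬ HasK5Minor G) (hG : InducedCyclesLe4 G) {u x w : V} (hux : u ≠ x) (huw : u ≠ w)
    (hxw : x ≠ w) (hS : FullSeparator G {u, x, w}) {A B D : Set V}
    (hA : IsComponent G {u, x, w} A) (hB : IsComponent G {u, x, w} B)
    (hD : IsComponent G {u, x, w} D) (hAB : A ≠ B) (hAD : A ≠ D) (hBD : B ≠ D) :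
    MetricIsCutOn G Set.univ := by
  refine metricIsCutOn_of_separator ih hK hG (Or.inr ⟨u, x, w, rfl⟩) fun C hC => ?_
  obtain ⟨B₁, B₂, h1, h2, h12, h1C, h2C⟩ : ∃ B₁ B₂, IsComponent G {u, x, w} B₁ ∧
      IsComponent G {u, x, w} B₂ ∧ B₁ ≠ B₂ ∧ B₁ ≠ C ∧ B₂ ≠ C := by
    by_cases hAC : A = C
    · exact ⟨B, D, hB, hD, hBD, fun h => hAB (hAC.trans h.symm), fun h => hAD (hAC.trans h.symm)⟩
    · by_cases hBC : B = C
      · exact ⟨A, D, hA, hD, hAD, hAC, fun h => hBD (hBC.trans h.symm)⟩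
      · exact ⟨A, B, hA, hB, hAB, hAC, hBC⟩
  refine ⟨rootedOff_of_two hux huw hxw (fun s hs => ⟨fun h => hC.disj s h hs,
    fun h => h1.disj s h hs, fun h => h2.disj s h hs⟩) h1.conn h2.conn (h1.disjoint h2 h12)
    (h1.disjoint hC h1C) (h2.disjoint hC h2C) ?_ ?_ ?_ ?_ ?_, B₁, h1, h1C, hS.linked _ h1⟩
  · exact hS.linked _ h1 u (by simp)
  · exact hS.linked _ h1 x (by simp)
  · exact hS.linked _ h2 u (by simp)
  · exact hS.linked _ h2 x (by simp)
  · exact hS.linked _ h2 w (by simp)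

/-- A separator of size three admits no reduction as soon as it is independent and has exactly two
components. -/
lemma independent_of_not_metricIsCutOn (ih : SmallerGraphsOk.{u} (Nat.card V))
    (hK : ¬ HasK5Minor G) (hG : InducedCyclesLe4 G) (hκ : BoundaryAtLeast G 3)
    (hno : ¬ MetricIsCutOn G Set.univ) {u x w : V} (hux : u ≠ x) (huw : u ≠ w) (hxw : x ≠ w)
    {A B : Set V} (hA : IsComponent G {u, x, w} A) (hB : IsComponent G {u, x, w} B)
    (hAB : A ≠ B) : FullSeparator G {u, x, w} ∧ (¬ G.Adj u x ∧ ¬ G.Adj u w ∧ ¬ G.Adj x w) ∧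
      ∀ D, IsComponent G {u, x, w} D → D = A ∨ D = B := by
  have hcard : ({u, x, w} : Set V).ncard = 3 := Set.ncard_eq_three.2 ⟨u, x, w, hux, huw, hxw, rfl⟩
  have hS : FullSeparator G {u, x, w} := (hcard ▸ hκ : BoundaryAtLeast G _).fullSeparator hA hB hAB
  refine ⟨hS, ⟨fun h => hno ?_, fun h => hno ?_, fun h => hno ?_⟩, fun D hD => ?_⟩
  · refine hS.metricIsCutOn_of_clique ih hK hG (Or.inr ⟨_, _, _, rfl⟩) w ?_
    rintro s (rfl | rfl | rfl) t (rfl | rfl | rfl) h1 h2 h3 <;>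
      first | exact h | exact h.symm | exact absurd rfl ‹_›
  · refine hS.metricIsCutOn_of_clique ih hK hG (Or.inr ⟨_, _, _, rfl⟩) x ?_
    rintro s (rfl | rfl | rfl) t (rfl | rfl | rfl) h1 h2 h3 <;>
      first | exact h | exact h.symm | exact absurd rfl ‹_›
  · refine hS.metricIsCutOn_of_clique ih hK hG (Or.inr ⟨_, _, _, rfl⟩) u ?_
    rintro s (rfl | rfl | rfl) t (rfl | rfl | rfl) h1 h2 h3 <;>
      first | exact h | exact h.symm | exact absurd rfl ‹_›
  · by_contra! hne
    exact hno (hS.metricIsCutOn_of_three ih hK hG hux huw hxw hA hB hD hAB hne.1.symm hne.2.symm)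

end SmallSeparators

section ThreeSeparators

universe u

variable {V : Type u} {G : SimpleGraph V} [Finite V]

lemma two_of_three_mem {N : Set V} {b u x w : V} (hN : N ⊆ {b, u, x, w}) (h3 : 3 ≤ N.ncard) :
    (u ∈ N ∧ x ∈ N) ∨ (u ∈ N ∧ w ∈ N) ∨ (x ∈ N ∧ w ∈ N) := by
  have hpair : ∀ s, ¬ N ⊆ {b, s} := fun s h => by
    have h1 := Set.ncard_le_ncard h (Set.toFinite _)
    have h2 := (Set.ncard_insert_le b {s})
    rw [Set.ncard_singleton] at h2
    omega
  by_contra! hcon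
  obtain ⟨h1, h2, h3⟩ := hcon
  have hmem : ∀ a ∈ N, a = b ∨ a = u ∨ a = x ∨ a = w := fun a ha => hN ha
  by_cases hu : u ∈ N
  · refine hpair u fun a ha => ?_
    rcases hmem a ha with rfl | rfl | rfl | rfl
    exacts [by simp, by simp, absurd ha (h1 hu), absurd ha (h2 hu)]
  · by_cases hx : x ∈ N
    · refine hpair x fun a ha => ?_
      rcases hmem a ha with rfl | rfl | rfl | rfl
      exacts [by simp, absurd ha hu, by simp, absurd ha (h3 hx)]
    · refine hpair w fun a ha => ?_
      rcases hmem a ha with rfl | rfl | rfl | rfl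
      exacts [by simp, absurd ha hu, absurd ha hx, by simp]

lemma rootedOff_of_ne_singleton (hκ : BoundaryAtLeast G 3) {u x w b : V} (hux : u ≠ x)
    (huw : u ≠ w) (hxw : x ≠ w) {A B : Set V} (hA : IsComponent G {u, x, w} A)
    (hB : IsComponent G {u, x, w} B) (hAB : A ≠ B) (hb : b ∈ B) (hbu : G.Adj b u)
    (hbx : G.Adj b x) (hbw : G.Adj b w) (hne : B ≠ {b}) : RootedOff G {u, x, w} A := by
  obtain ⟨d, hd, hdb⟩ : ∃ d ∈ B, d ≠ b := by
    by_contra! h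
    exact hne (Set.Subset.antisymm h (Set.singleton_subset_iff.2 hb))
  obtain ⟨p, hp⟩ := hA.conn.1
  have hBS := hB.disj
  have hdS := hB.disj d hd
  obtain ⟨D, hD, hdD⟩ := exists_isComponent G (S := insert b {u, x, w}) (v := d) (by
    rintro (h | h)
    exacts [hdb h, hdS h])
  have hDB : D ⊆ B := by
    intro y hy
    by_contra hyB
    obtain ⟨c, -, hc, e, he, heB, hce⟩ := hD.conn.exists_crossing hdD hd hy hyB
    exact heB (hB.closed c hc e (fun h => hD.disj e he (Or.inr h)) hce)
  have hN := hD.outerBoundary_subset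
  have h3 := hκ D hD.conn ⟨p, fun h => hA.disjoint hB hAB p hp (hDB h), fun h => by
    rcases hN h with rfl | h
    exacts [hA.disjoint hB hAB _ hp hb, hA.disj p hp h]⟩
  have hrooted : ∀ s t r, ({s, t, r} : Set V) = {u, x, w} → s ≠ t → s ≠ r → t ≠ r →
      G.Adj b s → G.Adj b t → G.Adj b r → s ∈ outerBoundary G D → t ∈ outerBoundary G D →
      RootedOff G {u, x, w} A := by
    intro s t r hS hst hsr htr bs bt br sD tD
    rw [← hS] at hA hB ⊢
    refine rootedOff_of_two (B₁ := D) (B₂ := {b}) hst hsr htr (fun a ha => ⟨fun h => hA.disj a h ha,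
      fun h => hB.disj a (hDB h) ha, ?_⟩) hD.conn (connectedOn_singleton b) ?_
      (fun a ha h => hA.disjoint hB hAB a h (hDB ha)) ?_ sD.2 tD.2 ⟨s, rfl, b, rfl, bs.symm⟩
      ⟨t, rfl, b, rfl, bt.symm⟩ ⟨r, rfl, b, rfl, br.symm⟩
    · rintro rfl
      exact hB.disj _ hb ha
    · rintro a ha rfl
      exact hD.disj _ ha (Or.inl rfl)
    · rintro a rfl h
      exact hA.disjoint hB hAB _ h hb
  rcases two_of_three_mem hN h3 with h | h | h
  · exact hrooted u x w rfl hux huw hxw hbu hbx hbw h.1 h.2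
  · exact hrooted u w x (by ext; simp; tauto) huw hux hxw.symm hbu hbw hbx h.1 h.2
  · exact hrooted x w u (by ext; simp; tauto) hxw hux.symm huw.symm hbx hbw hbu h.1 h.2

set_option maxHeartbeats 1000000 in
lemma false_of_isComponent_singleton (ih : SmallerGraphsOk.{u} (Nat.card V))
    (hK : ¬ HasK5Minor G) (hG : InducedCyclesLe4 G) (hκ : BoundaryAtLeast G 3)
    (hno : ¬ MetricIsCutOn G Set.univ) {u x w b p : V} (hux : u ≠ x) (huw : u ≠ w) (hxw : x ≠ w)
    {A : Set V} (hA : IsComponent G {u, x, w} A) (hB : IsComponent G {u, x, w} {b})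
    (hAB : A ≠ {b}) (hp : p ∈ A) (hpS : ∀ s ∈ ({u, x, w} : Set V), G.Adj p s) : False := by
  obtain ⟨hfull, ⟨nux, nuw, nxw⟩, hcomp⟩ :=
    independent_of_not_metricIsCutOn ih hK hG hκ hno hux huw hxw hA hB hAB
  have hindep : ∀ s ∈ ({u, x, w} : Set V), ∀ t ∈ ({u, x, w} : Set V), ¬ G.Adj s t := by
    rintro s (rfl | rfl | rfl) t (rfl | rfl | rfl) h <;>
      first | exact h.ne rfl | exact nux h | exact nux h.symm | exact nuw h | exact nuw h.symm |
        exact nxw h | exact nxw h.symm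
  have hbS : ∀ s ∈ ({u, x, w} : Set V), G.Adj b s := fun s hs => by
    obtain ⟨_, rfl, _, rfl, h⟩ := hfull.linked _ hB s hs
    exact h.symm
  have hu : u ∈ ({u, x, w} : Set V) := by simp
  have hx : x ∈ ({u, x, w} : Set V) := by simp
  have hw : w ∈ ({u, x, w} : Set V) := by simp
  have hbA : b ∉ A := fun h => hA.disjoint hB hAB b h rfl
  have hbnotS : b ∉ ({u, x, w} : Set V) := hB.disj b rfl
  have hcover : ∀ y, y ∉ ({u, x, w} : Set V) → y ≠ b → y ∈ A := by
    intro y hy hyb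
    obtain ⟨E, hE, hyE⟩ := exists_isComponent G hy
    rcases hcomp E hE with rfl | rfl
    exacts [hyE, absurd hyE hyb]
  generalize hSdef : ({u, x, w} : Set V) = S at *
  have hbA' : ∀ a ∈ A, ¬ G.Adj a b := fun a ha => hA.not_adj hB hAB a ha b rfl
  obtain ⟨d, hdA, hdp⟩ : ∃ d ∈ A, d ≠ p := by
    by_contra! h
    have hsub : outerBoundary G {u} ⊆ {b, p} := by
      rintro y ⟨hyu, y', hy', u', hu', hyu'⟩
      rw [Set.mem_singleton_iff.1 hy', Set.mem_singleton_iff.1 hu'] at hyu'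
      by_cases hyb : y = b
      · exact Or.inl hyb
      · exact Or.inr (h y (hcover y (fun hy => hindep y hy _ hu hyu') hyb))
    have h3 := hκ {u} (connectedOn_singleton u) ⟨x, hux.symm, by
      rintro ⟨-, x', hx', u', hu', h⟩
      rw [Set.mem_singleton_iff.1 hx', Set.mem_singleton_iff.1 hu'] at h
      exact nux h.symm⟩
    have h1 := Set.ncard_le_ncard hsub (Set.toFinite _)
    have h2 := Set.ncard_insert_le b {p}
    rw [Set.ncard_singleton] at h2
    omega
  have hbp : b ≠ p := fun h => hbA (h ▸ hp)
  have hD : ∀ D, IsComponent G (insert p S) D → b ∉ D →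
      D ⊆ A ∧ (∀ s ∈ S, Linked G {s} D) ∧ Linked G {p} D := by
    intro D hD hbD
    have hDA : D ⊆ A := fun y hy => hcover y (fun h => hD.disj y hy (Or.inr h))
      (fun h => hbD (h ▸ hy))
    obtain ⟨d', hd'⟩ := hD.conn.1
    have hpD : Linked G {p} D := by
      obtain ⟨c, -, hcD, e, heA, heD, hce⟩ := hA.conn.exists_crossing (hDA hd') hd' hp
        (fun h => hD.disj p h (Or.inl rfl))
      refine ⟨p, rfl, c, hcD, ?_⟩
      by_cases hep : e = p
      · exact hep ▸ hce.symm
      · refine absurd (hD.closed c hcD e ?_ hce) heD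
        rintro (h | h)
        exacts [hep h, hA.disj e heA h]
    have hN := hD.outerBoundary_subset
    have hbN : b ∉ outerBoundary G D := fun h => (hN h).elim hbp hbnotS
    have h3 := hκ D hD.conn ⟨b, hbD, hbN⟩
    have hbad : ∀ t ∈ S, ∀ t' ∈ S, t ≠ t' → ¬ outerBoundary G D ⊆ {p, t, t'} := by
      intro t ht t' ht' htt hsub
      have hpt : p ≠ t := fun h => hA.disj p hp (h ▸ ht)
      have hpt' : p ≠ t' := fun h => hA.disj p hp (h ▸ ht')
      have heq := Set.eq_of_subset_of_ncard_le hsub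
        ((Set.ncard_eq_three.2 ⟨p, t, t', hpt, hpt', htt, rfl⟩).le.trans h3)
      have hDc := isComponent_outerBoundary hD.conn
      obtain ⟨E, hE, hbE⟩ := exists_isComponent G hbN
      rw [heq] at hE hDc
      exact (independent_of_not_metricIsCutOn ih hK hG hκ hno hpt hpt' htt hDc hE
        fun h => hbD (h ▸ hbE)).2.1.1 (hpS t ht)
    refine ⟨hDA, fun s hs => ?_, hpD⟩
    by_contra hsD
    have hsub : ∀ y ∈ outerBoundary G D, y = p ∨ y ∈ S ∧ y ≠ s := by
      intro y hy
      rcases hN hy with h | h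
      exacts [Or.inl h, Or.inr ⟨h, fun h' => hsD (h' ▸ hy.2)⟩]
    rw [← hSdef] at hs
    rcases hs with rfl | rfl | rfl
    · refine hbad x hx w hw hxw fun y hy => ?_
      rcases hsub y hy with h | ⟨h, h'⟩
      · exact Or.inl h
      · rw [← hSdef] at h
        rcases h with h | h | h
        exacts [absurd h h', Or.inr (Or.inl h), Or.inr (Or.inr h)]
    · refine hbad u hu w hw huw fun y hy => ?_
      rcases hsub y hy with h | ⟨h, h'⟩
      · exact Or.inl h
      · rw [← hSdef] at h
        rcases h with h | h | h
        exacts [Or.inr (Or.inl h), absurd h h', Or.inr (Or.inr h)]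
    · refine hbad u hu x hx hux fun y hy => ?_
      rcases hsub y hy with h | ⟨h, h'⟩
      · exact Or.inl h
      · rw [← hSdef] at h
        rcases h with h | h | h
        exacts [Or.inr (Or.inl h), Or.inr (Or.inr h), absurd h h']
  have hbcomp : ∀ T, S ⊆ T → b ∉ T → IsComponent G T {b} := fun T hST hbT =>
    ⟨connectedOn_singleton b, fun a ha h => hbT (ha ▸ h), fun a ha c hc hac =>
      hB.closed a ha c (fun h => hc (hST h)) hac⟩
  have hbD : ∀ {T D a}, S ⊆ T → b ∉ T → IsComponent G T D → a ∈ D → a ∈ A → b ∉ D := by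
    intro T D a hST hbT hDc haD haA hbD
    rw [hDc.eq_of_mem (hbcomp T hST hbT) hbD rfl] at haD
    exact hbA (haD ▸ haA)
  have hbpS : b ∉ insert p S := by rintro (h | h); exacts [hbp h, hbnotS h]
  have hpnotS : p ∉ S := hA.disj p hp
  obtain ⟨D, hDc, hdD⟩ := exists_isComponent G (S := insert p S) (v := d) (by
    rintro (h | h); exacts [hdp h, hA.disj d hdA h])
  have hbD1 := hbD (Set.subset_insert _ _) hbpS hDc hdD hdA
  obtain ⟨hDA, hDS, hDp⟩ := hD D hDc hbD1
  obtain ⟨q, hqD, hqu, hqx, hqw⟩ := hG.exists_common_neighbor_three hDc.conn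
    (connectedOn_singleton b) (fun a ha h => hbD1 (h ▸ ha))
    (fun a ha b' hb' => by rw [Set.mem_singleton_iff.1 hb']; exact hbA' a (hDA ha)) hux huw hxw
    nux nuw nxw (fun t ht => by
      rw [hSdef] at ht
      exact ⟨fun h => hDc.disj t h (Or.inr ht), fun h => hbnotS (h ▸ ht), hDS t ht,
        t, rfl, b, rfl, (hbS t ht).symm⟩)
  have hqS : ∀ s ∈ S, G.Adj q s := by
    rw [← hSdef]
    rintro s (rfl | rfl | rfl)
    exacts [hqu.symm, hqx.symm, hqw.symm]
  have hpD : p ∉ D := fun h => hDc.disj p h (Or.inl rfl)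
  have hnotD : ∀ s ∈ S, s ∉ D := fun s hs h => hDc.disj s h (Or.inr hs)
  have hSne : ∀ s ∈ S, s ≠ p ∧ s ≠ b ∧ s ≠ q := fun s hs =>
    ⟨fun h => hpnotS (h ▸ hs), fun h => hbnotS (h ▸ hs), fun h => hnotD s hs (h ▸ hqD)⟩
  have hcoverA : ∀ a ∈ A, a = p ∨ a ∈ D := by
    by_contra! h
    obtain ⟨a, haA, hap, haD⟩ := h
    obtain ⟨D', hD'c, haD'⟩ := exists_isComponent G (S := insert p S) (v := a) (by
      rintro (h | h); exacts [hap h, hA.disj a haA h])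
    have hbD' := hbD (Set.subset_insert _ _) hbpS hD'c haD' haA
    obtain ⟨hD'A, hD'S, hD'p⟩ := hD D' hD'c hbD'
    have hdd := hDc.disjoint hD'c fun h => haD (h ▸ haD')
    have hpD' : p ∉ D' := fun h => hD'c.disj p h (Or.inl rfl)
    have hnotD' : ∀ s ∈ S, s ∉ D' := fun s hs h => hD'c.disj s h (Or.inr hs)
    refine hK (hasK5Minor_of (A := {p}) (B := D) (C := {u, b}) (D := insert x D') (E := {w})
      (connectedOn_singleton p) hDc.conn (connectedOn_pair (hbS u hu).symm)
      (hD'c.conn.insert_of_linked (hD'S x hx)) (connectedOn_singleton w)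
      ?_ ?_ ?_ ?_ ?_ ?_ ?_ ?_ ?_ ?_ hDp ⟨p, rfl, u, by simp, hpS u hu⟩
      ⟨p, rfl, x, by simp, hpS x hx⟩ ⟨p, rfl, w, rfl, hpS w hw⟩
      ((hDS u hu).symm.mono subset_rfl (by simp)) ((hDS x hx).symm.mono subset_rfl (by simp))
      (hDS w hw).symm ⟨b, by simp, x, by simp, hbS x hx⟩ ⟨b, by simp, w, rfl, hbS w hw⟩
      ((hD'S w hw).symm.mono (Set.subset_insert _ _) subset_rfl))
    all_goals
      simp only [Set.mem_insert_iff, Set.mem_singleton_iff]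
      grind
  have hS2 : S ⊆ insert q (insert p S) := (Set.subset_insert _ _).trans (Set.subset_insert _ _)
  have hbq : b ≠ q := fun h => hbD1 (h ▸ hqD)
  have hpq : p ≠ q := fun h => hpD (h ▸ hqD)
  have hbS2 : b ∉ insert q (insert p S) := by
    rintro (h | h); exacts [hbq h, hbpS h]
  have hkey : ∀ s t r, ({s, t, r} : Set V) = S → s ≠ t → s ≠ r → t ≠ r →
      ∀ Z, IsComponent G (insert q (insert p S)) Z → b ∉ Z → Linked G {s} Z → Linked G {t} Z →
      False := by
    intro s t r hstr hst hsr htr Z hZ hbZ hsZ htZ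
    have hs : s ∈ S := hstr ▸ (by simp)
    have ht : t ∈ S := hstr ▸ (by simp)
    have hr : r ∈ S := hstr ▸ (by simp)
    have hqZ : q ∉ Z := fun h => hZ.disj q h (Or.inl rfl)
    have hpZ : p ∉ Z := fun h => hZ.disj p h (Or.inr (Or.inl rfl))
    have hnotZ : ∀ s ∈ S, s ∉ Z := fun s hs h => hZ.disj s h (hS2 hs)
    have hZD : Z ⊆ D := fun y hy => (hcoverA y (hcover y (fun h => hnotZ y h hy)
      fun h => hbZ (h ▸ hy))).resolve_left fun h => hpZ (h ▸ hy)
    have hout : ∀ c ∈ Z, ∀ e ∈ D, e ∉ Z → G.Adj c e → e = q := by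
      intro c hc e he heZ hce
      by_contra heq
      refine heZ (hZ.closed c hc e ?_ hce)
      rintro (h | h | h)
      exacts [heq h, hpD (h ▸ he), hnotD e h he]
    have hZq : Linked G {q} Z := by
      obtain ⟨z, hz⟩ := hZ.conn.1
      obtain ⟨c, -, hc, e, he, heZ, hce⟩ := hDc.conn.exists_crossing (hZD hz) hz hqD hqZ
      exact ⟨q, rfl, c, hc, hout c hc e he heZ hce ▸ hce.symm⟩
    have hQ : ConnectedOn G (D \ Z) := by
      refine connectedOn_of_crossing (v := q) ⟨hqD, hqZ⟩ fun X hX hqX hne => ?_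
      obtain ⟨y, hy, hyX⟩ := Set.exists_of_ssubset (hX.ssubset_of_ne hne)
      obtain ⟨c, -, hc, e, he, heX, hce⟩ := hDc.conn.exists_crossing (Y := X ∪ Z) hqD (Or.inl hqX)
        hy.1 (by rintro (h | h); exacts [hyX h, hy.2 h])
      rcases hc with hc | hc
      · exact ⟨c, hc, e, ⟨he, fun h => heX (Or.inr h)⟩, fun h => heX (Or.inl h), hce⟩
      · exact absurd (Or.inl (hout c hc e he (fun h => heX (Or.inr h)) hce ▸ hqX)) heX
    have hqQ : q ∈ D \ Z := ⟨hqD, hqZ⟩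
    obtain ⟨p', hp', y, hyD, hpy⟩ := hDp
    rw [Set.mem_singleton_iff.1 hp'] at hpy
    by_cases hyZ : y ∈ Z
    · refine hK (hasK5Minor_of (A := {b, s}) (B := {t}) (C := {r, p}) (D := D \ Z) (E := Z)
        (connectedOn_pair (hbS s hs)) (connectedOn_singleton t) (connectedOn_pair (hpS r hr).symm)
        hQ hZ.conn ?_ ?_ ?_ ?_ ?_ ?_ ?_ ?_ ?_ ?_ ⟨b, by simp, t, rfl, hbS t ht⟩
        ⟨b, by simp, r, by simp, hbS r hr⟩ ⟨s, by simp, q, hqQ, (hqS s hs).symm⟩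
        (hsZ.mono (by simp) subset_rfl) ⟨t, rfl, p, by simp, (hpS t ht).symm⟩
        ⟨t, rfl, q, hqQ, (hqS t ht).symm⟩ htZ ⟨r, by simp, q, hqQ, (hqS r hr).symm⟩
        ⟨p, by simp, y, hyZ, hpy⟩ (hZq.mono (by simpa using hqQ) subset_rfl))
      all_goals
        simp only [Set.mem_insert_iff, Set.mem_singleton_iff, Set.mem_sdiff]
        grind
    · refine hK (hasK5Minor_of (A := {p}) (B := D \ Z) (C := insert s Z) (D := {t}) (E := {r, b})
        (connectedOn_singleton p) hQ (hZ.conn.insert_of_linked hsZ) (connectedOn_singleton t)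
        (connectedOn_pair (hbS r hr).symm) ?_ ?_ ?_ ?_ ?_ ?_ ?_ ?_ ?_ ?_
        ⟨p, rfl, y, ⟨hyD, hyZ⟩, hpy⟩ ⟨p, rfl, s, by simp, hpS s hs⟩ ⟨p, rfl, t, rfl, hpS t ht⟩
        ⟨p, rfl, r, by simp, hpS r hr⟩ ⟨q, hqQ, s, by simp, hqS s hs⟩ ⟨q, hqQ, t, rfl, hqS t ht⟩
        ⟨q, hqQ, r, by simp, hqS r hr⟩ (htZ.symm.mono (Set.subset_insert _ _) subset_rfl)
        ⟨s, by simp, b, by simp, (hbS s hs).symm⟩ ⟨t, rfl, b, by simp, (hbS t ht).symm⟩)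
      all_goals
        simp only [Set.mem_insert_iff, Set.mem_singleton_iff, Set.mem_sdiff]
        grind
  have hkey' : ∀ s ∈ S, ∀ t ∈ S, s ≠ t → ∀ Z, IsComponent G (insert q (insert p S)) Z → b ∉ Z →
      Linked G {s} Z → Linked G {t} Z → False := by
    intro s hs t ht hst
    rw [← hSdef] at hs ht
    rcases hs with rfl | rfl | rfl <;> rcases ht with rfl | rfl | rfl
    · exact absurd rfl hst
    · exact hkey _ _ _ hSdef hux huw hxw
    · exact hkey s t x (by rw [← hSdef]; ext; simp; tauto) huw hux hxw.symm
    · exact hkey s t w (by rw [← hSdef]; ext; simp; tauto) hst hxw huw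
    · exact absurd rfl hst
    · exact hkey s t u (by rw [← hSdef]; ext; simp; tauto) hst hux.symm huw.symm
    · exact hkey s t x (by rw [← hSdef]; ext; simp; tauto) hst hxw.symm hux
    · exact hkey s t u (by rw [← hSdef]; ext; simp; tauto) hst huw.symm hux.symm
    · exact absurd rfl hst
  have hsep : ∀ s ∈ S, ∀ t ∈ S, s ≠ t → ∀ E, IsComponent G {b, p, q} E → s ∈ E → t ∉ E := by
    intro s hs t ht hst E hE hsE htE
    obtain ⟨c, hcE, hcY, e, heE, heY, hce⟩ := hE.conn.exists_crossing
      (Y := {y | y = s ∨ ∃ Z, IsComponent G (insert q (insert p S)) Z ∧ b ∉ Z ∧ y ∈ Z ∧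
        Linked G {s} Z}) hsE (Or.inl rfl) htE (by
      rintro (h | ⟨Z, hZ, -, htZ, -⟩)
      exacts [hst h.symm, hZ.disj t htZ (hS2 ht)])
    have he := hE.disj e heE
    simp only [Set.mem_insert_iff, Set.mem_singleton_iff, not_or] at he
    have heS2 : e ∉ S → e ∉ insert q (insert p S) := by
      rintro h (h' | h' | h')
      exacts [he.2.2 h', he.2.1 h', h h']
    rcases hcY with rfl | ⟨Z, hZ, hbZ, hcZ, hsZ⟩
    · have heS : e ∉ S := fun h => hindep c hs e h hce
      obtain ⟨Z, hZ, heZ⟩ := exists_isComponent G (heS2 heS)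
      exact heY (Or.inr ⟨Z, hZ, hbD hS2 hbS2 hZ heZ (hcover e heS he.1), heZ, c, rfl, e, heZ, hce⟩)
    · by_cases heS : e ∈ S
      · by_cases hes : e = s
        · exact heY (Or.inl hes)
        · exact hkey' s hs e heS (Ne.symm hes) Z hZ hbZ hsZ ⟨e, rfl, c, hcZ, hce.symm⟩
      · exact heY (Or.inr ⟨Z, hZ, hbZ, hZ.closed c hcZ e (heS2 heS) hce, hsZ⟩)
  have hcomp3 : ∀ s ∈ S, ∃ E, IsComponent G {b, p, q} E ∧ s ∈ E := fun s hs =>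
    exists_isComponent G (by
      obtain ⟨h1, h2, h3⟩ := hSne s hs
      rintro (h | h | h)
      exacts [h2 h, h1 h, h3 h])
  obtain ⟨E₁, hE₁, huE⟩ := hcomp3 u hu
  obtain ⟨E₂, hE₂, hxE⟩ := hcomp3 x hx
  obtain ⟨E₃, hE₃, hwE⟩ := hcomp3 w hw
  rcases (independent_of_not_metricIsCutOn ih hK hG hκ hno hbp hbq hpq hE₁ hE₂
    fun h => hsep u hu x hx hux E₁ hE₁ huE (h ▸ hxE)).2.2 E₃ hE₃ with rfl | rfl
  exacts [hsep u hu w hw huw _ hE₁ huE hwE, hsep x hx w hw hxw _ hE₂ hxE hwE]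

lemma metricIsCutOn_of_three_separator (ih : SmallerGraphsOk.{u} (Nat.card V))
    (hK : ¬ HasK5Minor G) (hG : InducedCyclesLe4 G) (hκ : BoundaryAtLeast G 3) {u x w : V}
    (hux : u ≠ x) (huw : u ≠ w) (hxw : x ≠ w) {A B : Set V} (hA : IsComponent G {u, x, w} A)
    (hB : IsComponent G {u, x, w} B) (hAB : A ≠ B) : MetricIsCutOn G Set.univ := by
  by_contra hno
  obtain ⟨hfull, ⟨nux, nuw, nxw⟩, hcomp⟩ :=
    independent_of_not_metricIsCutOn ih hK hG hκ hno hux huw hxw hA hB hAB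
  have hcn : ∀ C D, IsComponent G {u, x, w} C → IsComponent G {u, x, w} D → C ≠ D →
      ∃ c ∈ C, ∀ s ∈ ({u, x, w} : Set V), G.Adj c s := by
    intro C D hC hD hCD
    obtain ⟨c, hc, h1, h2, h3⟩ := hG.exists_common_neighbor_three hC.conn hD.conn
      (hC.disjoint hD hCD) (hC.not_adj hD hCD) hux huw hxw nux nuw nxw fun t ht =>
      ⟨fun h => hC.disj t h ht, fun h => hD.disj t h ht, hfull.linked C hC t ht,
        hfull.linked D hD t ht⟩
    refine ⟨c, hc, ?_⟩
    rintro s (rfl | rfl | rfl)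
    exacts [h1.symm, h2.symm, h3.symm]
  obtain ⟨p, hp, hpS⟩ := hcn A B hA hB hAB
  obtain ⟨b, hb, hbS⟩ := hcn B A hB hA hAB.symm
  by_cases hB1 : B = {b}
  · subst hB1
    exact false_of_isComponent_singleton ih hK hG hκ hno hux huw hxw hA hB hAB hp hpS
  by_cases hA1 : A = {p}
  · subst hA1
    exact false_of_isComponent_singleton ih hK hG hκ hno hux huw hxw hB hA hAB.symm hb hbS
  refine hno (metricIsCutOn_of_separator ih hK hG (Or.inr ⟨u, x, w, rfl⟩) fun C hC => ?_)
  rcases hcomp C hC with rfl | rfl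
  · exact ⟨rootedOff_of_ne_singleton hκ hux huw hxw hA hB hAB hb (hbS u (by simp))
      (hbS x (by simp)) (hbS w (by simp)) hB1, B, hB, hAB.symm, hfull.linked B hB⟩
  · exact ⟨rootedOff_of_ne_singleton hκ hux huw hxw hB hA hAB.symm hp (hpS u (by simp))
      (hpS x (by simp)) (hpS w (by simp)) hA1, A, hA, hAB, hfull.linked A hA⟩

end ThreeSeparators

section FourConnected

universe u

variable {V : Type u} {G : SimpleGraph V} [Finite V]

lemma exists_mem_ne_three {S : Set V} (h : 4 ≤ S.ncard) (a b c : V) :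
    ∃ s ∈ S, s ≠ a ∧ s ≠ b ∧ s ≠ c := by
  by_contra! hcon
  have hsub : S ⊆ {a, b, c} := fun s hs => by
    by_contra hs'
    simp only [Set.mem_insert_iff, Set.mem_singleton_iff, not_or] at hs'
    exact hs'.2.2 (hcon s hs hs'.1 hs'.2.1)
  have h1 := Set.ncard_le_ncard hsub (Set.toFinite _)
  have h2 := Set.ncard_insert_le a {b, c}
  have h3 := Set.ncard_insert_le b {c}
  rw [Set.ncard_singleton] at h3
  omega

lemma BoundaryAtLeast.exists_ne_three (hκ : BoundaryAtLeast G 4) {A : Set V}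
    (hA : ConnectedOn G A) {y a b c : V} (hyA : y ∉ A) (hya : y ≠ a) (hyb : y ≠ b)
    (hyc : y ≠ c) : ∃ z ∈ outerBoundary G A, z ≠ a ∧ z ≠ b ∧ z ≠ c := by
  by_cases hy : y ∈ outerBoundary G A
  · exact ⟨y, hy, hya, hyb, hyc⟩
  · exact exists_mem_ne_three (hκ A hA ⟨y, hyA, hy⟩) a b c

/-- A connected set `B` with outer boundary `S`, missed by `v`, such that every vertex
outside `B ∪ S` is adjacent to all of `S`. -/
structure MaximalCore (G : SimpleGraph V) (v : V) (B S : Set V) : Prop where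
  conn : ConnectedOn G B
  notMem : v ∉ B
  notMem' : v ∉ S
  disj : ∀ s ∈ S, s ∉ B
  linked : ∀ s ∈ S, Linked G {s} B
  not_adj : ∀ b ∈ B, ∀ a, a ∉ B → a ∉ S → ¬ G.Adj b a
  complete : ∀ a, a ∉ B → a ∉ S → ∀ s ∈ S, G.Adj a s
  four : 4 ≤ S.ncard

namespace MaximalCore

variable {v : V} {B S : Set V}

lemma triangle_free (h : MaximalCore G v B S) (hK : ¬ HasK5Minor G) {t₁ t₂ t₃ : V}
    (h1 : t₁ ∈ S) (h2 : t₂ ∈ S) (h3 : t₃ ∈ S) (h12 : G.Adj t₁ t₂) (h13 : G.Adj t₁ t₃)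
    (h23 : G.Adj t₂ t₃) : False := by
  obtain ⟨s, hs, hs1, hs2, hs3⟩ := exists_mem_ne_three h.four t₁ t₂ t₃
  have hv := h.complete v h.notMem h.notMem'
  refine hK (hasK5Minor_of (A := {v, s}) (B := {t₁}) (C := {t₂}) (D := {t₃}) (E := B)
    (connectedOn_pair (hv s hs)) (connectedOn_singleton _) (connectedOn_singleton _)
    (connectedOn_singleton _) h.conn ?_ ?_ ?_ ?_ ?_ ?_ ?_ ?_ ?_ ?_
    ⟨v, by simp, t₁, rfl, hv _ h1⟩ ⟨v, by simp, t₂, rfl, hv _ h2⟩ ⟨v, by simp, t₃, rfl, hv _ h3⟩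
    ((h.linked s hs).mono (by simp) subset_rfl) ⟨t₁, rfl, t₂, rfl, h12⟩ ⟨t₁, rfl, t₃, rfl, h13⟩
    (h.linked _ h1) ⟨t₂, rfl, t₃, rfl, h23⟩ (h.linked _ h2) (h.linked _ h3))
  all_goals
    have := h12.ne
    have := h13.ne
    have := h23.ne
    have := h.disj
    have := h.notMem
    have := h.notMem'
    simp only [Set.mem_insert_iff, Set.mem_singleton_iff]
    grind

lemma exists_adj_two (h : MaximalCore G v B S) (hG : InducedCyclesLe4 G) {s t : V} (hs : s ∈ S)
    (ht : t ∈ S) (hst : s ≠ t) (hst' : ¬ G.Adj s t) : ∃ b ∈ B, G.Adj s b ∧ G.Adj t b := by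
  have hv := h.complete v h.notMem h.notMem'
  refine hG.exists_common_neighbor h.conn (connectedOn_singleton v)
    (fun a ha h' => h.notMem (h' ▸ ha)) ?_ hst hst' (h.disj s hs) (h.disj t ht)
    (fun h' => h.notMem' (h' ▸ hs)) (fun h' => h.notMem' (h' ▸ ht)) (h.linked s hs)
    (h.linked t ht) ⟨s, rfl, v, rfl, (hv s hs).symm⟩ ⟨t, rfl, v, rfl, (hv t ht).symm⟩
  rintro a ha b rfl
  exact h.not_adj a ha _ h.notMem h.notMem'

lemma exists_matching (h : MaximalCore G v B S) (hK : ¬ HasK5Minor G)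
    (hind : ∀ s₁ ∈ S, ∀ s₂ ∈ S, ∀ s₃ ∈ S, s₁ ≠ s₂ → s₁ ≠ s₃ → s₂ ≠ s₃ →
      G.Adj s₁ s₂ ∨ G.Adj s₁ s₃ ∨ G.Adj s₂ s₃) :
    ∃ s₁ ∈ S, ∃ s₂ ∈ S, ∃ s₃ ∈ S, ∃ s₄ ∈ S, s₁ ≠ s₂ ∧ s₁ ≠ s₃ ∧ s₁ ≠ s₄ ∧ s₂ ≠ s₃ ∧ s₂ ≠ s₄ ∧
      s₃ ≠ s₄ ∧ G.Adj s₁ s₂ ∧ G.Adj s₃ s₄ ∧ ¬ G.Adj s₁ s₃ ∧ ¬ G.Adj s₂ s₄ := by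
  have htri := fun {t₁ t₂ t₃ : V} (h1 : t₁ ∈ S) (h2 : t₂ ∈ S) (h3 : t₃ ∈ S) =>
    h.triangle_free hK h1 h2 h3
  obtain ⟨a, ha⟩ : S.Nonempty := Set.nonempty_of_ncard_ne_zero (by have := h.four; omega)
  obtain ⟨b, hb, hba, -⟩ := exists_mem_ne_three h.four a a a
  obtain ⟨c, hc, hca, hcb, -⟩ := exists_mem_ne_three h.four a b b
  obtain ⟨d, hd, hda, hdb, hdc⟩ := exists_mem_ne_three h.four a b c
  have key : ∀ a ∈ S, ∀ b ∈ S, ∀ c ∈ S, ∀ d ∈ S, a ≠ b → a ≠ c → a ≠ d → b ≠ c → b ≠ d → c ≠ d →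
      G.Adj a b → G.Adj c d → ∃ s₁ ∈ S, ∃ s₂ ∈ S, ∃ s₃ ∈ S, ∃ s₄ ∈ S, s₁ ≠ s₂ ∧ s₁ ≠ s₃ ∧
      s₁ ≠ s₄ ∧ s₂ ≠ s₃ ∧ s₂ ≠ s₄ ∧
      s₃ ≠ s₄ ∧ G.Adj s₁ s₂ ∧ G.Adj s₃ s₄ ∧ ¬ G.Adj s₁ s₃ ∧ ¬ G.Adj s₂ s₄ := by
    intro a ha b hb c hc d hd hab hac had hbc hbd hcd eab ecd
    by_cases h1 : ¬ G.Adj a c ∧ ¬ G.Adj b d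
    · exact ⟨a, ha, b, hb, c, hc, d, hd, hab, hac, had, hbc, hbd, hcd, eab, ecd, h1⟩
    · refine ⟨a, ha, b, hb, d, hd, c, hc, hab, had, hac, hbd, hbc, hcd.symm, eab, ecd.symm,
        fun h2 => ?_, fun h2 => ?_⟩
      · by_cases h3 : G.Adj a c
        · exact htri ha hc hd h3 h2 ecd
        · exact htri ha hb hd eab h2 (not_not.1 fun h4 => h1 ⟨h3, h4⟩)
      · by_cases h3 : G.Adj a c
        · exact htri ha hb hc eab h3 h2
        · exact htri hb hc hd h2 (not_not.1 fun h4 => h1 ⟨h3, h4⟩) ecd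
  have i1 := hind a ha b hb c hc hba.symm hca.symm hcb.symm
  have i2 := hind a ha b hb d hd hba.symm hda.symm hdb.symm
  have i3 := hind a ha c hc d hd hca.symm hda.symm hdc.symm
  have i4 := hind b hb c hc d hd hcb.symm hdb.symm hdc.symm
  have j1 := htri ha hb hc
  have j2 := htri ha hb hd
  have j3 := htri ha hc hd
  have j4 := htri hb hc hd
  have hmatch : (G.Adj a b ∧ G.Adj c d) ∨ (G.Adj a c ∧ G.Adj b d) ∨ (G.Adj a d ∧ G.Adj b c) := by
    clear key htri
    grind
  rcases hmatch with ⟨e, f⟩ | ⟨e, f⟩ | ⟨e, f⟩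
  · exact key a ha b hb c hc d hd hba.symm hca.symm hda.symm hcb.symm hdb.symm hdc.symm e f
  · exact key a ha c hc b hb d hd hca.symm hba.symm hda.symm hcb hdc.symm hdb.symm e f
  · exact key a ha d hd b hb c hc hda.symm hba.symm hca.symm hdb hdc hcb.symm e f

lemma exists_adj_three (h : MaximalCore G v B S) (hK : ¬ HasK5Minor G) (hG : InducedCyclesLe4 G) :
    ∃ p ∈ B, ∃ t₁ ∈ S, ∃ t₂ ∈ S, ∃ t₃ ∈ S, t₁ ≠ t₂ ∧ t₁ ≠ t₃ ∧ t₂ ≠ t₃ ∧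
      G.Adj t₁ p ∧ G.Adj t₂ p ∧ G.Adj t₃ p := by
  have hv := h.complete v h.notMem h.notMem'
  by_cases hind : ∀ s₁ ∈ S, ∀ s₂ ∈ S, ∀ s₃ ∈ S, s₁ ≠ s₂ → s₁ ≠ s₃ → s₂ ≠ s₃ →
      G.Adj s₁ s₂ ∨ G.Adj s₁ s₃ ∨ G.Adj s₂ s₃
  · obtain ⟨s₁, h1, s₂, h2, s₃, h3, s₄, h4, n12, n13, n14, n23, n24, n34, e12, e34, m13, m24⟩ :=
      h.exists_matching hK hind
    by_contra! hcon
    have hle : ∀ b ∈ B, ∀ t₁ ∈ S, ∀ t₂ ∈ S, ∀ t₃ ∈ S, t₁ ≠ t₂ → t₁ ≠ t₃ → t₂ ≠ t₃ →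
      G.Adj t₁ b → G.Adj t₂ b → ¬ G.Adj t₃ b := hcon
    obtain ⟨b, hb, b1, b3⟩ := h.exists_adj_two hG h1 h3 n13 m13
    obtain ⟨c, hc, c2, c4⟩ := h.exists_adj_two hG h2 h4 n24 m24
    have hbc : b ≠ c := fun h' => hle b hb s₁ h1 s₃ h3 s₂ h2 n13 n12 n23.symm b1 b3 (h' ▸ c2)
    have d1 := h.disj s₁ h1
    have d2 := h.disj s₂ h2
    have d3 := h.disj s₃ h3
    have d4 := h.disj s₄ h4
    have dv := h.notMem
    have dv' := h.notMem'
    by_cases m14 : G.Adj s₁ s₄ <;> by_cases m23 : G.Adj s₂ s₃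
    · refine hK (hasK5Minor_of (A := {v}) (B := {s₁, b}) (C := {s₂, c}) (D := {s₃}) (E := {s₄})
        (connectedOn_singleton _) (connectedOn_pair b1) (connectedOn_pair c2)
        (connectedOn_singleton _) (connectedOn_singleton _) ?_ ?_ ?_ ?_ ?_ ?_ ?_ ?_ ?_ ?_
        ⟨v, rfl, s₁, by simp, hv _ h1⟩ ⟨v, rfl, s₂, by simp, hv _ h2⟩ ⟨v, rfl, s₃, rfl, hv _ h3⟩
        ⟨v, rfl, s₄, rfl, hv _ h4⟩ ⟨s₁, by simp, s₂, by simp, e12⟩ ⟨b, by simp, s₃, rfl, b3.symm⟩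
        ⟨s₁, by simp, s₄, rfl, m14⟩ ⟨s₂, by simp, s₃, rfl, m23⟩ ⟨c, by simp, s₄, rfl, c4.symm⟩
        ⟨s₃, rfl, s₄, rfl, e34⟩)
      all_goals
        simp only [Set.mem_insert_iff, Set.mem_singleton_iff]
        grind
    · obtain ⟨d, hd, d2, d3⟩ := h.exists_adj_two hG h2 h3 n23 m23
      refine hG.false_of_hole_five e12.symm m14 e34.symm d3 d2.symm m24 m23 m13 ?_ ?_
      · exact hle d hd s₂ h2 s₃ h3 s₁ h1 n23 n12.symm n13.symm d2 d3
      · exact hle d hd s₂ h2 s₃ h3 s₄ h4 n23 n24 n34 d2 d3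
    · obtain ⟨d, hd, d1, d4⟩ := h.exists_adj_two hG h1 h4 n14 m14
      refine hG.false_of_hole_five e12 m23 e34 d4 d1.symm m13 m14 m24 ?_ ?_
      · exact hle d hd s₁ h1 s₄ h4 s₂ h2 n14 n12 n24.symm d1 d4
      · exact hle d hd s₁ h1 s₄ h4 s₃ h3 n14 n13 n34.symm d1 d4
    · obtain ⟨b', hb', b'1, b'4⟩ := h.exists_adj_two hG h1 h4 n14 m14
      obtain ⟨c', hc', c'2, c'3⟩ := h.exists_adj_two hG h2 h3 n23 m23
      have g1 := hle b hb s₁ h1 s₃ h3 s₂ h2 n13 n12 n23.symm b1 b3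
      have g2 := hle b' hb' s₁ h1 s₄ h4 s₂ h2 n14 n12 n24.symm b'1 b'4
      refine hK (hasK5Minor_of (A := {v}) (B := {b', b, s₁}) (C := {c', c, s₂}) (D := {s₃})
        (E := {s₄}) (connectedOn_singleton _)
        (((connectedOn_singleton s₁).insert rfl b1.symm).insert (by simp) b'1.symm)
        (((connectedOn_singleton s₂).insert rfl c2.symm).insert (by simp) c'2.symm)
        (connectedOn_singleton _) (connectedOn_singleton _) ?_ ?_ ?_ ?_ ?_ ?_ ?_ ?_ ?_ ?_
        ⟨v, rfl, s₁, by simp, hv _ h1⟩ ⟨v, rfl, s₂, by simp, hv _ h2⟩ ⟨v, rfl, s₃, rfl, hv _ h3⟩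
        ⟨v, rfl, s₄, rfl, hv _ h4⟩ ⟨s₁, by simp, s₂, by simp, e12⟩ ⟨b, by simp, s₃, rfl, b3.symm⟩
        ⟨b', by simp, s₄, rfl, b'4.symm⟩ ⟨c', by simp, s₃, rfl, c'3.symm⟩
        ⟨c, by simp, s₄, rfl, c4.symm⟩ ⟨s₃, rfl, s₄, rfl, e34⟩)
      all_goals
        simp only [Set.mem_insert_iff, Set.mem_singleton_iff]
        grind
  · push Not at hind
    obtain ⟨s₁, h1, s₂, h2, s₃, h3, n12, n13, n23, m12, m13, m23⟩ := hind
    obtain ⟨q, hq, q1, q2, q3⟩ := hG.exists_common_neighbor_three h.conn (connectedOn_singleton v)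
      (fun a ha h' => h.notMem (h' ▸ ha)) (by
        rintro a ha b rfl
        exact h.not_adj a ha _ h.notMem h.notMem') n12 n13 n23 m12 m13 m23 (by
        intro t ht
        have htS : t ∈ S := by rcases ht with rfl | rfl | rfl <;> assumption
        exact ⟨h.disj t htS, fun h' => h.notMem' (h' ▸ htS), h.linked t htS,
          t, rfl, v, rfl, (hv t htS).symm⟩)
    exact ⟨q, hq, s₁, h1, s₂, h2, s₃, h3, n12, n13, n23, q1, q2, q3⟩

end MaximalCore

end FourConnected

section FourConnectedCore

universe u

variable {V : Type u} {G : SimpleGraph V} [Finite V]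

namespace MaximalCore

variable {v : V} {B S : Set V}

set_option maxHeartbeats 1000000 in
lemma adj_of_adj_three (h : MaximalCore G v B S) (hK : ¬ HasK5Minor G) (hG : InducedCyclesLe4 G)
    (hκ : BoundaryAtLeast G 4) {p : V} (hp : p ∈ B) {t₁ t₂ t₃ : V} (h1 : t₁ ∈ S) (h2 : t₂ ∈ S)
    (h3 : t₃ ∈ S) (h12 : t₁ ≠ t₂) (h13 : t₁ ≠ t₃) (h23 : t₂ ≠ t₃) (p1 : G.Adj t₁ p)
    (p2 : G.Adj t₂ p) (p3 : G.Adj t₃ p) : ∀ s ∈ S, G.Adj p s := by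
  intro s hs
  by_contra hps
  have hv := h.complete v h.notMem h.notMem'
  obtain ⟨k, f, f0, fk, hfX, hfa, hinj, hna⟩ :=
    (h.conn.insert_of_linked (h.linked s hs)).exists_induced_path (Set.mem_insert s B)
      (Set.mem_insert_of_mem s hp)
  have hfB : ∀ i, 0 < i → i ≤ k → f i ∈ B := fun i hi hik =>
    (hfX i hik).resolve_left fun h' => hinj 0 i hi hik (f0.trans h'.symm)
  have hk2 : 2 ≤ k := by
    have hsp : s ≠ p := fun h' => h.disj s hs (h' ▸ hp)
    rcases Nat.lt_or_ge k 2 with hk | hk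
    · interval_cases k
      · exact absurd (f0.symm.trans fk) hsp
      · have h' := hfa 0 one_pos
        rw [zero_add, f0, fk] at h'
        exact absurd h'.symm hps
    · exact hk
  set P : Set V := f '' Set.Icc 0 (k - 1) with hP
  have hPconn : ConnectedOn G P :=
    connectedOn_image_Icc (Nat.zero_le _) fun i _ hi => hfa i (by omega)
  have hsP : s ∈ P := ⟨0, ⟨le_rfl, Nat.zero_le _⟩, f0⟩
  have hf1P : f 1 ∈ P := ⟨1, ⟨Nat.zero_le _, by omega⟩, rfl⟩
  have hpP : p ∉ P := by
    rintro ⟨i, ⟨-, hi⟩, hip⟩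
    exact hinj i k (by omega) le_rfl (hip.trans fk.symm)
  have hPB : ∀ y ∈ P, y = s ∨ y ∈ B := by
    rintro _ ⟨i, ⟨-, hi⟩, rfl⟩
    exact hfX i (by omega)
  have hvs : v ≠ s := fun h' => h.notMem' (h' ▸ hs)
  have hvP : v ∉ P := fun h' => (hPB v h').elim hvs h.notMem
  have hvp : v ≠ p := fun h' => h.notMem (h' ▸ hp)
  -- vertices of `S` adjacent to `p` see the start of the path
  have hstart : ∀ t ∈ S, G.Adj t p → ¬ G.Adj t s → G.Adj t (f 1) := by
    intro t ht htp hts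
    have hst : s ≠ t := fun h' => hps (h' ▸ htp.symm)
    obtain ⟨a, ⟨i, ⟨hi1, hik⟩, rfl⟩, sa, ta⟩ := hG.exists_common_neighbor (u := s) (v := t)
      (A := f '' Set.Icc 1 k) (B := {v})
      (connectedOn_image_Icc (by omega) fun i _ hi => hfa i hi) (connectedOn_singleton v)
      (by
        rintro _ ⟨i, ⟨hi1, hik⟩, rfl⟩ h'
        exact h.notMem (h' ▸ hfB i hi1 hik))
      (by
        rintro _ ⟨i, ⟨hi1, hik⟩, rfl⟩ b rfl
        exact h.not_adj _ (hfB i hi1 hik) _ h.notMem h.notMem') hst (fun h' => hts h'.symm)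
      (by
        rintro ⟨i, ⟨hi1, hik⟩, h'⟩
        exact h.disj s hs (h' ▸ hfB i hi1 hik))
      (by
        rintro ⟨i, ⟨hi1, hik⟩, h'⟩
        exact h.disj t ht (h' ▸ hfB i hi1 hik))
      (fun h' => h.notMem' (h' ▸ hs)) (fun h' => h.notMem' (h' ▸ ht))
      ⟨s, rfl, f 1, ⟨1, ⟨le_rfl, by omega⟩, rfl⟩, f0 ▸ hfa 0 (by omega)⟩
      ⟨t, rfl, p, ⟨k, ⟨by omega, le_rfl⟩, fk⟩, htp⟩ ⟨s, rfl, v, rfl, (hv s hs).symm⟩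
      ⟨t, rfl, v, rfl, (hv t ht).symm⟩
    rcases hi1.lt_or_eq with hi | rfl
    · exact absurd sa (f0 ▸ hna 0 i (by omega) hik)
    · exact ta
  have hlP : ∀ t ∈ S, G.Adj t p → Linked G {t} P := by
    intro t ht htp
    by_cases hts : G.Adj t s
    · exact ⟨t, rfl, s, hsP, hts⟩
    · exact ⟨t, rfl, f 1, hf1P, hstart t ht htp hts⟩
  have hST : ∀ t ∈ S, G.Adj t p → t ∉ P ∧ t ≠ v ∧ t ≠ p := fun t ht htp =>
    ⟨fun h' => (hPB t h').elim (fun h' => hps (h' ▸ htp.symm)) (h.disj t ht),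
      fun h' => h.notMem' (h' ▸ ht), htp.ne⟩
  -- the branch at one of the three vertices does not reach the other two
  have hbranch : ∀ t ∈ S, ∀ t' ∈ S, ∀ t'' ∈ S, t ≠ t' → t ≠ t'' → t' ≠ t'' → G.Adj t p →
      G.Adj t' p → G.Adj t'' p → ∃ C, t ∈ C ∧ t' ∉ C ∧ t'' ∉ C ∧ IsComponent G ({v, p} ∪ P) C := by
    intro t ht t' ht' t'' ht'' n1 n2 n3 tp tp' tp''
    obtain ⟨dP, dv, dp⟩ := hST t ht tp
    obtain ⟨dP', dv', dp'⟩ := hST t' ht' tp'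
    obtain ⟨dP'', dv'', dp''⟩ := hST t'' ht'' tp''
    obtain ⟨C, hC, htC⟩ := exists_isComponent G (S := {t', t''} ∪ ({v, p} ∪ P)) (v := t) (by
      simp only [Set.mem_union, Set.mem_insert_iff, Set.mem_singleton_iff]
      tauto)
    have hCn : ∀ y ∈ C, y ≠ t' ∧ y ≠ t'' ∧ y ≠ v ∧ y ≠ p ∧ y ∉ P := by
      intro y hy
      have := hC.disj y hy
      simp only [Set.mem_union, Set.mem_insert_iff, Set.mem_singleton_iff] at this
      tauto
    have hno : ∀ x ∈ S, ∀ y ∈ S, x ≠ y → t ≠ x → t ≠ y → G.Adj x p → G.Adj y p → x ∉ C → y ∉ C →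
        ∀ c ∈ C, ¬ G.Adj c x := by
      intro x hx y hy hxy hxt hyt xp yp xC yC c hc hcx
      obtain ⟨eP, ev, ep⟩ := hST x hx xp
      obtain ⟨eP', ev', ep'⟩ := hST y hy yp
      refine hK (hasK5Minor_of (A := {v}) (B := P) (C := C) (D := {x}) (E := {y, p})
        (connectedOn_singleton _) hPconn hC.conn (connectedOn_singleton _) (connectedOn_pair yp)
        ?_ ?_ ?_ ?_ ?_ ?_ ?_ ?_ ?_ ?_ ⟨v, rfl, s, hsP, hv s hs⟩ ⟨v, rfl, t, htC, hv t ht⟩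
        ⟨v, rfl, x, rfl, hv x hx⟩ ⟨v, rfl, y, by simp, hv y hy⟩
        ((hlP t ht tp).symm.mono subset_rfl (by simpa using htC)) (hlP x hx xp).symm
        ((hlP y hy yp).symm.mono subset_rfl (by simp)) ⟨c, hc, x, rfl, hcx⟩
        ⟨t, htC, p, by simp, tp⟩ ⟨x, rfl, p, by simp, xp⟩)
      all_goals
        clear hfX hfa hinj hna hfB hstart hlP hST hPB hP
        try simp only [Set.mem_insert_iff, Set.mem_singleton_iff]
        grind
    have tC' : t' ∉ C := fun h' => (hCn _ h').1 rfl
    have tC'' : t'' ∉ C := fun h' => (hCn _ h').2.1 rfl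
    refine ⟨C, htC, tC', tC'', hC.conn, fun a ha h' => hC.disj a ha (Or.inr h'),
      fun a ha b hb hab => hC.closed a ha b ?_ hab⟩
    rintro ((rfl | rfl) | h')
    · exact hno _ ht' _ ht'' n3 n1 n2 tp' tp'' tC' tC'' a ha hab
    · exact hno _ ht'' _ ht' n3.symm n2 n1 tp'' tp' tC'' tC' a ha hab
    · exact hb h'
  obtain ⟨C₁, c11, c12, c13, hC₁⟩ := hbranch t₁ h1 t₂ h2 t₃ h3 h12 h13 h23 p1 p2 p3
  obtain ⟨C₂, c22, c21, c23, hC₂⟩ := hbranch t₂ h2 t₁ h1 t₃ h3 h12.symm h23 h13 p2 p1 p3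
  obtain ⟨C₃, c33, c31, c32, hC₃⟩ := hbranch t₃ h3 t₁ h1 t₂ h2 h13.symm h23.symm h12 p3 p1 p2
  have hreach : ∀ C, IsComponent G ({v, p} ∪ P) C → ∀ y ∈ S, G.Adj y p → y ∉ C → ∀ q ∈ P,
      ∃ z ∈ P, z ≠ q ∧ Linked G {z} C := by
    intro C hC y hy yp hyC q hq
    obtain ⟨yP, yv, yp'⟩ := hST y hy yp
    obtain ⟨z, hz, zv, zp, zq⟩ := hκ.exists_ne_three hC.conn hyC yv yp' (fun h' => yP (h' ▸ hq))
    rcases hC.outerBoundary_subset hz with (h' | h') | h'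
    exacts [absurd h' zv, absurd h' zp, ⟨z, h', zq, hz.2⟩]
  have hpath : ∀ a, a ≤ k - 1 → ConnectedOn G (f '' Set.Icc a (k - 1)) := fun a ha =>
    connectedOn_image_Icc ha fun i _ hi => hfa i (by omega)
  have hfk : G.Adj p (f (k - 1)) := by
    have := hfa (k - 1) (by omega)
    rw [show k - 1 + 1 = k by omega, fk] at this
    exact this.symm
  have hs1 : G.Adj s (f 1) := f0 ▸ hfa 0 (by omega)
  -- two branches seeing `s`
  have hnear : ∀ x ∈ S, ∀ y ∈ S, ∀ z ∈ S, G.Adj x p → G.Adj y p → G.Adj z p →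
      ∀ X Y Z, IsComponent G ({v, p} ∪ P) X → IsComponent G ({v, p} ∪ P) Y →
      IsComponent G ({v, p} ∪ P) Z → x ∈ X → y ∈ Y → z ∈ Z → X ≠ Y → X ≠ Z → Y ≠ Z →
      Linked G {s} X → Linked G {s} Y → False := by
    intro x hx y hy z hz xp yp zp X Y Z hX hY hZ hxX hyY hzZ hXY hXZ hYZ sX sY
    have hL : ∀ C, IsComponent G ({v, p} ∪ P) C → ∀ y ∈ S, G.Adj y p → y ∉ C →
        Linked G (f '' Set.Icc 1 (k - 1)) C := by
      intro C hC y hy yp hyC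
      obtain ⟨w, ⟨i, ⟨-, hi⟩, rfl⟩, hwq, hw⟩ := hreach C hC y hy yp hyC s hsP
      refine hw.mono (Set.singleton_subset_iff.2 ⟨i, ⟨?_, hi⟩, rfl⟩) subset_rfl
      rcases Nat.eq_zero_or_pos i with rfl | hi
      exacts [absurd f0 hwq, hi]
    have hLP : ∀ w ∈ f '' Set.Icc 1 (k - 1), w ∈ P := by
      rintro _ ⟨i, ⟨-, hi⟩, rfl⟩
      exact ⟨i, ⟨Nat.zero_le _, hi⟩, rfl⟩
    have hsL : s ∉ f '' Set.Icc 1 (k - 1) := by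
      rintro ⟨i, ⟨hi, hi'⟩, h'⟩
      exact hinj 0 i hi (by omega) (f0.trans h'.symm)
    have dXY := hX.disjoint hY hXY
    have dXZ := hX.disjoint hZ hXZ
    have dYZ := hY.disjoint hZ hYZ
    have lX := hL X hX y hy yp fun h' => dXY y h' hyY
    have lY := hL Y hY x hx xp fun h' => dXY x hxX h'
    have lZ := hL Z hZ x hx xp fun h' => dXZ x hxX h'
    have hLc := hpath 1 (by omega)
    have pL : Linked G {p} (f '' Set.Icc 1 (k - 1)) :=
      ⟨p, rfl, f (k - 1), ⟨k - 1, ⟨by omega, le_rfl⟩, rfl⟩, hfk⟩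
    generalize f '' Set.Icc 1 (k - 1) = L at *
    refine hK (hasK5Minor_of (A := {p}) (B := L) (C := insert s X)
      (D := insert v Z) (E := Y) (connectedOn_singleton p) hLc
      (hX.conn.insert_of_linked sX) (hZ.conn.insert hzZ (hv z hz)) hY.conn
      ?_ ?_ ?_ ?_ ?_ ?_ ?_ ?_ ?_ ?_ pL ⟨p, rfl, x, by simp [hxX], xp.symm⟩
      ⟨p, rfl, z, by simp [hzZ], zp.symm⟩ ⟨p, rfl, y, hyY, yp.symm⟩
      (lX.mono subset_rfl (Set.subset_insert _ _)) (lZ.mono subset_rfl (Set.subset_insert _ _))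
      lY ⟨s, by simp, v, by simp, (hv s hs).symm⟩ (sY.mono (by simp) subset_rfl)
      ⟨v, by simp, y, hyY, hv y hy⟩)
    all_goals
      have eX := hX.disj
      have eY := hY.disj
      have eZ := hZ.disj
      clear hfX hfa hinj hna hfB hstart hlP hST hPB hP hbranch hreach hpath hC₁ hC₂ hC₃ h12 h13 h23 p1 p2 p3 hv hκ hG h
      simp only [Set.mem_insert_iff, Set.mem_singleton_iff, Set.mem_union] at eX eY eZ ⊢
      grind
  -- two branches missing `s`
  have hfar : ∀ x ∈ S, ∀ y ∈ S, ∀ z ∈ S, G.Adj x p → G.Adj y p → G.Adj z p →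
      ∀ X Y Z, IsComponent G ({v, p} ∪ P) X → IsComponent G ({v, p} ∪ P) Y →
      IsComponent G ({v, p} ∪ P) Z → x ∈ X → y ∈ Y → z ∈ Z → X ≠ Y → X ≠ Z → Y ≠ Z →
      ¬ Linked G {s} X → ¬ Linked G {s} Y → False := by
    intro x hx y hy z hz xp yp zp X Y Z hX hY hZ hxX hyY hzZ hXY hXZ hYZ sX sY
    have dXY := hX.disjoint hY hXY
    have dXZ := hX.disjoint hZ hXZ
    have dYZ := hY.disjoint hZ hYZ
    have hL : ∀ C, IsComponent G ({v, p} ∪ P) C → ∀ y ∈ S, G.Adj y p → y ∉ C →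
        ¬ Linked G {s} C → ∃ i, 2 ≤ i ∧ i ≤ k - 1 ∧ Linked G {f i} C := by
      intro C hC y hy yp hyC hsC
      obtain ⟨w, ⟨i, ⟨-, hi⟩, rfl⟩, hwq, hw⟩ := hreach C hC y hy yp hyC (f 1) hf1P
      refine ⟨i, ?_, hi, hw⟩
      rcases Nat.lt_or_ge i 2 with h' | h'
      · interval_cases i
        exacts [absurd (f0 ▸ hw) hsC, absurd rfl hwq]
      · exact h'
    obtain ⟨i, hi2, hik, lX⟩ := hL X hX y hy yp (fun h' => dXY y h' hyY) sX
    obtain ⟨j, hj2, hjk, lY⟩ := hL Y hY x hx xp (fun h' => dXY x hxX h') sY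
    have x1 : G.Adj x (f 1) := hstart x hx xp fun h' => sX ⟨s, rfl, x, hxX, h'.symm⟩
    have y1 : G.Adj y (f 1) := hstart y hy yp fun h' => sY ⟨s, rfl, y, hyY, h'.symm⟩
    have lz : Linked G {s, f 1} {z} := by
      by_cases hzs : G.Adj z s
      · exact ⟨s, by simp, z, rfl, hzs.symm⟩
      · exact ⟨f 1, by simp, z, rfl, (hstart z hz zp hzs).symm⟩
    have hLP : ∀ w ∈ f '' Set.Icc 2 (k - 1), w ∈ P ∧ w ≠ s ∧ w ≠ f 1 := by
      rintro _ ⟨i, ⟨hi, hi'⟩, rfl⟩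
      exact ⟨⟨i, ⟨Nat.zero_le _, hi'⟩, rfl⟩,
        fun h' => hinj 0 i (by omega) (by omega) (f0.trans h'.symm),
        fun h' => hinj 1 i hi (by omega) h'.symm⟩
    have hLc := hpath 2 (hi2.trans hik)
    have lX' : Linked G (f '' Set.Icc 2 (k - 1)) X :=
      lX.mono (Set.singleton_subset_iff.2 ⟨i, ⟨hi2, hik⟩, rfl⟩) subset_rfl
    have lY' : Linked G (f '' Set.Icc 2 (k - 1)) Y :=
      lY.mono (Set.singleton_subset_iff.2 ⟨j, ⟨hj2, hjk⟩, rfl⟩) subset_rfl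
    generalize f '' Set.Icc 2 (k - 1) = L at *
    generalize f 1 = g at *
    refine hK (hasK5Minor_of (A := {v}) (B := {s, g}) (C := X ∪ L) (D := insert p Z) (E := Y)
      (connectedOn_singleton v) (connectedOn_pair hs1) (hX.conn.union hLc lX'.symm)
      (hZ.conn.insert hzZ zp.symm) hY.conn ?_ ?_ ?_ ?_ ?_ ?_ ?_ ?_ ?_ ?_
      ⟨v, rfl, s, by simp, hv s hs⟩ ⟨v, rfl, x, Or.inl hxX, hv x hx⟩
      ⟨v, rfl, z, by simp [hzZ], hv z hz⟩ ⟨v, rfl, y, hyY, hv y hy⟩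
      ⟨g, by simp, x, Or.inl hxX, x1.symm⟩ (lz.mono subset_rfl (by simp [hzZ]))
      ⟨g, by simp, y, hyY, y1.symm⟩ ⟨x, Or.inl hxX, p, by simp, xp⟩
      (lY'.mono (by simp) subset_rfl) ⟨p, by simp, y, hyY, yp.symm⟩)
    all_goals
      have eX := hX.disj
      have eY := hY.disj
      have eZ := hZ.disj
      clear hfX hfa hinj hna hfB hstart hlP hST hPB hP hbranch hreach hpath hL hnear hC₁ hC₂ hC₃ h12 h13 h23 p1 p2 p3 hv hκ hG h
      simp only [Set.mem_insert_iff, Set.mem_singleton_iff, Set.mem_union] at eX eY eZ ⊢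
      grind
  have n12 : C₁ ≠ C₂ := fun h' => c12 (h' ▸ c22)
  have n13 : C₁ ≠ C₃ := fun h' => c13 (h' ▸ c33)
  have n23 : C₂ ≠ C₃ := fun h' => c23 (h' ▸ c33)
  by_cases l1 : Linked G {s} C₁ <;> by_cases l2 : Linked G {s} C₂
  · exact hnear _ h1 _ h2 _ h3 p1 p2 p3 _ _ _ hC₁ hC₂ hC₃ c11 c22 c33 n12 n13 n23 l1 l2
  · by_cases l3 : Linked G {s} C₃
    · exact hnear _ h1 _ h3 _ h2 p1 p3 p2 _ _ _ hC₁ hC₃ hC₂ c11 c33 c22 n13 n12 n23.symm l1 l3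
    · exact hfar _ h2 _ h3 _ h1 p2 p3 p1 _ _ _ hC₂ hC₃ hC₁ c22 c33 c11 n23 n12.symm n13.symm l2 l3
  · by_cases l3 : Linked G {s} C₃
    · exact hnear _ h2 _ h3 _ h1 p2 p3 p1 _ _ _ hC₂ hC₃ hC₁ c22 c33 c11 n23 n12.symm n13.symm
        l2 l3
    · exact hfar _ h1 _ h3 _ h2 p1 p3 p2 _ _ _ hC₁ hC₃ hC₂ c11 c33 c22 n13 n12 n23.symm l1 l3
  · exact hfar _ h1 _ h2 _ h3 p1 p2 p3 _ _ _ hC₁ hC₂ hC₃ c11 c22 c33 n12 n13 n23 l1 l2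

end MaximalCore

lemma BoundaryAtLeast.false_of_complete_three (hκ : BoundaryAtLeast G 4) (hK : ¬ HasK5Minor G)
    {T : Set V} (hT : 4 ≤ T.ncard) {v p q : V} (hvp : v ≠ p) (hvq : v ≠ q) (hpq : p ≠ q)
    (hv : ∀ t ∈ T, G.Adj v t) (hp : ∀ t ∈ T, G.Adj p t) (hq : ∀ t ∈ T, G.Adj q t) : False := by
  obtain ⟨t, ht⟩ : T.Nonempty := Set.nonempty_of_ncard_ne_zero (by omega)
  obtain ⟨C, hC, htC⟩ := exists_isComponent G (S := {v, p, q} ∪ (T \ {t})) (v := t) (by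
    have := (hv t ht).ne
    have := (hp t ht).ne
    have := (hq t ht).ne
    simp only [Set.mem_union, Set.mem_insert_iff, Set.mem_singleton_iff, Set.mem_sdiff]
    tauto)
  have hCd := hC.disj
  simp only [Set.mem_union, Set.mem_insert_iff, Set.mem_singleton_iff, Set.mem_sdiff, not_or]
    at hCd
  obtain ⟨y, hy, hyt, -⟩ := exists_mem_ne_three hT t t t
  obtain ⟨t', ht', tv', tp', tq'⟩ := hκ.exists_ne_three hC.conn (y := y)
    (fun h => (hCd y h).2 ⟨hy, hyt⟩) (hv y hy).ne' (hp y hy).ne' (hq y hy).ne'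
  obtain ⟨ht'T, htt'⟩ : t' ∈ T ∧ t' ≠ t := by
    rcases hC.outerBoundary_subset ht' with (h | h | h) | h
    exacts [absurd h tv', absurd h tp', absurd h tq', h]
  obtain ⟨a, ha, hat, hat', -⟩ := exists_mem_ne_three hT t t' t
  obtain ⟨b, hb, hbt, hbt', hba⟩ := exists_mem_ne_three hT t t' a
  refine hK (hasK5Minor_of (A := {v, b}) (B := {p}) (C := C) (D := {t'}) (E := {a, q})
    (connectedOn_pair (hv b hb)) (connectedOn_singleton _) hC.conn (connectedOn_singleton _)
    (connectedOn_pair (hq a ha).symm) ?_ ?_ ?_ ?_ ?_ ?_ ?_ ?_ ?_ ?_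
    ⟨b, by simp, p, rfl, (hp b hb).symm⟩ ⟨v, by simp, t, htC, hv t ht⟩
    ⟨v, by simp, t', rfl, hv t' ht'T⟩ ⟨v, by simp, a, by simp, hv a ha⟩
    ⟨p, rfl, t, htC, hp t ht⟩ ⟨p, rfl, t', rfl, hp t' ht'T⟩ ⟨p, rfl, a, by simp, hp a ha⟩
    (ht'.2.symm) ⟨t, htC, q, by simp, (hq t ht).symm⟩ ⟨t', rfl, q, by simp, (hq t' ht'T).symm⟩)
  all_goals
    have e1 : ∀ t ∈ T, t ≠ v ∧ t ≠ p ∧ t ≠ q := fun t ht =>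
      ⟨(hv t ht).ne', (hp t ht).ne', (hq t ht).ne'⟩
    simp only [Set.mem_insert_iff, Set.mem_singleton_iff]
    grind

end FourConnectedCore

section FourConnectedMain

universe u

variable {V : Type u} {G : SimpleGraph V}

/-- A triangle minor missing a vertex of a set `S` extends to a `K₅` minor by means of two further
vertices complete to `S`. -/
lemma hasK5Minor_of_complete_two {S C D E : Set V} {v p s c d e : V} (hvp : v ≠ p)
    (hv : ∀ t ∈ S, G.Adj v t) (hp : ∀ t ∈ S, G.Adj p t) (hs : s ∈ S) (hC : ConnectedOn G C)
    (hD : ConnectedOn G D) (hE : ConnectedOn G E) (dCD : ∀ x ∈ C, x ∉ D) (dCE : ∀ x ∈ C, x ∉ E)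
    (dDE : ∀ x ∈ D, x ∉ E) (lCD : Linked G C D) (lCE : Linked G C E) (lDE : Linked G D E)
    (hCn : v ∉ C ∧ p ∉ C ∧ s ∉ C) (hDn : v ∉ D ∧ p ∉ D ∧ s ∉ D) (hEn : v ∉ E ∧ p ∉ E ∧ s ∉ E)
    (hc : c ∈ C ∧ c ∈ S) (hd : d ∈ D ∧ d ∈ S) (he : e ∈ E ∧ e ∈ S) : HasK5Minor G := by
  refine hasK5Minor_of (A := {v, s}) (B := {p}) (C := C) (D := D) (E := E)
    (connectedOn_pair (hv s hs)) (connectedOn_singleton p) hC hD hE ?_ ?_ ?_ ?_ ?_ ?_ ?_ dCD dCE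
    dDE ⟨s, by simp, p, rfl, (hp s hs).symm⟩ ⟨v, by simp, c, hc.1, hv c hc.2⟩
    ⟨v, by simp, d, hd.1, hv d hd.2⟩ ⟨v, by simp, e, he.1, hv e he.2⟩ ⟨p, rfl, c, hc.1, hp c hc.2⟩
    ⟨p, rfl, d, hd.1, hp d hd.2⟩ ⟨p, rfl, e, he.1, hp e he.2⟩ lCD lCE lDE
  all_goals
    have := (hp s hs).ne'
    simp only [Set.mem_insert_iff, Set.mem_singleton_iff]
    grind

variable [Finite V]

lemma metricIsCutOn_of_complete_two (hκ : BoundaryAtLeast G 4) (hK : ¬ HasK5Minor G)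
    (hG : InducedCyclesLe4 G) {S : Set V} (hS : 4 ≤ S.ncard) {v p : V} (hvp : v ≠ p)
    (hvp' : ¬ G.Adj v p) (hv : ∀ t ∈ S, G.Adj v t) (hp : ∀ t ∈ S, G.Adj p t)
    (hcover : ∀ y, y = v ∨ y = p ∨ y ∈ S) : MetricIsCutOn G Set.univ := by
  have hvS : v ∉ S := fun h => (hv v h).ne rfl
  have hpS : p ∉ S := fun h => (hp p h).ne rfl
  have hne : ∀ t ∈ S, t ≠ v ∧ t ≠ p := fun t ht => ⟨(hv t ht).ne', (hp t ht).ne'⟩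
  have htri : ∀ a ∈ S, ∀ b ∈ S, ∀ c ∈ S, G.Adj a b → G.Adj a c → ¬ G.Adj b c := by
    intro a ha b hb c hc ab ac bc
    obtain ⟨s, hs, sa, sb, sc⟩ := exists_mem_ne_three hS a b c
    obtain ⟨av, ap⟩ := hne a ha
    obtain ⟨bv, bp⟩ := hne b hb
    obtain ⟨cv, cp⟩ := hne c hc
    exact hK (hasK5Minor_of_complete_two hvp hv hp hs (connectedOn_singleton a)
      (connectedOn_singleton b) (connectedOn_singleton c) (by simpa using ab.ne)
      (by simpa using ac.ne) (by simpa using bc.ne) ⟨a, rfl, b, rfl, ab⟩ ⟨a, rfl, c, rfl, ac⟩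
      ⟨b, rfl, c, rfl, bc⟩ ⟨av.symm, ap.symm, sa⟩ ⟨bv.symm, bp.symm, sb⟩
      ⟨cv.symm, cp.symm, sc⟩ ⟨rfl, ha⟩ ⟨rfl, hb⟩ ⟨rfl, hc⟩)
  -- every vertex of `S` has a non-neighbour in `S`
  have hnonadj : ∀ t ∈ S, ∃ y ∈ S, y ≠ t ∧ ¬ G.Adj t y := by
    intro t ht
    by_contra! hcon
    obtain ⟨x, hx, hxt, -⟩ := exists_mem_ne_three hS t t t
    obtain ⟨y, hy, hyt, hyx, -⟩ := exists_mem_ne_three hS t x x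
    obtain ⟨z, hz, zv, zp, zt⟩ := hκ.exists_ne_three (connectedOn_singleton x) (y := y) hyx
      (hne y hy).1 (hne y hy).2 hyt
    obtain ⟨hzx, z', hz', x', hx', hzx'⟩ := hz
    rw [Set.mem_singleton_iff.1 hz', Set.mem_singleton_iff.1 hx'] at hzx'
    have hzS := ((hcover z).resolve_left zv).resolve_left zp
    exact htri t ht x hx z hzS (hcon x hx hxt) (hcon z hzS zt) hzx'.symm
  have hnbr : ∀ t ∈ S, ∀ w, ∃ x ∈ S, x ≠ w ∧ G.Adj t x := by
    intro t ht w
    obtain ⟨y, hy, hyt, hty⟩ := hnonadj t ht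
    by_cases hyw : y = w
    · obtain ⟨z, ⟨-, z', hz', t', ht', hzt⟩, zv, zp, -⟩ := hκ.exists_ne_three
        (connectedOn_singleton t) (y := y) hyt (hne y hy).1 (hne y hy).2 (hne y hy).2
      rw [Set.mem_singleton_iff.1 hz', Set.mem_singleton_iff.1 ht'] at hzt
      exact ⟨z, ((hcover z).resolve_left zv).resolve_left zp,
        fun h => hty (hyw ▸ h ▸ hzt.symm), hzt.symm⟩
    · obtain ⟨z, ⟨-, z', hz', t', ht', hzt⟩, zv, zp, zw⟩ := hκ.exists_ne_three
        (connectedOn_singleton t) (y := y) hyt (hne y hy).1 (hne y hy).2 hyw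
      rw [Set.mem_singleton_iff.1 hz', Set.mem_singleton_iff.1 ht'] at hzt
      exact ⟨z, ((hcover z).resolve_left zv).resolve_left zp, zw, hzt.symm⟩
  have hdeg : ∀ t ∈ S, ∀ x ∈ S, ∀ y ∈ S, x ≠ y → G.Adj t x → G.Adj t y → ∀ z ∈ S, G.Adj t z →
      z = x ∨ z = y := by
    intro t ht x hx y hy hxy tx ty z hz tz
    by_contra! hcon
    obtain ⟨zx, zy⟩ := hcon
    obtain ⟨C, hC, hxC⟩ := exists_isComponent G (S := {v, p, t} ∪ {s | s ∈ S ∧ G.Adj t s ∧ s ≠ x})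
      (v := x) (by
        have := hne x hx
        have := tx.ne'
        simp only [Set.mem_union, Set.mem_insert_iff, Set.mem_singleton_iff, Set.mem_ofPred_eq]
        tauto)
    have hCd : ∀ a ∈ C, a ≠ v ∧ a ≠ p ∧ a ≠ t ∧ ¬ (a ∈ S ∧ G.Adj t a ∧ a ≠ x) := by
      intro a ha
      have := hC.disj a ha
      simp only [Set.mem_union, Set.mem_insert_iff, Set.mem_singleton_iff, Set.mem_ofPred_eq] at this
      tauto
    obtain ⟨w, hw, wv, wp, wt⟩ := hκ.exists_ne_three hC.conn (y := y)
      (fun h => (hCd y h).2.2.2 ⟨hy, ty, hxy.symm⟩) (hne y hy).1 (hne y hy).2 ty.ne'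
    obtain ⟨hwS, tw, wx⟩ : w ∈ S ∧ G.Adj t w ∧ w ≠ x := by
      rcases hC.outerBoundary_subset hw with (h | h | h) | h
      exacts [absurd h wv, absurd h wp, absurd h wt, h]
    obtain ⟨s, hs, ts, sx, sw⟩ : ∃ s ∈ S, G.Adj t s ∧ s ≠ x ∧ s ≠ w := by
      by_cases h : y = w
      · exact ⟨z, hz, tz, zx, h ▸ zy⟩
      · exact ⟨y, hy, ty, hxy.symm, h⟩
    exact hK (hasK5Minor_of_complete_two hvp hv hp hs (connectedOn_singleton t) hC.conn
      (connectedOn_singleton w) (fun a ha h => (hCd a h).2.2.1 ha)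
      (by simpa using tw.ne) (fun a ha h => hw.1 (h ▸ ha)) ⟨t, rfl, x, hxC, tx⟩ ⟨t, rfl, w, rfl, tw⟩
      hw.2.symm ⟨(hne t ht).1.symm, (hne t ht).2.symm, ts.ne'⟩
      ⟨fun h => (hCd v h).1 rfl, fun h => (hCd p h).2.1 rfl,
        fun h => (hCd s h).2.2.2 ⟨hs, ts, sx⟩⟩
      ⟨(hne w hwS).1.symm, (hne w hwS).2.symm, sw⟩ ⟨rfl, ht⟩ ⟨hxC, hx⟩ ⟨rfl, hwS⟩)
  obtain ⟨t, ht⟩ : S.Nonempty := Set.nonempty_of_ncard_ne_zero (by omega)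
  obtain ⟨x, hx, -, tx⟩ := hnbr t ht t
  obtain ⟨y, hy, yx, ty⟩ := hnbr t ht x
  have hxy := htri t ht x hx y hy tx ty
  have htxy := hdeg t ht x hx y hy yx.symm tx ty
  obtain ⟨a, haS, hat, hax, hay⟩ : ∃ a ∈ S, a ≠ t ∧ G.Adj x a ∧ G.Adj y a := by
    obtain ⟨a, ha, hat, xa⟩ := hnbr x hx t
    have hay : a ≠ y := fun h => hxy (h ▸ xa)
    obtain ⟨A, hA, haA⟩ := exists_isComponent G (S := {v, p, t, x, y}) (v := a) (by
      have := hne a ha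
      have := xa.ne'
      simp only [Set.mem_insert_iff, Set.mem_singleton_iff]
      tauto)
    have hAd : ∀ b ∈ A, b ≠ v ∧ b ≠ p ∧ b ≠ t ∧ b ≠ x ∧ b ≠ y := by
      intro b hb
      have := hA.disj b hb
      simp only [Set.mem_insert_iff, Set.mem_singleton_iff] at this
      tauto
    have hAS : ∀ b ∈ A, b ∈ S := fun b hb =>
      ((hcover b).resolve_left (hAd b hb).1).resolve_left (hAd b hb).2.1
    have htA : ∀ b ∈ A, ¬ G.Adj b t := fun b hb h => by
      rcases htxy b (hAS b hb) h.symm with h' | h'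
      exacts [(hAd b hb).2.2.2.1 h', (hAd b hb).2.2.2.2 h']
    have hyA : Linked G {y} A := by
      obtain ⟨w, hw, wv, wp, wx⟩ := hκ.exists_ne_three hA.conn (y := y)
        (fun h => (hAd y h).2.2.2.2 rfl) (hne y hy).1 (hne y hy).2 yx
      rcases hA.outerBoundary_subset hw with h | h | h | h | h
      · exact absurd h wv
      · exact absurd h wp
      · obtain ⟨-, w', hw', b, hb, hwb⟩ := hw
        rw [Set.mem_singleton_iff.1 hw', h] at hwb
        exact absurd hwb.symm (htA b hb)
      · exact absurd h wx
      · exact (show w = y from h) ▸ hw.2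
    obtain ⟨b, hb, xb, yb⟩ := hG.exists_common_neighbor hA.conn (connectedOn_singleton t)
      (fun b hb h => (hAd b hb).2.2.1 h) (by rintro b hb _ rfl; exact htA b hb) yx.symm hxy
      (fun h => (hAd x h).2.2.2.1 rfl) (fun h => (hAd y h).2.2.2.2 rfl) tx.ne' ty.ne'
      ⟨x, rfl, a, haA, xa⟩ hyA ⟨x, rfl, t, rfl, tx.symm⟩ ⟨y, rfl, t, rfl, ty.symm⟩
    exact ⟨b, hAS b hb, (hAd b hb).2.2.1, xb, yb⟩
  have haxy := hdeg a haS x hx y hy yx.symm hax.symm hay.symm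
  have hxta := hdeg x hx t ht a haS hat.symm tx.symm hax
  have hyta := hdeg y hy t ht a haS hat.symm ty.symm hay
  have hta : ¬ G.Adj t a := fun h => (htxy a haS h).elim hax.ne' hay.ne'
  have hS' : ∀ s ∈ S, s = t ∨ s = a ∨ s = x ∨ s = y := by
    by_contra! h
    obtain ⟨s, hs, st, sa, sx, sy⟩ := h
    have hconn : ConnectedOn G {y, a, x, t} :=
      (((connectedOn_singleton t).insert rfl tx.symm).insert (by simp) hax.symm).insert
        (by simp) hay
    obtain ⟨z, ⟨hz, z', hz', b, hb, hzb⟩, zv, zp, -⟩ := hκ.exists_ne_three hconn (y := s)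
      (by simp only [Set.mem_insert_iff, Set.mem_singleton_iff]; tauto) (hne s hs).1 (hne s hs).2
      (hne s hs).2
    rw [Set.mem_singleton_iff.1 hz'] at hzb
    have hzS := ((hcover z).resolve_left zv).resolve_left zp
    simp only [Set.mem_insert_iff, Set.mem_singleton_iff, not_or] at hz
    rcases hb with rfl | rfl | rfl | rfl
    · exact (hyta z hzS hzb.symm).elim hz.2.2.2 hz.2.1
    · exact (haxy z hzS hzb.symm).elim hz.2.2.1 hz.1
    · exact (hxta z hzS hzb.symm).elim hz.2.2.2 hz.2.1
    · exact (htxy z hzS hzb.symm).elim hz.2.2.1 hz.1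
  have hall : ∀ z, z = v ∨ z = p ∨ z = t ∨ z = a ∨ z = x ∨ z = y := fun z => by
    rcases hcover z with h | h | h
    exacts [Or.inl h, Or.inr (Or.inl h), Or.inr (Or.inr (hS' z h))]
  classical
  let f : V → Fin 3 × Bool := fun z => if z = v then (0, true) else if z = p then (0, false) else
    if z = t then (1, true) else if z = a then (1, false) else if z = x then (2, true)
    else (2, false)
  let g : Fin 3 × Bool → V := fun i => ![![v, p], ![t, a], ![x, y]] i.1 (if i.2 then 0 else 1)
  have fv : f v = (0, true) := if_pos rfl
  have fp : f p = (0, false) := by simp [f, hvp.symm]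
  have ft : f t = (1, true) := by simp [f, hne t ht]
  have fa : f a = (1, false) := by simp [f, hne a haS, hat]
  have fx : f x = (2, true) := by simp [f, hne x hx, tx.ne', hax.ne]
  have fy : f y = (2, false) := by simp [f, hne y hy, ty.ne', hay.ne, yx]
  refine metricIsCutOn_octahedron.comap f g (fun z _ => ?_) (fun _ _ => trivial)
    (fun z _ z' _ hzz => ?_)
  · rcases hall z with rfl | rfl | rfl | rfl | rfl | rfl <;> simp [fv, fp, ft, fa, fx, fy, g]
  · change (f z).1 ≠ (f z').1
    rcases hall z with rfl | rfl | rfl | rfl | rfl | rfl <;>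
      rcases hall z' with rfl | rfl | rfl | rfl | rfl | rfl <;>
      first
      | exact absurd hzz G.irrefl
      | exact absurd hzz hvp'
      | exact absurd hzz.symm hvp'
      | exact absurd hzz hta
      | exact absurd hzz.symm hta
      | exact absurd hzz hxy
      | exact absurd hzz.symm hxy
      | simp [fv, fp, ft, fa, fx, fy]

lemma MaximalCore.metricIsCutOn {v : V} {B S : Set V} (h : MaximalCore G v B S)
    (hκ : BoundaryAtLeast G 4) (hK : ¬ HasK5Minor G) (hG : InducedCyclesLe4 G) :
    MetricIsCutOn G Set.univ := by
  have hv := h.complete v h.notMem h.notMem'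
  obtain ⟨p, hp, t₁, h1, t₂, h2, t₃, h3, h12, h13, h23, p1, p2, p3⟩ := h.exists_adj_three hK hG
  have hpS := h.adj_of_adj_three hK hG hκ hp h1 h2 h3 h12 h13 h23 p1 p2 p3
  have hvp : v ≠ p := fun h' => h.notMem (h' ▸ hp)
  have hunique : ∀ y, y ∉ B → y ∉ S → y = v := by
    intro y hyB hyS
    by_contra hyv
    exact hκ.false_of_complete_three hK h.four hvp (Ne.symm hyv) (fun h' => hyB (h' ▸ hp))
      hv hpS (h.complete y hyB hyS)
  have hBp : ∀ d ∈ B, d = p := by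
    intro d hd
    by_contra hdp
    obtain ⟨D, hD, hdD⟩ := exists_isComponent G (S := insert p S) (v := d) (by
      rintro (h' | h')
      exacts [hdp h', h.disj d h' hd])
    have hDB : D ⊆ B := by
      intro y hy
      by_contra hyB
      obtain ⟨c, -, hc, e, he, heB, hce⟩ := hD.conn.exists_crossing hdD hd hy hyB
      exact h.not_adj c hc e heB (fun h' => hD.disj e he (Or.inr h')) hce
    have hvD : v ∉ D := fun h' => h.notMem (hDB h')
    have hmem : ∀ z ∈ outerBoundary G D, z ≠ p → z ∈ S := fun z hz hzp =>
      (hD.outerBoundary_subset hz).resolve_left hzp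
    have hvS : ∀ s ∈ S, v ≠ s := fun s hs => (hv s hs).ne
    obtain ⟨s₁, hs1, s1p, -⟩ := hκ.exists_ne_three hD.conn hvD hvp hvp hvp
    have m1 := hmem s₁ hs1 s1p
    obtain ⟨s₂, hs2, s2p, n12, -⟩ := hκ.exists_ne_three hD.conn hvD hvp (hvS _ m1) hvp
    have m2 := hmem s₂ hs2 s2p
    obtain ⟨s₃, hs3, s3p, n13, n23⟩ := hκ.exists_ne_three hD.conn hvD hvp (hvS _ m1) (hvS _ m2)
    have m3 := hmem s₃ hs3 s3p
    have hedge : ∀ a b c, a ∈ S → b ∈ S → c ∈ S → a ≠ c → b ≠ c → Linked G {a} D →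
        Linked G {b} D → Linked G {c} D → ¬ G.Adj a b := by
      intro a b c ha hb hc hac hbc la lb lc hab
      obtain ⟨s, hs, sa, sb, sc⟩ := exists_mem_ne_three h.four a b c
      have hSD : ∀ s ∈ S, s ∉ D := fun s hs h' => hD.disj s h' (Or.inr hs)
      have hpD : p ∉ D := fun h' => hD.disj p h' (Or.inl rfl)
      have hSp : ∀ s ∈ S, p ≠ s := fun s hs => (hpS s hs).ne
      refine hK (hasK5Minor_of_complete_two hvp hv hpS hs (connectedOn_singleton a)
        (connectedOn_singleton b) (hD.conn.insert_of_linked lc) (by simpa using hab.ne) ?_ ?_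
        ⟨a, rfl, b, rfl, hab⟩ (la.mono subset_rfl (Set.subset_insert _ _))
        (lb.mono subset_rfl (Set.subset_insert _ _)) ⟨hvS a ha, hSp a ha, sa⟩
        ⟨hvS b hb, hSp b hb, sb⟩ ?_ ⟨rfl, ha⟩ ⟨rfl, hb⟩ ⟨Set.mem_insert c D, hc⟩)
      · rintro _ rfl (h' | h')
        exacts [hac h', hSD _ ha h']
      · rintro _ rfl (h' | h')
        exacts [hbc h', hSD _ hb h']
      · simp only [Set.mem_insert_iff, not_or]
        exact ⟨⟨hvS c hc, hvD⟩, ⟨hSp c hc, hpD⟩, sc, hSD s hs⟩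
    obtain ⟨q, hq, q1, q2, q3⟩ := hG.exists_common_neighbor_three hD.conn (connectedOn_singleton v)
      (fun a ha h' => hvD (h' ▸ ha)) (by
        rintro a ha b rfl
        exact h.not_adj a (hDB ha) _ h.notMem h.notMem') n12.symm n13.symm n23.symm
      (hedge s₁ s₂ s₃ m1 m2 m3 n13.symm n23.symm hs1.2 hs2.2 hs3.2)
      (hedge s₁ s₃ s₂ m1 m3 m2 n12.symm n23 hs1.2 hs3.2 hs2.2)
      (hedge s₂ s₃ s₁ m2 m3 m1 n12 n13 hs2.2 hs3.2 hs1.2) (by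
        intro t ht
        obtain ⟨htS, htD⟩ : t ∈ S ∧ t ∈ outerBoundary G D := by
          rcases ht with rfl | rfl | rfl
          exacts [⟨m1, hs1⟩, ⟨m2, hs2⟩, ⟨m3, hs3⟩]
        exact ⟨htD.1, (hvS t htS).symm, htD.2, t, rfl, v, rfl, (hv t htS).symm⟩)
    have hqS := h.adj_of_adj_three hK hG hκ (hDB hq) m1 m2 m3 n12.symm n13.symm n23.symm q1 q2 q3
    exact hκ.false_of_complete_three hK h.four hvp (fun h' => hvD (h' ▸ hq))
      (fun h' => hD.disj p (h' ▸ hq) (Or.inl rfl)) hv hpS hqS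
  refine metricIsCutOn_of_complete_two hκ hK hG h.four hvp
    (fun h' => h.not_adj p hp v h.notMem h.notMem' h'.symm) hv hpS fun y => ?_
  by_cases hyB : y ∈ B
  · exact Or.inr (Or.inl (hBp y hyB))
  · by_cases hyS : y ∈ S
    · exact Or.inr (Or.inr hyS)
    · exact Or.inl (hunique y hyB hyS)

lemma exists_maximalCore (hκ : BoundaryAtLeast G 4) {a b : V} (hab : a ≠ b)
    (hab' : ¬ G.Adj a b) : ∃ v B S, MaximalCore G v B S := by
  obtain ⟨⟨v, B⟩, ⟨hB, hvB, hvS⟩, hmax⟩ := Set.exists_max_image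
    {x : V × Set V | ConnectedOn G x.2 ∧ x.1 ∉ x.2 ∧ x.1 ∉ outerBoundary G x.2}
    (fun x => x.2.ncard) (Set.toFinite _) ⟨(a, {b}), connectedOn_singleton b, hab, by
      rintro ⟨-, a', ha, b', hb, h⟩
      rw [Set.mem_singleton_iff.1 ha, Set.mem_singleton_iff.1 hb] at h
      exact hab' h⟩
  refine ⟨v, B, outerBoundary G B, hB, hvB, hvS, fun s hs => hs.1, fun s hs => hs.2,
    fun b hb y hy hyS h => hyS (mem_outerBoundary_of_adj hb hy h), fun y hyB hyS s hs => ?_,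
    hκ B hB ⟨v, hvB, hvS⟩⟩
  by_contra hys
  have hle := hmax (y, insert s B) ⟨hB.insert_of_linked hs.2, by
    rintro (h | h)
    exacts [hyS ((show y = s from h) ▸ hs), hyB h], by
    rintro ⟨-, y', hy', c, hc, h⟩
    rw [Set.mem_singleton_iff.1 hy'] at h
    rcases hc with rfl | hc
    exacts [hys h, hyS (mem_outerBoundary_of_adj hc hyB h.symm)]⟩
  dsimp only at hle
  rw [Set.ncard_insert_of_notMem hs.1 (Set.toFinite _)] at hle
  omega

lemma metricIsCutOn_of_smaller (ih : SmallerGraphsOk.{u} (Nat.card V)) (hK : ¬ HasK5Minor G)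
    (hG : InducedCyclesLe4 G) : MetricIsCutOn G Set.univ := by
  by_cases hcomplete : ∀ a b, a ≠ b → G.Adj a b
  · refine metricIsCutOn_of_ncard_le_four G Set.finite_univ ?_
    by_contra! h
    obtain ⟨f⟩ : Nonempty (Fin 5 ↪ V) := by
      have := Fintype.ofFinite V
      refine Function.Embedding.nonempty_of_card_le ?_
      rw [Set.ncard_univ, Nat.card_eq_fintype_card] at h
      rw [Fintype.card_fin]
      exact h
    have hf : ∀ i j, i ≠ j → ∀ x ∈ ({f i} : Set V), x ∉ ({f j} : Set V) := by
      rintro i j hij _ rfl h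
      exact hij (f.injective h)
    have hl : ∀ i j, i ≠ j → Linked G {f i} {f j} := fun i j hij =>
      ⟨_, rfl, _, rfl, hcomplete _ _ fun h => hij (f.injective h)⟩
    have hc := fun i => connectedOn_singleton (G := G) (f i)
    exact hK (hasK5Minor_of (hc 0) (hc 1) (hc 2) (hc 3) (hc 4)
      (hf _ _ (by decide)) (hf _ _ (by decide)) (hf _ _ (by decide)) (hf _ _ (by decide))
      (hf _ _ (by decide)) (hf _ _ (by decide)) (hf _ _ (by decide)) (hf _ _ (by decide))
      (hf _ _ (by decide)) (hf _ _ (by decide))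
      (hl _ _ (by decide)) (hl _ _ (by decide)) (hl _ _ (by decide)) (hl _ _ (by decide))
      (hl _ _ (by decide)) (hl _ _ (by decide)) (hl _ _ (by decide)) (hl _ _ (by decide))
      (hl _ _ (by decide)) (hl _ _ (by decide)))
  · push Not at hcomplete
    obtain ⟨a, b, hab, hab'⟩ := hcomplete
    obtain ⟨A, ⟨hA, v, hvA, hvN⟩, hmin⟩ := Set.exists_min_image
      {A : Set V | ConnectedOn G A ∧ ∃ v, v ∉ A ∧ v ∉ outerBoundary G A}
      (fun A => (outerBoundary G A).ncard) (Set.toFinite _) ⟨{a}, connectedOn_singleton a, b,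
        hab.symm, by
        rintro ⟨-, b', hb, a', ha, h⟩
        rw [Set.mem_singleton_iff.1 ha, Set.mem_singleton_iff.1 hb] at h
        exact hab' h.symm⟩
    have hκ : BoundaryAtLeast G (outerBoundary G A).ncard := fun A' hA' hv => hmin A' ⟨hA', hv⟩
    have hAc := isComponent_outerBoundary hA
    obtain ⟨D, hD, hvD⟩ := exists_isComponent G hvN
    have hAD : A ≠ D := fun h => hvA (h ▸ hvD)
    have hfull := hκ.fullSeparator hAc hD hAD
    rcases Nat.lt_or_ge (outerBoundary G A).ncard 4 with hlt | hge
    · generalize outerBoundary G A = S at *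
      interval_cases hn : S.ncard
      · rw [Set.ncard_eq_zero] at hn
        exact hfull.metricIsCutOn_of_clique ih hK hG (Or.inl hn) a (by simp [hn])
      · obtain ⟨c, rfl⟩ := Set.ncard_eq_one.1 hn
        exact hfull.metricIsCutOn_of_clique ih hK hG (Or.inr ⟨c, c, c, by simp⟩) c
          (fun s hs _ _ _ hs' _ => absurd hs hs')
      · obtain ⟨c, d, -, rfl⟩ := Set.ncard_eq_two.1 hn
        refine hfull.metricIsCutOn_of_clique ih hK hG (Or.inr ⟨c, d, d, by simp⟩) c ?_
        rintro s (rfl | rfl) t (rfl | rfl) h1 h2 h3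
        all_goals first | exact absurd rfl h1 | exact absurd rfl h2 | exact absurd rfl h3
      · obtain ⟨c, d, e, hcd, hce, hde, rfl⟩ := Set.ncard_eq_three.1 hn
        exact metricIsCutOn_of_three_separator ih hK hG hκ hcd hce hde hAc hD hAD
    · have hκ4 : BoundaryAtLeast G 4 := fun A' hA' hv => hge.trans (hκ A' hA' hv)
      obtain ⟨w, B, S, hS⟩ := exists_maximalCore hκ4 hab hab'
      exact hS.metricIsCutOn hκ4 hK hG

end FourConnectedMain

section MainStructure

universe u

/-- In a graph without `K₅` minor and without long induced cycles, every semimetric restricted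
to the edges is a convex combination of cuts. -/
theorem metricIsCutOn_univ {V : Type u} [Finite V] {G : SimpleGraph V} (hK : ¬ HasK5Minor G)
    (hG : InducedCyclesLe4 G) : MetricIsCutOn G Set.univ := by
  suffices h : ∀ n, SmallerGraphsOk.{u} n from h _ V G (Nat.lt_succ_self _) hK hG
  intro n
  induction n with
  | zero => exact fun _ _ _ h => absurd h (Nat.not_lt_zero _)
  | succ n ih =>
    intro W _ H hW hK hG
    refine metricIsCutOn_of_smaller (fun W' _ H' h' => ih W' H' (by omega)) hK hG

end MainStructure

section Compressed

variable {E : Type*}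

lemma isCompressed_of_functionals {A : Set (E → ℝ)} {ι : Type*} [Finite ι]
    (φ : ι → (E → ℝ) →ₗ[ℝ] ℝ) (hinj : ∀ x y, (∀ i, φ i x = φ i y) → x = y)
    (h01 : ∀ i, ∀ a ∈ A, φ i a = 0 ∨ φ i a = 1)
    (hull : ∀ x, (∀ i, φ i x ∈ Set.Icc (0 : ℝ) 1) → x ∈ convexHull ℝ A) : IsCompressed A := by
  obtain ⟨N, ⟨e⟩⟩ := Finite.exists_equiv_fin ι
  have hcube : ∀ i, ∀ x ∈ convexHull ℝ A, φ i x ∈ Set.Icc (0 : ℝ) 1 := by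
    intro i x hx
    have hsub : convexHull ℝ A ⊆ φ i ⁻¹' Set.Icc (0 : ℝ) 1 := by
      refine convexHull_min (fun a ha => ?_) ((convex_Icc 0 1).linear_preimage _)
      rcases h01 i a ha with h | h <;> simp [h]
    exact hsub hx
  have hinteger : ∀ i, ∀ x ∈ AddSubgroup.closure A, ∃ n : ℤ, φ i x = n := by
    intro i x hx
    induction hx using AddSubgroup.closure_induction with
    | mem a ha =>
      rcases h01 i a ha with h | h
      exacts [⟨0, by simp [h]⟩, ⟨1, by simp [h]⟩]
    | zero => exact ⟨0, by simp⟩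
    | add a b _ _ ha hb =>
      obtain ⟨m, hm⟩ := ha
      obtain ⟨n, hn⟩ := hb
      exact ⟨m + n, by simp [hm, hn]⟩
    | neg a _ ha =>
      obtain ⟨m, hm⟩ := ha
      exact ⟨-m, by simp [hm]⟩
  let π : (E → ℝ) →ₗ[ℝ] (Fin N → ℝ) := LinearMap.pi fun j => φ (e.symm j)
  have hπ : ∀ x j, π.toAffineMap x j = φ (e.symm j) x := fun x j => rfl
  refine ⟨N, π.toAffineMap, fun x _ y _ hxy => hinj x y fun i => ?_, fun x ⟨hx, hx'⟩ j => ?_, ?_⟩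
  · simpa [hπ] using congrFun hxy (e i)
  · obtain ⟨n, hn⟩ := hinteger (e.symm j) x hx'
    have h := hcube (e.symm j) x hx
    rw [hπ, hn]
    rw [hn] at h
    have h0 : (0 : ℤ) ≤ n := by exact_mod_cast h.1
    have h1 : n ≤ (1 : ℤ) := by exact_mod_cast h.2
    rcases (by omega : n = 0 ∨ n = 1) with h | h <;> simp [h]
  · refine Set.Subset.antisymm (Set.subset_inter ?_ (subset_affineSpan ℝ _)) ?_
    · rintro _ ⟨x, hx, rfl⟩ j
      exact hcube _ x hx
    · rintro y ⟨hy, hy'⟩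
      have hle : affineSpan ℝ (π.toAffineMap '' convexHull ℝ A) ≤ (⊤ : AffineSubspace ℝ _).map
          π.toAffineMap := by
        rw [affineSpan_le]
        rintro _ ⟨x, -, rfl⟩
        exact ⟨x, trivial, rfl⟩
      obtain ⟨x, -, rfl⟩ := hle hy'
      refine ⟨x, hull x fun i => ?_, rfl⟩
      simpa [hπ] using hy (e i)

end Compressed

section CutPolytope

variable {V : Type*} {G : SimpleGraph V}

open Classical in
/-- The coordinate of a vector indexed by edges at the pair `u v`, zero if this is not an edge. -/
def edgeCoord (G : SimpleGraph V) (u v : V) : (G.edgeSet → ℝ) →ₗ[ℝ] ℝ :=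
  if h : G.Adj u v then LinearMap.proj ⟨s(u, v), h⟩ else 0

lemma edgeCoord_of_adj {u v : V} (h : G.Adj u v) (x : G.edgeSet → ℝ) :
    edgeCoord G u v x = x ⟨s(u, v), h⟩ := by
  simp [edgeCoord, h]

lemma edgeCoord_comm (u v : V) : edgeCoord G u v = edgeCoord G v u := by
  by_cases h : G.Adj u v
  · refine LinearMap.ext fun x => ?_
    rw [edgeCoord_of_adj h, edgeCoord_of_adj h.symm]
    congr 1
    exact Subtype.ext Sym2.eq_swap
  · have h' : ¬ G.Adj v u := fun h' => h h'.symm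
    simp [edgeCoord, h, h']

lemma edgeCoord_cutVec {u v : V} (h : G.Adj u v) (S : Set V) :
    edgeCoord G u v (cutVec G S) = cutSep S u v := by
  rw [edgeCoord_of_adj h]
  simp only [cutVec, cutSep, Sym2.lift_mk]
  congr

/-- Half of a signed sum of coordinates along a closed walk of length four. -/
def walkFunctional (G : SimpleGraph V) (i : (V × V × V × V) × (Fin 4 → SignType)) :
    (G.edgeSet → ℝ) →ₗ[ℝ] ℝ :=
  (1 / 2 : ℝ) • (((i.2 0 : SignType) : ℝ) • edgeCoord G i.1.1 i.1.2.1 +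
    ((i.2 1 : SignType) : ℝ) • edgeCoord G i.1.2.1 i.1.2.2.1 +
    ((i.2 2 : SignType) : ℝ) • edgeCoord G i.1.2.2.1 i.1.2.2.2 +
    ((i.2 3 : SignType) : ℝ) • edgeCoord G i.1.2.2.2 i.1.1)

lemma isCompressed_cutVec [Finite V] (hK : ¬ HasK5Minor G) (hG : InducedCyclesLe4 G) :
    IsCompressed (Set.range (cutVec G)) := by
  let ι := {i // ∀ S, walkFunctional G i (cutVec G S) = 0 ∨ walkFunctional G i (cutVec G S) = 1}
  have hedge : ∀ u v, G.Adj u v → ∀ S, walkFunctional G ((u, v, u, v), ![1, 1, 0, 0]) (cutVec G S)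
      = 0 ∨ walkFunctional G ((u, v, u, v), ![1, 1, 0, 0]) (cutVec G S) = 1 := by
    intro u v h S
    simp [walkFunctional, edgeCoord_comm v u, edgeCoord_cutVec h, cutSep]
    by_cases u ∈ S <;> by_cases v ∈ S <;> simp [*] <;> norm_num
  have hedge' : ∀ u v x, walkFunctional G ((u, v, u, v), ![1, 1, 0, 0]) x = edgeCoord G u v x := by
    intro u v x
    simp [walkFunctional, edgeCoord_comm v u]
    ring
  refine isCompressed_of_functionals (ι := ι) (fun i => walkFunctional G i.1) ?_ ?_ ?_
  · intro x y hxy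
    ext ⟨e, he⟩
    induction e using Sym2.ind with
    | _ u v =>
      have := hxy ⟨_, hedge u v he⟩
      simpa only [hedge', edgeCoord_of_adj he] using this
  · rintro i _ ⟨S, rfl⟩
    exact i.2 S
  · intro x hx
    have hx' : ∀ a b c d s, (∀ S, walkFunctional G ((a, b, c, d), s) (cutVec G S) = 0 ∨
        walkFunctional G ((a, b, c, d), s) (cutVec G S) = 1) →
        walkFunctional G ((a, b, c, d), s) x ∈ Set.Icc (0 : ℝ) 1 := fun a b c d s h => hx ⟨_, h⟩
    have hS : ShortCycles G fun u v => edgeCoord G u v x := by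
      refine ⟨fun u v => by rw [edgeCoord_comm], fun u v h => ?_, fun a b c hab hbc hca => ?_,
        fun a b c hab hbc hca => ?_, fun a b c d hab hbc hcd hda => ?_,
        fun a b c d hab hbc hcd hda => ?_⟩
      · have := hx' u v u v _ (hedge u v h)
        rwa [hedge'] at this
      · have := hx' a b c a ![1, 1, -1, 0] fun S => by
          simp [walkFunctional, edgeCoord_cutVec hab, edgeCoord_cutVec hbc, edgeCoord_cutVec hca,
            cutSep]
          by_cases a ∈ S <;> by_cases b ∈ S <;> by_cases c ∈ S <;> simp [*] <;> norm_num
        simp [walkFunctional] at this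
        linarith [this.1]
      · have := hx' a b c a ![1, 1, 1, 0] fun S => by
          simp [walkFunctional, edgeCoord_cutVec hab, edgeCoord_cutVec hbc, edgeCoord_cutVec hca,
            cutSep]
          by_cases a ∈ S <;> by_cases b ∈ S <;> by_cases c ∈ S <;> simp [*] <;> norm_num
        simp [walkFunctional] at this
        linarith [this.2]
      all_goals
        have := hx' a b c d ![1, 1, 1, -1] fun S => by
          simp [walkFunctional, edgeCoord_cutVec hab, edgeCoord_cutVec hbc, edgeCoord_cutVec hcd,
            edgeCoord_cutVec hda, cutSep]
          by_cases a ∈ S <;> by_cases b ∈ S <;> by_cases c ∈ S <;> by_cases d ∈ S <;>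
            simp [*] <;> norm_num
        simp [walkFunctional] at this
        linarith [this.1, this.2]
    obtain ⟨y, hy, hyx⟩ := hS.exists_semimetric hG
    obtain ⟨κ, _, w, T, hw, h1, hT⟩ := metricIsCutOn_univ hK hG y hy
    refine mem_convexHull_of_exists_fintype w (fun i => cutVec G (T i)) hw h1
      (fun i => ⟨_, rfl⟩) ?_
    ext ⟨e, he⟩
    induction e using Sym2.ind with
    | _ u v =>
      have h := hT u v ⟨he, trivial, trivial⟩
      rw [hyx u v he, edgeCoord_of_adj he] at h
      rw [← h, Finset.sum_apply]
      refine Finset.sum_congr rfl fun i _ => ?_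
      rw [← edgeCoord_cutVec he, edgeCoord_of_adj he]
      rfl

end CutPolytope

section Facets

open Filter Topology

variable {E : Type*}

/-- A compressed polytope has width one with respect to some functional that vanishes on a given
proper face and is positive at a given vertex outside the face. -/
lemma IsCompressed.exists_functional {A : Set (E → ℝ)} (hA : IsCompressed A) (hfin : A.Finite)
    {L : (E → ℝ) →ₗ[ℝ] ℝ} {β : ℝ} (hL : ∀ a ∈ A, L a ≤ β) (hne : ∃ a ∈ A, L a = β)
    {a₀ : E → ℝ} (ha₀ : a₀ ∈ A) (hLa₀ : L a₀ < β) :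
    ∃ (φ : (E → ℝ) →ₗ[ℝ] ℝ) (c : ℝ), (∀ a ∈ A, φ a + c = 0 ∨ φ a + c = 1) ∧
      (∀ a ∈ A, L a = β → φ a + c = 0) ∧ φ a₀ + c = 1 := by
  obtain ⟨N, π, hinj, h01, himg⟩ := hA
  have hAP : ∀ a ∈ A, a ∈ convexHull ℝ A := fun a ha => subset_convexHull ℝ A ha
  have hA01 : ∀ a ∈ A, ∀ i, π a i = 0 ∨ π a i = 1 := fun a ha =>
    h01 a ⟨hAP a ha, AddSubgroup.subset_closure ha⟩
  have hLP : ∀ x ∈ convexHull ℝ A, L x ≤ β := fun x hx =>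
    convexHull_min (s := A) (t := {x | L x ≤ β}) hL (convex_halfSpace_le L.isLinear β) hx
  have hπ : ∀ x i, π x i = π.linear x i + π 0 i := fun x i =>
    congrFun (congrFun π.decomp x) i
  -- the barycentre of the face
  let F : Finset (E → ℝ) := (hfin.subset (Set.sep_subset A fun a => L a = β)).toFinset
  have hF : ∀ a, a ∈ F ↔ a ∈ A ∧ L a = β := fun a => by
    simp only [F, Set.Finite.mem_toFinset, Set.mem_sep_iff]
  have hFne : F.Nonempty := by
    obtain ⟨a, ha, h⟩ := hne
    exact ⟨a, (hF a).2 ⟨ha, h⟩⟩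
  have hcard : (0 : ℝ) < F.card := Nat.cast_pos.2 hFne.card_pos
  let p : E → ℝ := ∑ a ∈ F, (F.card : ℝ)⁻¹ • a
  have hp : p ∈ convexHull ℝ A := by
    refine (convex_convexHull ℝ A).sum_mem (fun _ _ => inv_nonneg.2 hcard.le) ?_
      fun a ha => hAP a ((hF a).1 ha).1
    simp [hcard.ne']
  have hpφ : ∀ φ : (E → ℝ) →ₗ[ℝ] ℝ, φ p = (F.card : ℝ)⁻¹ * ∑ a ∈ F, φ a := by
    intro φ
    simp [p, Finset.mul_sum]
  have hLp : L p = β := by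
    rw [hpφ, Finset.sum_congr rfl fun a ha => ((hF a).1 ha).2]
    simp [hcard.ne']
  have hpcube : ∀ x ∈ convexHull ℝ A, ∀ i, π x i ∈ Set.Icc (0 : ℝ) 1 := fun x hx =>
    (himg.subset ⟨x, hx, rfl⟩).1
  -- beyond the face, some coordinate leaves the cube
  have hleave : ∀ t : ℝ, 0 < t → ∃ i, π p i + t * (π p i - π a₀ i) ∉ Set.Icc (0 : ℝ) 1 := by
    intro t ht
    by_contra! hcon
    have hline : AffineMap.lineMap (π a₀) (π p) (1 + t) ∈ stdCube N ∩
        (affineSpan ℝ (π '' convexHull ℝ A) : Set (Fin N → ℝ)) := by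
      refine ⟨fun i => ?_, AffineMap.lineMap_mem _
        (subset_affineSpan ℝ _ ⟨_, hAP _ ha₀, rfl⟩) (subset_affineSpan ℝ _ ⟨_, hp, rfl⟩)⟩
      have := hcon i
      convert this using 1
      simp [AffineMap.lineMap_apply]
      ring
    rw [← himg] at hline
    obtain ⟨x, hx, hxe⟩ := hline
    have hmid : (1 / (1 + t)) • x + (t / (1 + t)) • a₀ ∈ convexHull ℝ A :=
      convex_convexHull ℝ A hx (hAP _ ha₀) (by positivity) (by positivity) (by field_simp)
    have hpe : (1 / (1 + t)) • x + (t / (1 + t)) • a₀ = p := by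
      refine hinj hmid hp (funext fun i => ?_)
      have hxi := congrFun hxe i
      simp only [AffineMap.lineMap_apply, vsub_eq_sub, vadd_eq_add, Pi.add_apply, Pi.smul_apply,
        Pi.sub_apply, smul_eq_mul] at hxi
      rw [hπ] at hxi ⊢
      rw [hπ p, hπ a₀] at hxi
      rw [hπ p]
      simp only [map_add, map_smul, Pi.add_apply, Pi.smul_apply, smul_eq_mul]
      have : π.linear x i = (1 + t) * (π.linear p i - π.linear a₀ i) + π.linear a₀ i := by
        linarith
      rw [this]
      field_simp
      ring
    have h1 := congrArg L hpe
    simp only [map_add, map_smul, smul_eq_mul, hLp] at h1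
    have h2 := hLP x hx
    have h3 : L x + t * L a₀ = (1 + t) * β := by
      rw [← h1]
      field_simp
    nlinarith
  obtain ⟨i, hi, hi'⟩ : ∃ i, (π p i = 0 ∨ π p i = 1) ∧ π p i ≠ π a₀ i := by
    by_contra! hcon
    have hev : ∀ i, ∀ᶠ t in 𝓝[>] (0 : ℝ), π p i + t * (π p i - π a₀ i) ∈ Set.Icc (0 : ℝ) 1 := by
      intro i
      by_cases h : π p i = 0 ∨ π p i = 1
      · refine Eventually.of_forall fun t => ?_
        rw [← hcon i h]
        simpa using hpcube p hp i
      · push Not at h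
        have hmem := hpcube p hp i
        have hcont : Tendsto (fun t : ℝ => π p i + t * (π p i - π a₀ i)) (𝓝[>] 0)
            (𝓝 (π p i)) := by
          have : Continuous fun t : ℝ => π p i + t * (π p i - π a₀ i) := by fun_prop
          have := this.tendsto 0
          simp only [zero_mul, add_zero] at this
          exact this.mono_left nhdsWithin_le_nhds
        exact hcont (Icc_mem_nhds (lt_of_le_of_ne hmem.1 h.1.symm) (lt_of_le_of_ne hmem.2 h.2))
    obtain ⟨t, ht, ht'⟩ := ((eventually_all.2 hev).and self_mem_nhdsWithin).exists
    obtain ⟨i, hi⟩ := hleave t ht'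
    exact hi (ht i)
  -- normalise the coordinate
  obtain ⟨φ, c, hφ01, hφp, hφa⟩ : ∃ (φ : (E → ℝ) →ₗ[ℝ] ℝ) (c : ℝ),
      (∀ a ∈ A, φ a + c = 0 ∨ φ a + c = 1) ∧ φ p + c = 0 ∧ φ a₀ + c = 1 := by
    let ψ : (E → ℝ) →ₗ[ℝ] ℝ := (LinearMap.proj i).comp π.linear
    have hψ : ∀ x, π x i = ψ x + π 0 i := fun x => hπ x i
    have ha := hA01 a₀ ha₀ i
    rcases hi with h0 | h1
    · refine ⟨ψ, π 0 i, fun a ha => ?_, ?_, ?_⟩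
      · rw [← hψ]; exact hA01 a ha i
      · rw [← hψ, h0]
      · rw [← hψ]
        exact ha.resolve_left fun h => hi' (h0.trans h.symm)
    · refine ⟨-ψ, 1 - π 0 i, fun a ha => ?_, ?_, ?_⟩
      · have := hψ a
        simp only [LinearMap.neg_apply]
        rcases hA01 a ha i with h | h
        · right; linarith
        · left; linarith
      · have := hψ p
        simp only [LinearMap.neg_apply]
        linarith
      · have := hψ a₀
        have h := ha.resolve_right fun h => hi' (h1.trans h.symm)
        simp only [LinearMap.neg_apply]
        linarith
  refine ⟨φ, c, hφ01, fun a ha hLa => ?_, hφa⟩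
  have hsum : ∑ a ∈ F, (φ a + c) = 0 := by
    rw [Finset.sum_add_distrib, Finset.sum_const, nsmul_eq_mul]
    rw [hpφ] at hφp
    have : (F.card : ℝ) * ((F.card : ℝ)⁻¹ * ∑ a ∈ F, φ a + c) = 0 := by rw [hφp, mul_zero]
    rwa [mul_add, mul_inv_cancel_left₀ hcard.ne'] at this
  refine (Finset.sum_eq_zero_iff_of_nonneg fun b hb => ?_).1 hsum a ((hF a).2 ⟨ha, hLa⟩)
  rcases hφ01 b ((hF b).1 hb).1 with h | h <;> simp [h]

end Facets

section CutIdentities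

variable {V : Type*} {G : SimpleGraph V}

lemma cutVec_ext {x y : G.edgeSet → ℝ}
    (h : ∀ u v, G.Adj u v → edgeCoord G u v x = edgeCoord G u v y) : x = y := by
  ext ⟨e, he⟩
  induction e using Sym2.ind with
  | _ u v => simpa only [edgeCoord_of_adj he] using h u v he

lemma cutVec_union_add {X Y Z : Set V} (hXY : Disjoint X Y) (hYZ : Disjoint Y Z)
    (hXZ : Disjoint X Z) (hadj : ∀ u ∈ X, ∀ v ∈ Z, ¬ G.Adj u v) :
    cutVec G (X ∪ Y ∪ Z) + cutVec G Y = cutVec G (X ∪ Y) + cutVec G (Y ∪ Z) := by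
  refine cutVec_ext fun u v h => ?_
  simp only [map_add, edgeCoord_cutVec h, cutSep, Set.mem_union]
  have hu1 : u ∈ X → u ∉ Y := fun h => Set.disjoint_left.1 hXY h
  have hu2 : u ∈ Y → u ∉ Z := fun h => Set.disjoint_left.1 hYZ h
  have hu3 : u ∈ X → u ∉ Z := fun h => Set.disjoint_left.1 hXZ h
  have hv1 : v ∈ X → v ∉ Y := fun h => Set.disjoint_left.1 hXY h
  have hv2 : v ∈ Y → v ∉ Z := fun h => Set.disjoint_left.1 hYZ h
  have hv3 : v ∈ X → v ∉ Z := fun h => Set.disjoint_left.1 hXZ h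
  have huv : u ∈ X → v ∉ Z := fun h1 h2 => hadj u h1 v h2 h
  have hvu : v ∈ X → u ∉ Z := fun h1 h2 => hadj v h1 u h2 h.symm
  clear hXY hYZ hXZ hadj
  by_cases u ∈ X <;> by_cases u ∈ Y <;> by_cases u ∈ Z <;> by_cases v ∈ X <;> by_cases v ∈ Y <;>
    by_cases v ∈ Z <;> simp_all

lemma cutVec_union_union {X Y Z : Set V} (hXY : Disjoint X Y) (hYZ : Disjoint Y Z)
    (hXZ : Disjoint X Z) :
    cutVec G (X ∪ Y ∪ Z) + cutVec G X + cutVec G Y + cutVec G Z =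
      cutVec G (X ∪ Y) + cutVec G (Y ∪ Z) + cutVec G (X ∪ Z) + cutVec G ∅ := by
  refine cutVec_ext fun u v h => ?_
  simp only [map_add, edgeCoord_cutVec h, cutSep, Set.mem_union, Set.mem_empty_iff_false]
  have hu1 : u ∈ X → u ∉ Y := fun h => Set.disjoint_left.1 hXY h
  have hu2 : u ∈ Y → u ∉ Z := fun h => Set.disjoint_left.1 hYZ h
  have hu3 : u ∈ X → u ∉ Z := fun h => Set.disjoint_left.1 hXZ h
  have hv1 : v ∈ X → v ∉ Y := fun h => Set.disjoint_left.1 hXY h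
  have hv2 : v ∈ Y → v ∉ Z := fun h => Set.disjoint_left.1 hYZ h
  have hv3 : v ∈ X → v ∉ Z := fun h => Set.disjoint_left.1 hXZ h
  clear hXY hYZ hXZ
  by_cases u ∈ X <;> by_cases u ∈ Y <;> by_cases u ∈ Z <;> by_cases v ∈ X <;> by_cases v ∈ Y <;>
    by_cases v ∈ Z <;> simp_all

end CutIdentities

section Necessity

variable {V : Type*} {G : SimpleGraph V}

lemma IsCompressed.exists_cut_functional [Finite V] (hC : IsCompressed (Set.range (cutVec G)))
    {L : (G.edgeSet → ℝ) →ₗ[ℝ] ℝ} {β : ℝ} (hL : ∀ S, L (cutVec G S) ≤ β) {T S₀ : Set V}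
    (hT : L (cutVec G T) = β) (hS₀ : L (cutVec G S₀) < β) :
    ∃ (φ : (G.edgeSet → ℝ) →ₗ[ℝ] ℝ) (c : ℝ),
      (∀ S, φ (cutVec G S) + c = 0 ∨ φ (cutVec G S) + c = 1) ∧
      (∀ S, L (cutVec G S) = β → φ (cutVec G S) + c = 0) ∧ φ (cutVec G S₀) + c = 1 := by
  obtain ⟨φ, c, h01, h0, h1⟩ := hC.exists_functional (Set.finite_range _)
    (by rintro _ ⟨S, rfl⟩; exact hL S) ⟨_, ⟨T, rfl⟩, hT⟩ ⟨S₀, rfl⟩ hS₀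
  exact ⟨φ, c, fun S => h01 _ ⟨S, rfl⟩, fun S => h0 _ ⟨S, rfl⟩, h1⟩

lemma sum_split_five (σ : Finset (Fin 5)) :
    (∑ i, ∑ j, if (i ∈ σ ↔ j ∈ σ) then (0 : ℝ) else 1) = 2 * σ.card * (5 - σ.card) := by
  have h : ∀ σ : Finset (Fin 5), (∑ i, ∑ j, if (i ∈ σ ↔ j ∈ σ) then (0 : ℤ) else 1) =
      2 * σ.card * (5 - σ.card) := by decide
  exact_mod_cast h σ

lemma IsCompressed.not_hasK5Minor [Finite V] (hC : IsCompressed (Set.range (cutVec G))) :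
    ¬ HasK5Minor G := by
  classical
  have := Fintype.ofFinite V
  rintro ⟨B, hne, hdisj, hconn, hadj⟩
  have : Nonempty V := (hne 0).to_subtype.map Subtype.val
  choose! a ha b hb hab using hadj
  let ℓ : (G.edgeSet → ℝ) →ₗ[ℝ] ℝ := ∑ i, ∑ j, if i = j then 0 else edgeCoord G (a i j) (b i j)
  let m : (G.edgeSet → ℝ) →ₗ[ℝ] ℝ :=
    ∑ i, ∑ u, ∑ v, if u ∈ B i ∧ v ∈ B i then edgeCoord G u v else 0
  have hℓ : ∀ S, ℓ (cutVec G S) = ∑ i, ∑ j, if i = j then 0 else cutSep S (a i j) (b i j) := by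
    intro S
    simp only [ℓ, LinearMap.sum_apply]
    refine Finset.sum_congr rfl fun i _ => Finset.sum_congr rfl fun j _ => ?_
    split_ifs with h
    · rfl
    · exact edgeCoord_cutVec (hab i j h) S
  have hcoord : ∀ u v S, edgeCoord G u v (cutVec G S) = if G.Adj u v then cutSep S u v else 0 := by
    intro u v S
    split_ifs with h
    · exact edgeCoord_cutVec h S
    · simp [edgeCoord, h]
  have hm : ∀ S, m (cutVec G S) = ∑ i, ∑ u, ∑ v,
      if u ∈ B i ∧ v ∈ B i ∧ G.Adj u v then cutSep S u v else 0 := by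
    intro S
    simp only [m, LinearMap.sum_apply]
    refine Finset.sum_congr rfl fun i _ => Finset.sum_congr rfl fun u _ =>
      Finset.sum_congr rfl fun v _ => ?_
    by_cases h : u ∈ B i ∧ v ∈ B i
    · simp [h, hcoord]
    · rw [if_neg h, if_neg fun h' => h ⟨h'.1, h'.2.1⟩]
      rfl
  have hsep : ∀ S (u v : V), 0 ≤ cutSep S u v ∧ cutSep S u v ≤ 1 := by
    intro S u v
    unfold cutSep
    split_ifs <;> norm_num
  have hconst : ∀ (S : Set V) (σ : Finset (Fin 5)), (∀ i, ∀ u ∈ B i, (u ∈ S ↔ i ∈ σ)) →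
      (ℓ - (8 : ℝ) • m) (cutVec G S) = 2 * σ.card * (5 - σ.card) := by
    intro S σ h
    have hm0 : m (cutVec G S) = 0 := by
      rw [hm]
      refine Finset.sum_eq_zero fun i _ => Finset.sum_eq_zero fun u _ =>
        Finset.sum_eq_zero fun v _ => ?_
      split_ifs with h'
      · simp [cutSep, h i u h'.1, h i v h'.2.1]
      · rfl
    simp only [LinearMap.sub_apply, LinearMap.smul_apply, hm0, smul_zero, sub_zero]
    rw [hℓ, ← sum_split_five]
    refine Finset.sum_congr rfl fun i _ => Finset.sum_congr rfl fun j _ => ?_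
    by_cases hij : i = j
    · simp [hij]
    · simp [hij, cutSep, h i _ (ha i j hij), h j _ (hb i j hij)]
  have hL : ∀ S, (ℓ - (8 : ℝ) • m) (cutVec G S) ≤ 12 := by
    intro S
    by_cases hS : ∀ i, ∀ u ∈ B i, ∀ v ∈ B i, (u ∈ S ↔ v ∈ S)
    · have h : ∀ i, ∀ u ∈ B i, (u ∈ S ↔ i ∈ Finset.univ.filter fun i => (hne i).some ∈ S) :=
        fun i u hu => by simpa using hS i u hu _ (hne i).some_mem
      rw [hconst S _ h]
      set n := (Finset.univ.filter fun i => (hne i).some ∈ S).card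
      have hn : n ≤ 2 ∨ 3 ≤ n := by omega
      rcases hn with hn | hn
      · have : (n : ℝ) ≤ 2 := by exact_mod_cast hn
        nlinarith
      · have : (3 : ℝ) ≤ n := by exact_mod_cast hn
        nlinarith
    · push Not at hS
      obtain ⟨i, u, hu, v, hv, huv⟩ := hS
      have hcross : ∃ x ∈ B i, ∃ y ∈ B i, G.Adj x y ∧ cutSep S x y = 1 := by
        have hBi := ConnectedOn.of_connected_induce (hconn i)
        rcases huv with ⟨h1, h2⟩ | ⟨h1, h2⟩
        · obtain ⟨x, hx, hxS, y, hy, hyS, hxy⟩ := hBi.exists_crossing hu h1 hv h2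
          exact ⟨x, hx, y, hy, hxy, by simp [cutSep, hxS, hyS]⟩
        · obtain ⟨x, hx, hxS, y, hy, hyS, hxy⟩ := hBi.exists_crossing hv h2 hu h1
          exact ⟨x, hx, y, hy, hxy, by simp [cutSep, hxS, hyS]⟩
      obtain ⟨x, hx, y, hy, hxy, hxy1⟩ := hcross
      have hnn : ∀ i u v, 0 ≤ if u ∈ B i ∧ v ∈ B i ∧ G.Adj u v then cutSep S u v else 0 := by
        intro i u v
        split_ifs
        exacts [(hsep S u v).1, le_rfl]
      have hm1 : 1 ≤ m (cutVec G S) := by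
        rw [hm]
        refine le_trans ?_ (Finset.single_le_sum (fun i _ => Finset.sum_nonneg fun u _ =>
          Finset.sum_nonneg fun v _ => hnn i u v) (Finset.mem_univ i))
        refine le_trans ?_ (Finset.single_le_sum (fun u _ =>
          Finset.sum_nonneg fun v _ => hnn i u v) (Finset.mem_univ x))
        refine le_trans ?_ (Finset.single_le_sum (fun v _ => hnn i x v) (Finset.mem_univ y))
        rw [if_pos ⟨hx, hy, hxy⟩, hxy1]
      have hℓ20 : ℓ (cutVec G S) ≤ 20 := by
        rw [hℓ]
        calc _ ≤ ∑ i : Fin 5, ∑ j : Fin 5, if i = j then (0 : ℝ) else 1 := by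
              refine Finset.sum_le_sum fun i _ => Finset.sum_le_sum fun j _ => ?_
              split_ifs
              exacts [le_rfl, (hsep _ _ _).2]
          _ = 20 := by simp [Fin.sum_univ_five]; norm_num
      simp only [LinearMap.sub_apply, LinearMap.smul_apply, smul_eq_mul]
      linarith
  let P : Finset (Fin 5) → Set V := fun σ => ⋃ i ∈ σ, B i
  have hP : ∀ σ, ∀ i, ∀ u ∈ B i, (u ∈ P σ ↔ i ∈ σ) := by
    intro σ i u hu
    simp only [P, Set.mem_iUnion, exists_prop]
    refine ⟨fun ⟨j, hj, huj⟩ => ?_, fun h => ⟨i, h, hu⟩⟩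
    by_contra h
    exact Set.disjoint_left.1 (hdisj i j fun hij => h (hij ▸ hj)) hu huj
  obtain ⟨φ, c, h01, h0, h1⟩ := hC.exists_cut_functional hL (T := P {0, 1}) (S₀ := P ∅)
    (by rw [hconst _ _ (hP _)]; norm_num) (by rw [hconst _ _ (hP _)]; norm_num)
  have hpair : ∀ i j, i ≠ j → φ (cutVec G (B i ∪ B j)) + c = 0 := by
    intro i j hij
    have := h0 (P {i, j}) (by rw [hconst _ _ (hP _), Finset.card_pair hij]; norm_num)
    simpa [P] using this
  have htriple : ∀ i j k, i ≠ j → j ≠ k → i ≠ k →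
      φ (cutVec G (B i)) + c + (φ (cutVec G (B j)) + c) + (φ (cutVec G (B k)) + c) = 1 := by
    intro i j k hij hjk hik
    have h3 := h0 (P {i, j, k}) (by
      rw [hconst _ _ (hP _), Finset.card_eq_three.2 ⟨i, j, k, hij, hik, hjk, rfl⟩]; norm_num)
    have hid := congrArg φ (cutVec_union_union (G := G) (hdisj i j hij) (hdisj j k hjk)
      (hdisj i k hik))
    simp only [map_add] at hid
    have e3 : P {i, j, k} = B i ∪ B j ∪ B k := by simp [P, Set.union_assoc]
    have e0 : P ∅ = ∅ := by simp [P]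
    rw [e3] at h3
    rw [e0] at h1
    linarith [hpair i j hij, hpair j k hjk, hpair i k hik]
  have t1 := htriple 0 1 2 (by decide) (by decide) (by decide)
  have t2 := htriple 0 1 3 (by decide) (by decide) (by decide)
  have t3 := htriple 0 2 3 (by decide) (by decide) (by decide)
  have t4 := htriple 1 2 3 (by decide) (by decide) (by decide)
  rcases h01 (B 0) with h | h <;> linarith

lemma cutSep_le_sum (S : Set V) (p : ℕ → V) (n : ℕ) :
    cutSep S (p 0) (p n) ≤ ∑ i ∈ Finset.range n, cutSep S (p i) (p (i + 1)) := by
  induction n with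
  | zero => simp [cutSep]
  | succ n ih =>
    rw [Finset.sum_range_succ]
    have : cutSep S (p 0) (p (n + 1)) ≤ cutSep S (p 0) (p n) + cutSep S (p n) (p (n + 1)) := by
      unfold cutSep
      by_cases p 0 ∈ S <;> by_cases p n ∈ S <;> by_cases p (n + 1) ∈ S <;> simp [*]
    linarith

lemma cutSep_eq_sum {S : Set V} {p : ℕ → V} {n j : ℕ} (h : ∀ i ≤ n, (p i ∈ S ↔ i < j)) :
    cutSep S (p 0) (p n) = ∑ i ∈ Finset.range n, cutSep S (p i) (p (i + 1)) := by
  have hterm : ∀ i ∈ Finset.range n, cutSep S (p i) (p (i + 1)) = if i + 1 = j then 1 else 0 := by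
    intro i hi
    rw [Finset.mem_range] at hi
    rw [cutSep, h i hi.le, h (i + 1) hi]
    split_ifs <;> first | rfl | omega
  rw [Finset.sum_congr rfl hterm, cutSep, h 0 (Nat.zero_le n), h n le_rfl]
  rcases Nat.eq_zero_or_pos j with rfl | hj
  · simp
  · obtain ⟨j, rfl⟩ : ∃ i, j = i + 1 := ⟨j - 1, by omega⟩
    simp only [Nat.add_right_cancel_iff, Finset.sum_ite_eq', Finset.mem_range]
    split_ifs <;> first | rfl | omega

lemma IsCompressed.false_of_hole [Finite V] (hC : IsCompressed (Set.range (cutVec G)))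
    {n : ℕ} (hn : 4 ≤ n) {p : ℕ → V} (hinj : ∀ i ≤ n, ∀ j ≤ n, p i = p j → i = j)
    (hadj : ∀ i j, i < j → j ≤ n → (G.Adj (p i) (p j) ↔ j = i + 1 ∨ (i = 0 ∧ j = n))) : False := by
  let L : (G.edgeSet → ℝ) →ₗ[ℝ] ℝ :=
    edgeCoord G (p 0) (p n) - ∑ i ∈ Finset.range n, edgeCoord G (p i) (p (i + 1))
  have hL : ∀ S, L (cutVec G S) =
      cutSep S (p 0) (p n) - ∑ i ∈ Finset.range n, cutSep S (p i) (p (i + 1)) := by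
    intro S
    simp only [L, LinearMap.sub_apply, LinearMap.sum_apply]
    rw [edgeCoord_cutVec ((hadj 0 n (by omega) le_rfl).2 (Or.inr ⟨rfl, rfl⟩))]
    congr 1
    refine Finset.sum_congr rfl fun i hi => ?_
    rw [Finset.mem_range] at hi
    exact edgeCoord_cutVec ((hadj i (i + 1) (by omega) hi).2 (Or.inl rfl)) S
  let P : Set ℕ → Set V := fun I => p '' (I ∩ Set.Iic n)
  have hP : ∀ I, ∀ i ≤ n, (p i ∈ P I ↔ i ∈ I) := by
    intro I i hi
    refine ⟨?_, fun h => ⟨i, ⟨h, hi⟩, rfl⟩⟩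
    rintro ⟨j, ⟨hjI, hj⟩, hji⟩
    rwa [← hinj j hj i hi hji]
  have hinit : ∀ j, L (cutVec G (P (Set.Iio j))) = 0 := by
    intro j
    rw [hL, cutSep_eq_sum (S := P (Set.Iio j)) (j := j) fun i hi => hP _ i hi, sub_self]
  have hfinal : ∀ j, L (cutVec G (P (Set.Ici j))) = 0 := by
    intro j
    rw [hL]
    have h := cutSep_eq_sum (S := (P (Set.Ici j))ᶜ) (p := p) (n := n) (j := j) fun i hi => by
      rw [Set.mem_compl_iff, hP _ i hi, Set.mem_Ici, not_le]
    simp only [cutSep_compl] at h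
    rw [h, sub_self]
  have hneg : L (cutVec G (P {1, 3})) < 0 := by
    rw [hL]
    have h := cutSep_le_sum (P {1, 3}) (fun i => p (i + 1)) (n - 1)
    have e0 : cutSep (P {1, 3}) (p 0) (p n) = 0 := by
      have h0 := hP {1, 3} 0 (by omega)
      have h1 := hP {1, 3} n le_rfl
      simp only [Set.mem_insert_iff, Set.mem_singleton_iff] at h0 h1
      rw [cutSep, if_pos (by rw [h0, h1]; omega)]
    have e1 : cutSep (P {1, 3}) (p 0) (p 1) = 1 := by
      have h0 := hP {1, 3} 0 (by omega)
      have h1 := hP {1, 3} 1 (by omega)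
      simp at h0 h1
      simp [cutSep, h0, h1]
    have := Finset.single_le_sum (f := fun i => cutSep (P {1, 3}) (p i) (p (i + 1)))
      (s := Finset.range n) (fun i _ => by dsimp only [cutSep]; split_ifs <;> norm_num)
      (Finset.mem_range.2 (by omega : 0 < n))
    simp only [zero_add] at this
    linarith
  obtain ⟨φ, c, h01, h0, h1⟩ := hC.exists_cut_functional (L := L) (β := 0)
    (fun S => by rw [hL]; linarith [cutSep_le_sum S p n]) (hinit 0) hneg
  have hmod : ∀ X Y Z : Set ℕ, Disjoint X Y → Disjoint Y Z → (∀ i ∈ X, ∀ j ∈ Z, j ≤ n → i + 1 < j) →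
      (0 ∉ X ∨ n ∉ Z) → φ (cutVec G (P (X ∪ Y ∪ Z))) + φ (cutVec G (P Y)) =
        φ (cutVec G (P (X ∪ Y))) + φ (cutVec G (P (Y ∪ Z))) := by
    intro X Y Z hXY hYZ hXZ hend
    have hdisj : ∀ I J : Set ℕ, (∀ i ∈ I, ∀ j ∈ J, i ≤ n → j ≤ n → i ≠ j) →
        Disjoint (P I) (P J) := by
      intro I J hIJ
      rw [Set.disjoint_left]
      rintro _ ⟨i, ⟨hi, hin⟩, rfl⟩ hj
      rw [hP _ i hin] at hj
      exact hIJ i hi i hj hin hin rfl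
    have hunion : ∀ I J : Set ℕ, P (I ∪ J) = P I ∪ P J := by
      intro I J
      simp only [P, Set.union_inter_distrib_right, Set.image_union]
    simp only [hunion, ← map_add]
    congr 1
    refine cutVec_union_add
      (hdisj _ _ fun i hi j hj _ _ hij => Set.disjoint_left.1 hXY hi (hij ▸ hj))
      (hdisj _ _ fun i hi j hj _ _ hij => Set.disjoint_left.1 hYZ hi (hij ▸ hj))
      (hdisj _ _ fun i hi j hj _ hj' hij => by have := hXZ i hi j hj hj'; omega) ?_
    rintro _ ⟨i, ⟨hi, hin⟩, rfl⟩ _ ⟨j, ⟨hj, hjn⟩, rfl⟩ h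
    have hij := hXZ i hi j hj hjn
    rw [hadj i j (by omega) hjn] at h
    rcases h with h | ⟨rfl, rfl⟩
    · omega
    · tauto
  have hstep : ∀ i, 1 ≤ i → i + 2 ≤ n → φ (cutVec G (P {i})) = φ (cutVec G (P {i + 1})) := by
    intro i hi1 hi2
    have a1 := hmod (Set.Iio i) {i} {i + 1} (by simp) (by simp)
      (fun x hx y hy _ => by simp at hx hy; omega) (Or.inr (by simp; omega))
    have a2 := hmod {i} {i + 1} (Set.Ici (i + 2)) (by simp) (by simp)
      (fun x hx y hy _ => by simp at hx hy; omega) (Or.inl (by simp; omega))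
    have b1 : Set.Iio i ∪ {i} ∪ {i + 1} = Set.Iio (i + 2) := by ext; simp; omega
    have b2 : Set.Iio i ∪ {i} = Set.Iio (i + 1) := by
      ext
      simp only [Set.mem_union, Set.mem_Iio, Set.mem_singleton_iff]
      omega
    have b3 : {i} ∪ {i + 1} ∪ Set.Ici (i + 2) = Set.Ici i := by ext; simp; omega
    have b4 : {i + 1} ∪ Set.Ici (i + 2) = Set.Ici (i + 1) := by ext; simp; omega
    rw [b1, b2] at a1
    rw [b3, b4] at a2
    linarith [h0 _ (hinit (i + 2)), h0 _ (hinit (i + 1)), h0 _ (hfinal i), h0 _ (hfinal (i + 1))]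
  have h13 := hmod {1} ∅ {3} (by simp) (by simp) (by simp) (Or.inl (by simp))
  have e13 : ({1} ∪ ∅ ∪ {3} : Set ℕ) = {1, 3} := by ext; simp [or_comm]
  rw [e13, Set.union_empty, Set.empty_union] at h13
  have hemp := h0 _ (hinit 0)
  have e0 : (Set.Iio 0 : Set ℕ) = ∅ := by ext; simp
  rw [e0] at hemp
  have s1 := hstep 1 le_rfl (by omega)
  have s2 := hstep 2 (by omega) (by omega)
  norm_num at s1 s2
  rcases h01 (P {1}) with h | h <;> linarith

lemma IsCompressed.inducedCyclesLe4 [Finite V] (hC : IsCompressed (Set.range (cutVec G))) :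
    InducedCyclesLe4 G := by
  intro k hk v hv hadj
  by_contra! h
  have hcast : ∀ i j : ℕ, i < k → j < k → (i : ZMod k) = j → i = j := by
    intro i j hi hj hij
    rw [ZMod.natCast_eq_natCast_iff', Nat.mod_eq_of_lt hi, Nat.mod_eq_of_lt hj] at hij
    exact hij
  refine hC.false_of_hole (n := k - 1) (by omega) (p := fun i => v i)
    (fun i hi j hj hij => hcast i j (by omega) (by omega) (hv hij)) fun i j hij hj => ?_
  rw [hadj, sub_eq_iff_eq_add', sub_eq_iff_eq_add']
  constructor
  · rintro (h' | h')
    · rcases Nat.lt_or_ge (j + 1) k with hjk | hjk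
      · have := hcast i (j + 1) (by omega) hjk (by push_cast; exact h')
        omega
      · have hjk : j + 1 = k := by omega
        have := hcast i 0 (by omega) (by omega) (by
          rw [h']
          rw [← Nat.cast_add_one, hjk, ZMod.natCast_self, Nat.cast_zero])
        omega
    · have := hcast j (i + 1) (by omega) (by omega) (by push_cast; exact h')
      omega
  · rintro (rfl | ⟨rfl, rfl⟩)
    · right
      push_cast
      rfl
    · left
      have := ZMod.natCast_self k
      rw [Nat.cast_sub (by omega), this]
      simp

end Necessity

/-- Theorem 3.6: the cut polytope of a finite simple graph `G` is compressed if and only if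
`G` has no `K₅` minor and every induced cycle in `G` has length at most `4`. -/
theorem cutPolytope_compressed_iff
    {V : Type*} [Fintype V] (G : SimpleGraph V) :
    IsCompressed (Set.range (cutVec G)) ↔ ¬ HasK5Minor G ∧ InducedCyclesLe4 G := ⟨fun h => ⟨h.not_hasK5Minor, h.inducedCyclesLe4⟩,
      fun h => isCompressed_cutVec h.1 h.2⟩
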